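/- Let Λ be a finite dimensional algebra over an algebraically closed field k such that the set of indecomposable Λ-modules is a disjoint union P ∪ R ∪ Q, where R is a family of stable standard pairwise orthogonal tubes, Hom_Λ(R, P) = 0, Hom_Λ(Q, R) = 0 and Hom_Λ(Q, P) = 0. If some tube in R has rank r ≥ 2, then ftors Λ is neither a join-semilattice nor a meet-semilattice. -/

import Mathlib

noncomputable section

namespace TorsionLattice


/-! ### Posets: meets and joins (as unique maximal/minimal bounds), semilattices -/

section Posets

variable {P : Type*} [PartialOrder P]

/-- `m` is a maximal element of the subset `S`. -/
def MaximalIn (S : Set P) (m : P) : Prop := m ∈ S ∧ ∀ y ∈ S, m ≤ y → y = m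

/-- `m` is a minimal element of the subset `S`. -/
def MinimalIn (S : Set P) (m : P) : Prop := m ∈ S ∧ ∀ y ∈ S, y ≤ m → y = m

/-- `m` is a meet of `S` : the unique maximal element of the set of lower bounds of `S`. -/
def IsMeetOf (S : Set P) (m : P) : Prop :=
  MaximalIn (lowerBounds S) m ∧ ∀ y, MaximalIn (lowerBounds S) y → y = m

/-- `m` is a join of `S` : the unique minimal element of the set of upper bounds of `S`. -/
def IsJoinOf (S : Set P) (m : P) : Prop :=
  MinimalIn (upperBounds S) m ∧ ∀ y, MinimalIn (upperBounds S) y → y = m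

def HasMeet (S : Set P) : Prop := ∃ m, IsMeetOf S m

def HasJoin (S : Set P) : Prop := ∃ m, IsJoinOf S m

end Posets

/-- Every finite subset has a meet. -/
def IsMeetSemilatticePoset (P : Type*) [PartialOrder P] : Prop :=
  ∀ S : Set P, S.Finite → HasMeet S

/-- Every finite subset has a join. -/
def IsJoinSemilatticePoset (P : Type*) [PartialOrder P] : Prop :=
  ∀ S : Set P, S.Finite → HasJoin S

def IsLatticePoset (P : Type*) [PartialOrder P] : Prop :=
  IsJoinSemilatticePoset P ∧ IsMeetSemilatticePoset P

def IsCompleteMeetSemilatticePoset (P : Type*) [PartialOrder P] : Prop :=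
  ∀ S : Set P, HasMeet S

def IsCompleteJoinSemilatticePoset (P : Type*) [PartialOrder P] : Prop :=
  ∀ S : Set P, HasJoin S

def IsCompleteLatticePoset (P : Type*) [PartialOrder P] : Prop :=
  ∀ S : Set P, HasMeet S ∧ HasJoin S

def PreservesMeets {P Q : Type*} [PartialOrder P] [PartialOrder Q] (f : P → Q) : Prop :=
  ∀ (S : Set P) (m : P), IsMeetOf S m → IsMeetOf (f '' S) (f m)

def PreservesJoins {P Q : Type*} [PartialOrder P] [PartialOrder Q] (f : P → Q) : Prop :=
  ∀ (S : Set P) (m : P), IsJoinOf S m → IsJoinOf (f '' S) (f m)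

/-! ### Torsion classes in `mod Λ`

We model the category `mod Λ` of finite dimensional (equivalently, finitely generated)
`Λ`-modules by the objects of `ModuleCat.{0} Λ` satisfying `Module.Finite Λ`.
Subcategories closed under isomorphisms are modelled as sets of objects. -/

section Torsion

variable (Λ : Type) [Ring Λ]

/-- `0 → X → Y → Z → 0` is a short exact sequence. -/
def IsSES {X Y Z : Type} [AddCommGroup X] [Module Λ X] [AddCommGroup Y] [Module Λ Y]
    [AddCommGroup Z] [Module Λ Z] (f : X →ₗ[Λ] Y) (g : Y →ₗ[Λ] Z) : Prop :=
  Function.Injective f ∧ Function.Surjective g ∧ LinearMap.range f = LinearMap.ker g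

/-- All members of `C` are finite (equivalently, finite dimensional) modules,
i.e. `C` is a subcategory of `mod Λ`. -/
def FinMods (C : Set (ModuleCat.{0} Λ)) : Prop := ∀ X ∈ C, Module.Finite Λ X

/-- `C` is closed under factor modules (in particular under isomorphisms). -/
def QuotClosed (C : Set (ModuleCat.{0} Λ)) : Prop :=
  ∀ X ∈ C, ∀ (Y : ModuleCat.{0} Λ) (f : ↥X →ₗ[Λ] ↥Y), Function.Surjective f → Y ∈ C

/-- `C` is closed under submodules (in particular under isomorphisms). -/
def SubClosed (C : Set (ModuleCat.{0} Λ)) : Prop :=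
  ∀ X ∈ C, ∀ (Y : ModuleCat.{0} Λ) (f : ↥Y →ₗ[Λ] ↥X), Function.Injective f → Y ∈ C

/-- `C` is closed under extensions. -/
def ExtClosed (C : Set (ModuleCat.{0} Λ)) : Prop :=
  ∀ (X Y Z : ModuleCat.{0} Λ) (f : ↥X →ₗ[Λ] ↥Y) (g : ↥Y →ₗ[Λ] ↥Z),
    IsSES Λ f g → X ∈ C → Z ∈ C → Y ∈ C

/-- A torsion class in `mod Λ`: a class of finite dimensional modules closed under
factor modules, isomorphisms and extensions. -/
def IsTorsionClass (C : Set (ModuleCat.{0} Λ)) : Prop :=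
  FinMods Λ C ∧ QuotClosed Λ C ∧ ExtClosed Λ C

/-- A torsionfree class in `mod Λ`: a class of finite dimensional modules closed under
submodules, isomorphisms and extensions. -/
def IsTorsionFreeClass (C : Set (ModuleCat.{0} Λ)) : Prop :=
  FinMods Λ C ∧ SubClosed Λ C ∧ ExtClosed Λ C

/-- `Fac X`: factor modules of finite direct sums of copies of `X`. -/
def Fac (X : ModuleCat.{0} Λ) : Set (ModuleCat.{0} Λ) :=
  {Y | ∃ (n : ℕ) (f : (Fin n → ↥X) →ₗ[Λ] ↥Y), Function.Surjective f}

/-- `C` is of the form `Fac X` for a finite dimensional module `X`; for a torsion class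
this means precisely that `C` is functorially finite in `mod Λ`. -/
def IsFacFinite (C : Set (ModuleCat.{0} Λ)) : Prop :=
  ∃ X : ModuleCat.{0} Λ, Module.Finite Λ X ∧ C = Fac Λ X

/-- A functorially finite torsion class in `mod Λ`. -/
def IsFTorsionClass (C : Set (ModuleCat.{0} Λ)) : Prop :=
  IsTorsionClass Λ C ∧ IsFacFinite Λ C

/-- The poset `tors Λ` of torsion classes, ordered by inclusion. -/
abbrev Tors := {C : Set (ModuleCat.{0} Λ) // IsTorsionClass Λ C}

/-- The poset `torf Λ` of torsionfree classes, ordered by inclusion. -/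
abbrev Torf := {C : Set (ModuleCat.{0} Λ) // IsTorsionFreeClass Λ C}

/-- The poset `ftors Λ` of functorially finite torsion classes, ordered by inclusion. -/
abbrev FTors := {C : Set (ModuleCat.{0} Λ) // IsFTorsionClass Λ C}

/-- `C^⊥ = {X ∈ mod Λ ∣ Hom(C, X) = 0}`. -/
def rperp (C : Set (ModuleCat.{0} Λ)) : Set (ModuleCat.{0} Λ) :=
  {X | Module.Finite Λ X ∧ ∀ T ∈ C, ∀ f : ↥T →ₗ[Λ] ↥X, f = 0}

/-- `^⊥C = {X ∈ mod Λ ∣ Hom(X, C) = 0}`. -/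
def lperp (C : Set (ModuleCat.{0} Λ)) : Set (ModuleCat.{0} Λ) :=
  {X | Module.Finite Λ X ∧ ∀ T ∈ C, ∀ f : ↥X →ₗ[Λ] ↥T, f = 0}

/-- The intersection, inside `mod Λ`, of a family of subcategories of `mod Λ`. -/
def interMod (𝒮 : Set (Set (ModuleCat.{0} Λ))) : Set (ModuleCat.{0} Λ) :=
  {X | Module.Finite Λ X ∧ ∀ C ∈ 𝒮, X ∈ C}

/-- `Hom_Λ(X, Y) = 0`. -/
def HomZero (X Y : ModuleCat.{0} Λ) : Prop := ∀ f : ↥X →ₗ[Λ] ↥Y, f = 0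

/-- `X` is an indecomposable module: it is nonzero and its endomorphism ring has no
nontrivial idempotents. -/
def Indecomp (X : ModuleCat.{0} Λ) : Prop :=
  Nontrivial ↥X ∧ ∀ e : ↥X →ₗ[Λ] ↥X, e ∘ₗ e = e → e = 0 ∨ e = LinearMap.id

/-- `Ext¹_Λ(X, Y) ≠ 0` : there is a non-split short exact sequence `0 → Y → E → X → 0`. -/
def Ext1Nonzero (X Y : ModuleCat.{0} Λ) : Prop :=
  ∃ (E : ModuleCat.{0} Λ) (f : ↥Y →ₗ[Λ] ↥E) (g : ↥E →ₗ[Λ] ↥X),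
    IsSES Λ f g ∧ ¬∃ s : ↥X →ₗ[Λ] ↥E, g ∘ₗ s = LinearMap.id

/-- `X` is rigid : `Ext¹_Λ(X, X) = 0`. -/
def IsRigid (X : ModuleCat.{0} Λ) : Prop := ¬ Ext1Nonzero Λ X X

end Torsion

section Tubes

variable (k : Type) [Field k]

/-- The shift of a representation of the cyclic quiver with vertex set `ZMod r`:
apply all the arrow maps simultaneously. -/
def cshift {r : ℕ} (V : ZMod r → Type) [∀ i, AddCommGroup (V i)] [∀ i, Module k (V i)]
    (g : ∀ i, V i →ₗ[k] V (i + 1)) : (∀ i, V i) → (∀ i, V i) :=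
  fun w i => (show i - 1 + 1 = i by ring) ▸ (g (i - 1) (w (i - 1)))

/-- A finite dimensional nilpotent representation of the cyclic quiver with `r` vertices;
these form the serial abelian category to which a standard stable tube of rank `r`
(equivalently, the mesh category of `ℤA_∞/(τ^r)`) is equivalent. -/
structure CycRep (r : ℕ) : Type 1 where
  V : ZMod r → Type
  [acg : ∀ i, AddCommGroup (V i)]
  [mods : ∀ i, Module k (V i)]
  g : ∀ i, V i →ₗ[k] V (i + 1)
  fin : ∀ i, Module.Finite k (V i)
  nilp : ∃ n : ℕ, ∀ w : (∀ i, V i), (cshift k V g)^[n] w = fun _ => 0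

attribute [instance] CycRep.acg CycRep.mods

/-- Morphisms of representations of the cyclic quiver. -/
structure CycHom {r : ℕ} (X Y : CycRep k r) : Type where
  φ : ∀ i, X.V i →ₗ[k] Y.V i
  comm : ∀ i (v : X.V i), φ (i + 1) (X.g i v) = Y.g i (φ i v)

def CycHom.comp {r : ℕ} {X Y Z : CycRep k r} (g : CycHom k Y Z) (f : CycHom k X Y) :
    CycHom k X Z :=
  ⟨fun i => (g.φ i).comp (f.φ i), fun i v => by simp [f.comm i v, g.comm i (f.φ i v)]⟩

instance {r : ℕ} (X Y : CycRep k r) : Add (CycHom k X Y) :=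
  ⟨fun f g => ⟨fun i => f.φ i + g.φ i, fun i v => by simp [f.comm i v, g.comm i v]⟩⟩

instance {r : ℕ} (X Y : CycRep k r) : SMul k (CycHom k X Y) :=
  ⟨fun c f => ⟨fun i => c • f.φ i, fun i v => by simp [f.comm i v]⟩⟩

variable (Λ : Type) [Ring Λ] [Algebra k Λ]

/-- `add S`: all modules isomorphic to finite direct sums of modules in `S`. -/
def AddOfSet (S : Set (ModuleCat.{0} Λ)) : Set (ModuleCat.{0} Λ) :=
  {Y | ∃ (n : ℕ) (C : Fin n → ModuleCat.{0} Λ), (∀ i, C i ∈ S) ∧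
    Nonempty (↥Y ≃ₗ[Λ] ((i : Fin n) → ↥(C i)))}

/-- `R` is a standard stable tube of rank `r`: a class of finite dimensional
indecomposable modules, closed under isomorphism, containing no projective and no
injective module (stability), whose additive closure is equivalent, via an additive
`k`-linear fully faithful functor `Φ`, to the category of finite dimensional nilpotent
representations of the cyclic quiver with `r` vertices (the mesh category
`k(ℤA_∞/(τ^r))`, which makes the tube standard of rank `r`). -/
def IsStandardStableTube (R : Set (ModuleCat.{0} Λ)) (r : ℕ) : Prop :=
  1 ≤ r ∧
  (∀ X ∈ R, Module.Finite Λ X ∧ Indecomp Λ X ∧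
    ¬ Module.Projective Λ X ∧ ¬ Module.Injective Λ ↥X) ∧
  (∀ X ∈ R, ∀ Y : ModuleCat.{0} Λ, Nonempty (↥X ≃ₗ[Λ] ↥Y) → Y ∈ R) ∧
  ∃ (Φ : CycRep k r → ModuleCat.{0} Λ)
    (Φh : ∀ {X Y : CycRep k r}, CycHom k X Y → (↥(Φ X) →ₗ[Λ] ↥(Φ Y))),
    (∀ X, Φ X ∈ AddOfSet Λ R) ∧
    (∀ Y ∈ AddOfSet Λ R, ∃ X, Nonempty (↥(Φ X) ≃ₗ[Λ] ↥Y)) ∧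
    (∀ X Y : CycRep k r, Function.Bijective (fun f : CycHom k X Y => Φh f)) ∧
    (∀ (X Y : CycRep k r) (f g : CycHom k X Y), Φh (f + g) = Φh f + Φh g) ∧
    (∀ (X Y : CycRep k r) (c : k) (f : CycHom k X Y) (m : ↥(Φ X)),
      Φh (c • f) m = algebraMap k Λ c • Φh f m) ∧
    (∀ (X Y Z : CycRep k r) (f : CycHom k X Y) (g : CycHom k Y Z),
      Φh (CycHom.comp k g f) = (Φh g).comp (Φh f))

end Tubes

set_option linter.unusedSectionVars false

section Basics

variable {A : Type} [Ring A]

/-- The module `X` belongs to the class `T`. -/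
def Has (T : Set (ModuleCat.{0} A)) (X : Type) [AddCommGroup X] [Module A X] : Prop :=
  ModuleCat.of A X ∈ T

/-- The finite modules cogenerated by `N`. -/
def Sub (N : ModuleCat.{0} A) : Set (ModuleCat.{0} A) :=
  {Y | Module.Finite A Y ∧ ∃ (n : ℕ) (f : ↥Y →ₗ[A] (Fin n → ↥N)), Function.Injective f}

variable {T F : Set (ModuleCat.{0} A)}
variable {X Y Z : Type} [AddCommGroup X] [Module A X] [AddCommGroup Y] [Module A Y]
  [AddCommGroup Z] [Module A Z]

theorem ExtClosed.pi (hE : ExtClosed A T)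
    (h0 : ∀ (X : Type) [AddCommGroup X] [Module A X] [Subsingleton X], Has T X) :
    ∀ (n : ℕ) (X : Fin n → Type) [∀ i, AddCommGroup (X i)] [∀ i, Module A (X i)],
      (∀ i, Has T (X i)) → Has T (∀ i, X i)
  | 0, X, _, _, _ => h0 _
  | n + 1, X, _, _, h => by
    have ih := ExtClosed.pi hE h0 n (fun i => X i.succ) (fun i => h i.succ)
    let f : (∀ i : Fin n, X i.succ) →ₗ[A] (∀ i, X i) :=
      LinearMap.pi (fun i => Fin.cases 0 (fun i => LinearMap.proj i) i)
    refine hE (ModuleCat.of A (∀ i : Fin n, X i.succ)) (ModuleCat.of A (∀ i, X i))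
      (ModuleCat.of A (X 0)) f (LinearMap.proj 0) ⟨?_, ?_, ?_⟩ ih (h 0)
    · intro a b hab
      funext i
      have := congrFun hab i.succ
      simpa [f] using this
    · exact LinearMap.proj_surjective 0
    · ext x
      simp only [LinearMap.mem_range, LinearMap.mem_ker]
      constructor
      · rintro ⟨y, rfl⟩
        simp [f]
      · intro hx
        refine ⟨fun i => x i.succ, ?_⟩
        funext i
        refine Fin.cases ?_ (fun i => ?_) i
        · simpa [f] using (Eq.symm hx)
        · simp [f]

theorem IsTorsionClass.finite (hT : IsTorsionClass A T) (hX : Has T X) : Module.Finite A X :=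
  hT.1 _ hX

theorem IsTorsionClass.quot (hT : IsTorsionClass A T) (hX : Has T X) (f : X →ₗ[A] Y)
    (hf : Function.Surjective f) : Has T Y :=
  hT.2.1 (ModuleCat.of A X) hX (ModuleCat.of A Y) f hf

theorem IsTorsionClass.range (hT : IsTorsionClass A T) (hX : Has T X) (f : X →ₗ[A] Y) :
    Has T (LinearMap.range f) :=
  hT.quot hX f.rangeRestrict f.surjective_rangeRestrict

theorem IsTorsionClass.equiv (hT : IsTorsionClass A T) (hX : Has T X) (e : X ≃ₗ[A] Y) : Has T Y :=
  hT.quot hX e.toLinearMap e.surjective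

theorem ExtClosed.ses (hE : ExtClosed A T) (f : X →ₗ[A] Y) (g : Y →ₗ[A] Z)
    (hf : Function.Injective f) (hg : Function.Surjective g)
    (h : LinearMap.range f = LinearMap.ker g) (hX : Has T X) (hZ : Has T Z) : Has T Y :=
  hE (ModuleCat.of A X) (ModuleCat.of A Y) (ModuleCat.of A Z) f g ⟨hf, hg, h⟩ hX hZ

theorem ExtClosed.of_ker (hE : ExtClosed A T) (g : Y →ₗ[A] Z) (hg : Function.Surjective g)
    (h1 : Has T (LinearMap.ker g)) (h2 : Has T Z) : Has T Y :=
  hE.ses (LinearMap.ker g).subtype g (Submodule.subtype_injective _) hg (by simp) h1 h2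

theorem ExtClosed.of_sub (hE : ExtClosed A T) (S : Submodule A X) (h1 : Has T S)
    (h2 : Has T (X ⧸ S)) : Has T X :=
  hE.ses S.subtype S.mkQ S.subtype_injective S.mkQ_surjective (by simp) h1 h2

theorem IsTorsionClass.zero (hT : IsTorsionClass A T) (hne : T.Nonempty) [Subsingleton X] :
    Has T X := by
  obtain ⟨M, hM⟩ := hne
  exact hT.quot (X := M) hM (0 : M →ₗ[A] X) fun x => ⟨0, Subsingleton.elim _ _⟩

theorem IsTorsionClass.pi (hT : IsTorsionClass A T) (hne : T.Nonempty) {n : ℕ} {X : Fin n → Type}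
    [∀ i, AddCommGroup (X i)] [∀ i, Module A (X i)] (h : ∀ i, Has T (X i)) : Has T (∀ i, X i) :=
  ExtClosed.pi hT.2.2 (fun _ _ _ _ => hT.zero hne) n X h

theorem IsTorsionFreeClass.finite (hF : IsTorsionFreeClass A F) (hX : Has F X) :
    Module.Finite A X :=
  hF.1 _ hX

theorem IsTorsionFreeClass.sub (hF : IsTorsionFreeClass A F) (hX : Has F X) (f : Y →ₗ[A] X)
    (hf : Function.Injective f) : Has F Y :=
  hF.2.1 (ModuleCat.of A X) hX (ModuleCat.of A Y) f hf

theorem IsTorsionFreeClass.equiv (hF : IsTorsionFreeClass A F) (hX : Has F X) (e : X ≃ₗ[A] Y) :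
    Has F Y :=
  hF.sub hX e.symm.toLinearMap e.symm.injective

theorem IsTorsionFreeClass.zero (hF : IsTorsionFreeClass A F) (hne : F.Nonempty)
    [Subsingleton X] : Has F X := by
  obtain ⟨M, hM⟩ := hne
  exact hF.sub (X := M) hM (0 : X →ₗ[A] M) fun x y _ => Subsingleton.elim _ _

theorem IsTorsionFreeClass.pi (hF : IsTorsionFreeClass A F) (hne : F.Nonempty) {n : ℕ}
    {X : Fin n → Type} [∀ i, AddCommGroup (X i)] [∀ i, Module A (X i)] (h : ∀ i, Has F (X i)) :
    Has F (∀ i, X i) :=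
  ExtClosed.pi hF.2.2 (fun _ _ _ _ => hF.zero hne) n X h

theorem has_lperp : Has (lperp A T) X ↔ Module.Finite A X ∧
    ∀ (Y : Type) [AddCommGroup Y] [Module A Y], Has T Y → ∀ f : X →ₗ[A] Y, f = 0 :=
  ⟨fun h => ⟨h.1, fun Y _ _ hY f => h.2 (ModuleCat.of A Y) hY f⟩,
    fun h => ⟨h.1, fun Y hY f => h.2 Y hY f⟩⟩

theorem has_rperp : Has (rperp A T) X ↔ Module.Finite A X ∧
    ∀ (Y : Type) [AddCommGroup Y] [Module A Y], Has T Y → ∀ f : Y →ₗ[A] X, f = 0 :=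
  ⟨fun h => ⟨h.1, fun Y _ _ hY f => h.2 (ModuleCat.of A Y) hY f⟩,
    fun h => ⟨h.1, fun Y hY f => h.2 Y hY f⟩⟩

theorem rperp_nonempty (F : Set (ModuleCat.{0} A)) : (rperp A F).Nonempty :=
  ⟨ModuleCat.of A PUnit, (inferInstance : Module.Finite A PUnit), fun _ _ f => by
    ext x⟩

theorem exists_factor_of_surjective (g : Y →ₗ[A] Z) (hg : Function.Surjective g) {W : Type*}
    [AddCommGroup W] [Module A W] (u : Y →ₗ[A] W) (h : ∀ y, g y = 0 → u y = 0) :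
    ∃ v : Z →ₗ[A] W, ∀ y, v (g y) = u y := by
  have hker : LinearMap.ker g ≤ LinearMap.ker u := h
  let e := g.quotKerEquivOfSurjective hg
  refine ⟨((LinearMap.ker g).liftQ u hker) ∘ₗ e.symm.toLinearMap, fun y => ?_⟩
  have : e.symm (g y) = (LinearMap.ker g).mkQ y := by
    rw [LinearEquiv.symm_apply_eq]
    rfl
  simp [this]

theorem exists_factor_of_injective (f : X →ₗ[A] Y) (hf : Function.Injective f) {W : Type*}
    [AddCommGroup W] [Module A W] (u : W →ₗ[A] Y) (h : ∀ w, u w ∈ LinearMap.range f) :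
    ∃ v : W →ₗ[A] X, ∀ w, f (v w) = u w := by
  let e := LinearEquiv.ofInjective f hf
  refine ⟨e.symm.toLinearMap ∘ₗ (u.codRestrict _ h), fun w => ?_⟩
  have : e (e.symm (u.codRestrict _ h w)) = u.codRestrict _ h w := e.apply_symm_apply _
  exact congrArg Subtype.val this

variable [IsNoetherianRing A]

theorem isTorsionClass_lperp (F : Set (ModuleCat.{0} A)) : IsTorsionClass A (lperp A F) := by
  refine ⟨fun X h => h.1, fun X hX Y f hf => ⟨?_, fun Z hZ g => ?_⟩,
    fun X Y Z f g ⟨hf, hg, hfg⟩ hX hZ => ⟨?_, fun W hW u => ?_⟩⟩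
  · have := hX.1
    exact Module.Finite.of_surjective f hf
  · have := hX.2 Z hZ (g ∘ₗ f)
    ext y
    obtain ⟨x, rfl⟩ := hf y
    simpa using LinearMap.congr_fun this x
  · have h1 := hX.1
    have h2 := hZ.1
    have : IsNoetherian A X := isNoetherian_of_isNoetherianRing_of_finite A X
    have : IsNoetherian A Z := isNoetherian_of_isNoetherianRing_of_finite A Z
    have : IsNoetherian A Y := isNoetherian_of_range_eq_ker f g hfg
    infer_instance
  · have h1 := hX.2 W hW (u ∘ₗ f)
    obtain ⟨v, hv⟩ := exists_factor_of_surjective g hg u fun y hy => by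
      obtain ⟨x, rfl⟩ : y ∈ LinearMap.range f := hfg ▸ hy
      exact LinearMap.congr_fun h1 x
    ext y
    rw [← hv, hZ.2 W hW v]
    rfl

theorem isTorsionFreeClass_rperp (F : Set (ModuleCat.{0} A)) :
    IsTorsionFreeClass A (rperp A F) := by
  refine ⟨fun X h => h.1, fun X hX Y f hf => ⟨?_, fun Z hZ g => ?_⟩,
    fun X Y Z f g ⟨hf, hg, hfg⟩ hX hZ => ⟨?_, fun W hW u => ?_⟩⟩
  · have := hX.1
    exact Module.Finite.of_injective f hf
  · have := hX.2 Z hZ (f ∘ₗ g)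
    ext y
    apply hf
    simpa using LinearMap.congr_fun this y
  · have h1 := hX.1
    have h2 := hZ.1
    have : IsNoetherian A X := isNoetherian_of_isNoetherianRing_of_finite A X
    have : IsNoetherian A Z := isNoetherian_of_isNoetherianRing_of_finite A Z
    have : IsNoetherian A Y := isNoetherian_of_range_eq_ker f g hfg
    infer_instance
  · have h1 := hZ.2 W hW (g ∘ₗ u)
    obtain ⟨v, hv⟩ := exists_factor_of_injective f hf u fun w => by
      rw [hfg]
      exact LinearMap.congr_fun h1 w
    ext w
    rw [← hv, hX.2 W hW v]
    simp

theorem IsTorsionClass.exists_radical (hT : IsTorsionClass A T) (hne : T.Nonempty)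
    (X : Type) [AddCommGroup X] [Module A X] [Module.Finite A X] :
    ∃ S : Submodule A X, Has T S ∧ Has (rperp A T) (X ⧸ S) := by
  have : IsNoetherian A X := isNoetherian_of_isNoetherianRing_of_finite A X
  obtain ⟨S, hS, hmax⟩ := WellFounded.has_min (wellFounded_gt (α := Submodule A X))
    {S | Has T S} ⟨⊥, hT.zero hne⟩
  refine ⟨S, hS, has_rperp.2 ⟨inferInstance, fun Y _ _ hY f => ?_⟩⟩
  let S' : Submodule A X := (LinearMap.range f).comap S.mkQ
  have hSS' : S ≤ S' := fun x hx => by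
    have : S.mkQ x = 0 := (Submodule.Quotient.mk_eq_zero S).2 hx
    exact Submodule.mem_comap.2 (this ▸ zero_mem _)
  have hS' : Has T S' := by
    refine hT.2.2.ses (Submodule.inclusion hSS')
      ((S.mkQ.restrict (p := S') (q := LinearMap.range f) (fun x hx => hx)))
      (Submodule.inclusion_injective _) ?_ ?_ hS (hT.range hY f)
    · rintro ⟨y, hy⟩
      obtain ⟨x, rfl⟩ := S.mkQ_surjective y
      exact ⟨⟨x, hy⟩, rfl⟩
    · ext ⟨x, hx⟩
      simp only [LinearMap.mem_range, LinearMap.mem_ker]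
      constructor
      · rintro ⟨⟨y, hy⟩, h⟩
        have : y = x := congrArg Subtype.val h
        subst this
        apply Subtype.ext
        exact (Submodule.Quotient.mk_eq_zero S).2 hy
      · intro h
        exact ⟨⟨x, (Submodule.Quotient.mk_eq_zero S).1 (congrArg Subtype.val h)⟩, rfl⟩
  have : ¬ S < S' := hmax S' hS'
  have hle : S' ≤ S := by
    by_contra h
    exact this (lt_of_le_not_ge hSS' h)
  ext y
  obtain ⟨x, hx⟩ := S.mkQ_surjective (f y)
  have : x ∈ S' := ⟨y, hx.symm⟩
  rw [← hx]
  exact (Submodule.Quotient.mk_eq_zero S).2 (hle this)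

variable [IsArtinianRing A]

theorem IsTorsionFreeClass.exists_radical (hF : IsTorsionFreeClass A F) (hne : F.Nonempty)
    (X : Type) [AddCommGroup X] [Module A X] [Module.Finite A X] :
    ∃ S : Submodule A X, Has F (X ⧸ S) ∧ Has (lperp A F) S := by
  have : IsArtinian A X := inferInstance
  have : IsNoetherian A X := isNoetherian_of_isNoetherianRing_of_finite A X
  obtain ⟨S, hS, hmax⟩ := WellFounded.has_min (wellFounded_lt (α := Submodule A X))
    {S | Has F (X ⧸ S)} ⟨⊤, hF.zero hne⟩
  refine ⟨S, hS, has_lperp.2 ⟨inferInstance, fun Y _ _ hY f => ?_⟩⟩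
  let S' : Submodule A X := (LinearMap.ker f).map S.subtype
  have hSS' : S' ≤ S := Submodule.map_subtype_le _ _
  have hS' : Has F (X ⧸ S') := by
    refine hF.2.2.of_ker (S'.mapQ S LinearMap.id hSS') ?_ ?_ hS
    · intro y
      obtain ⟨x, rfl⟩ := S.mkQ_surjective y
      exact ⟨S'.mkQ x, rfl⟩
    · have hm : ∀ y : LinearMap.ker (S'.mapQ S LinearMap.id hSS'), ∃ s : S, S'.mkQ s.1 = y.1 := by
        rintro ⟨y, hy⟩
        obtain ⟨x, rfl⟩ := S'.mkQ_surjective y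
        exact ⟨⟨x, (Submodule.Quotient.mk_eq_zero S).1 hy⟩, rfl⟩
      let g : S →ₗ[A] LinearMap.ker (S'.mapQ S LinearMap.id hSS') :=
        LinearMap.codRestrict _ (S'.mkQ ∘ₗ S.subtype)
          (fun s => (Submodule.Quotient.mk_eq_zero S).2 s.2)
      have hg : Function.Surjective g := fun y => by
        obtain ⟨s, hs⟩ := hm y
        exact ⟨s, Subtype.ext hs⟩
      have hk : LinearMap.ker g = LinearMap.ker f := by
        ext s
        constructor
        · intro h
          obtain ⟨t, ht, hts⟩ := (Submodule.Quotient.mk_eq_zero S').1 (congrArg Subtype.val h)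
          have : t = s := Subtype.ext hts
          exact this ▸ ht
        · intro h
          exact Subtype.ext ((Submodule.Quotient.mk_eq_zero S').2 ⟨s, h, rfl⟩)
      let e1 := g.quotKerEquivOfSurjective hg
      let e2 := Submodule.quotEquivOfEq _ _ hk
      let e3 := f.quotKerEquivRange
      exact hF.sub hY ((LinearMap.range f).subtype ∘ₗ e3.toLinearMap ∘ₗ e2.toLinearMap ∘ₗ
        e1.symm.toLinearMap) ((Submodule.subtype_injective _).comp
          (e3.injective.comp (e2.injective.comp e1.symm.injective)))
  have : ¬ S' < S := hmax S' hS'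
  have hle : S ≤ S' := by
    by_contra h
    exact this (lt_of_le_not_ge hSS' h)
  ext s
  obtain ⟨t, ht, hts⟩ := hle s.2
  have : t = s := Subtype.ext hts
  exact this ▸ ht

theorem IsTorsionClass.has_iff (hT : IsTorsionClass A T) (hne : T.Nonempty) :
    Has T X ↔ Has (lperp A (rperp A T)) X := by
  constructor
  · intro h
    exact has_lperp.2 ⟨hT.finite h, fun Y _ _ hY f => (has_rperp.1 hY).2 X h f⟩
  · intro h
    have := (has_lperp.1 h).1
    obtain ⟨S, hS, hS'⟩ := hT.exists_radical hne X
    have h0 := (has_lperp.1 h).2 _ hS' S.mkQ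
    have : S = ⊤ := by rw [← S.ker_mkQ, h0, LinearMap.ker_zero]
    subst this
    exact hT.equiv hS Submodule.topEquiv

theorem IsTorsionFreeClass.has_iff (hF : IsTorsionFreeClass A F) (hne : F.Nonempty) :
    Has F X ↔ Has (rperp A (lperp A F)) X := by
  constructor
  · intro h
    exact has_rperp.2 ⟨hF.finite h, fun Y _ _ hY f => (has_lperp.1 hY).2 X h f⟩
  · intro h
    have := (has_rperp.1 h).1
    obtain ⟨S, hS, hS'⟩ := hF.exists_radical hne X
    have h0 := (has_rperp.1 h).2 _ hS' S.subtype
    have : S = ⊥ := by rw [← S.range_subtype, h0, LinearMap.range_zero]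
    subst this
    exact hF.equiv hS (Submodule.quotEquivOfEqBot _ rfl)

theorem IsTorsionClass.lperp_rperp (hT : IsTorsionClass A T) (hne : T.Nonempty) :
    lperp A (rperp A T) = T :=
  Set.ext fun X => (hT.has_iff (X := X) hne).symm

theorem IsTorsionFreeClass.rperp_lperp (hF : IsTorsionFreeClass A F) (hne : F.Nonempty) :
    rperp A (lperp A F) = F :=
  Set.ext fun X => (hF.has_iff (X := X) hne).symm

end Basics

section Basics

/-- The length of a finite length module, as a natural number. -/
def len (A X : Type) [Ring A] [AddCommGroup X] [Module A X] : ℕ := (Module.length A X).toNat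

variable {A : Type} [Ring A] [IsNoetherianRing A] [IsArtinianRing A]
variable {T F : Set (ModuleCat.{0} A)}
variable {X Y Z : Type} [AddCommGroup X] [Module A X] [AddCommGroup Y] [Module A Y]
  [AddCommGroup Z] [Module A Z]

theorem coe_len [Module.Finite A X] : (len A X : ℕ∞) = Module.length A X :=
  ENat.natCast_toNat Module.length_ne_top

theorem len_eq_add [Module.Finite A X] [Module.Finite A Y] [Module.Finite A Z] (f : X →ₗ[A] Y)
    (g : Y →ₗ[A] Z) (hf : Function.Injective f)
    (hg : Function.Surjective g) (h : LinearMap.range f = LinearMap.ker g) :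
    len A Y = len A X + len A Z := by
  have := Module.length_eq_add_of_exact f g hf hg (LinearMap.exact_iff.2 h.symm)
  simp only [← coe_len] at this
  exact_mod_cast this

theorem len_sub_add [Module.Finite A X] (S : Submodule A X) :
    len A X = len A S + len A (X ⧸ S) :=
  len_eq_add S.subtype S.mkQ S.subtype_injective S.mkQ_surjective (by simp)

theorem len_ker_add [Module.Finite A X] (f : X →ₗ[A] Y) :
    len A X = len A (LinearMap.ker f) + len A (LinearMap.range f) :=
  len_eq_add (LinearMap.ker f).subtype f.rangeRestrict (Submodule.subtype_injective _)
    f.surjective_rangeRestrict (by simp)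

theorem len_le_of_injective [Module.Finite A Y] (f : X →ₗ[A] Y) (hf : Function.Injective f) :
    len A X ≤ len A Y := by
  have := Module.Finite.of_injective f hf
  have := Module.length_le_of_injective f hf
  simp only [← coe_len] at this
  exact_mod_cast this

theorem len_equiv (e : X ≃ₗ[A] Y) : len A X = len A Y := by
  simp only [len, e.length_eq]

theorem len_eq_zero [Module.Finite A X] : len A X = 0 ↔ Subsingleton X := by
  rw [← Module.length_eq_zero_iff (R := A), ← coe_len]
  simp

theorem len_pi [Module.Finite A X] (n : ℕ) : len A (Fin n → X) = n * len A X := by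
  have := Module.length_pi_of_fintype (R := A) (M := fun _ : Fin n => X)
  simp only [← coe_len, Finset.sum_const, Finset.card_univ, Fintype.card_fin, nsmul_eq_mul] at this
  exact_mod_cast this

theorem eq_top_of_len_le [Module.Finite A X] (S : Submodule A X) (h : len A X ≤ len A S) :
    S = ⊤ := by
  have := len_sub_add S
  have h0 : len A (X ⧸ S) = 0 := by omega
  rw [len_eq_zero] at h0
  exact Submodule.Quotient.subsingleton_iff.1 h0

theorem surjective_of_injective_of_len_le [Module.Finite A X] [Module.Finite A Y] (f : X →ₗ[A] Y)
    (hf : Function.Injective f) (h : len A Y ≤ len A X) : Function.Surjective f := by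
  rw [← LinearMap.range_eq_top]
  apply eq_top_of_len_le
  rwa [← len_equiv (LinearEquiv.ofInjective f hf)]

theorem fac_of_fintype {M : ModuleCat.{0} A} {ι : Type*} [Fintype ι] (f : (ι → M) →ₗ[A] Y)
    (hf : Function.Surjective f) : Has (Fac A M) Y := by
  let e : (Fin (Fintype.card ι) → M) ≃ₗ[A] (ι → M) :=
    LinearEquiv.funCongrLeft A M (Fintype.equivFin ι)
  exact ⟨Fintype.card ι, f ∘ₗ e.toLinearMap, hf.comp e.surjective⟩

theorem sub_of_fintype [Module.Finite A Y] {M : ModuleCat.{0} A} {ι : Type*} [Fintype ι]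
    (f : Y →ₗ[A] (ι → M)) (hf : Function.Injective f) : Has (Sub M) Y := by
  let e : (ι → M) ≃ₗ[A] (Fin (Fintype.card ι) → M) :=
    LinearEquiv.funCongrLeft A M (Fintype.equivFin ι).symm
  exact ⟨‹_›, Fintype.card ι, e.toLinearMap ∘ₗ f, e.injective.comp hf⟩

theorem has_fac_iff [Module.Finite A Y] {M : ModuleCat.{0} A} :
    Has (Fac A M) Y ↔ ∀ y : Y, y ∈ ⨆ f : M →ₗ[A] Y, LinearMap.range f := by
  constructor
  · rintro ⟨n, f, hf⟩ y
    obtain ⟨m, rfl⟩ := hf y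
    have : f m = ∑ i, (f ∘ₗ LinearMap.single A (fun _ => (M : Type)) i) (m i) := by
      simp only [LinearMap.comp_apply, ← map_sum]
      congr 1
      exact (LinearMap.sum_single_apply (fun _ => (M : Type)) m).symm
    erw [this]
    refine Submodule.sum_mem _ fun i _ => ?_
    exact Submodule.mem_iSup_of_mem (f ∘ₗ LinearMap.single A (fun _ => (M : Type)) i) ⟨_, rfl⟩
  · intro h
    obtain ⟨t, ht⟩ := Finset.exists_sup_ge (fun f : M →ₗ[A] Y => LinearMap.range f)
    let F : (t → M) →ₗ[A] Y := ∑ i : t, i.1 ∘ₗ LinearMap.proj i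
    refine fac_of_fintype F ?_
    rw [← LinearMap.range_eq_top, eq_top_iff]
    intro y _
    have h1 : (⨆ f : M →ₗ[A] Y, LinearMap.range f) ≤ t.sup (fun f => LinearMap.range f) :=
      iSup_le ht
    have h2 : t.sup (fun f => LinearMap.range f) ≤ LinearMap.range F := by
      classical
      refine Finset.sup_le fun φ hφ => ?_
      rintro _ ⟨m, rfl⟩
      refine ⟨Pi.single ⟨φ, hφ⟩ m, ?_⟩
      simp only [F, LinearMap.sum_apply, LinearMap.comp_apply, LinearMap.proj_apply]
      rw [Finset.sum_eq_single ⟨φ, hφ⟩]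
      · simp
      · intro b _ hb
        simp [hb]
      · simp
    exact h2 (h1 (h y))

theorem has_sub_iff {M : ModuleCat.{0} A} :
    Has (Sub M) Y ↔ Module.Finite A Y ∧ ∀ y : Y, (∀ f : Y →ₗ[A] M, f y = 0) → y = 0 := by
  constructor
  · rintro ⟨h, n, f, hf⟩
    refine ⟨h, fun y hy => hf ?_⟩
    funext i
    have := hy (LinearMap.proj i ∘ₗ f)
    simpa using this
  · rintro ⟨h0, h⟩
    obtain ⟨t, ht⟩ := Finset.exists_inf_le (fun f : Y →ₗ[A] M => LinearMap.ker f)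
    let F : Y →ₗ[A] (t → M) := LinearMap.pi fun i => i.1
    refine sub_of_fintype F ?_
    rw [← LinearMap.ker_eq_bot, eq_bot_iff]
    intro y hy
    refine h y fun f => ht f ?_
    rw [Submodule.mem_finsetInf]
    intro i hi
    exact congrFun hy ⟨i, hi⟩

theorem finMods_fac (M : ModuleCat.{0} A) [Module.Finite A M] : FinMods A (Fac A M) :=
  fun _ ⟨_, f, hf⟩ => Module.Finite.of_surjective f hf

theorem quotClosed_fac (M : ModuleCat.{0} A) : QuotClosed A (Fac A M) :=
  fun _ ⟨n, f, hf⟩ _ g hg => ⟨n, g ∘ₗ f, hg.comp hf⟩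

theorem self_mem_fac (M : ModuleCat.{0} A) : M ∈ Fac A M :=
  ⟨1, LinearMap.proj 0, LinearMap.proj_surjective 0⟩

theorem finMods_sub (M : ModuleCat.{0} A) : FinMods A (Sub M) := fun _ h => h.1

theorem subClosed_sub (M : ModuleCat.{0} A) : SubClosed A (Sub M) :=
  fun _ ⟨_, n, f, hf⟩ _ g hg => ⟨Module.Finite.of_injective g hg, n, f ∘ₗ g, hf.comp hg⟩

theorem self_mem_sub (M : ModuleCat.{0} A) [Module.Finite A M] : M ∈ Sub M :=
  ⟨‹_›, 1, LinearMap.pi fun _ => LinearMap.id, fun _ _ h => congrFun h 0⟩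

theorem sub_has_pi (M : ModuleCat.{0} A) [Module.Finite A M] (n : ℕ) : Has (Sub M) (Fin n → M) :=
  ⟨(inferInstance : Module.Finite A (Fin n → M)), n, LinearMap.id, fun _ _ h => h⟩

theorem fac_has_pi (M : ModuleCat.{0} A) (n : ℕ) : Has (Fac A M) (Fin n → M) :=
  ⟨n, LinearMap.id, fun x => ⟨x, rfl⟩⟩

theorem IsTorsionClass.fac_subset (hT : IsTorsionClass A T) {M : ModuleCat.{0} A} (hM : M ∈ T) :
    Fac A M ⊆ T := fun _ ⟨_, f, hf⟩ => hT.quot (hT.pi ⟨M, hM⟩ fun _ => hM) f hf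

theorem IsTorsionFreeClass.sub_subset (hF : IsTorsionFreeClass A F) {M : ModuleCat.{0} A}
    (hM : M ∈ F) : Sub M ⊆ F := fun _ ⟨_, _, f, hf⟩ => hF.sub (hF.pi ⟨M, hM⟩ fun _ => hM) f hf

end Basics

section Universal

theorem isNoetherianRing_of_finiteDimensional (k : Type) {A : Type} [Field k] [Ring A] [Algebra k A]
    [FiniteDimensional k A] : IsNoetherianRing A :=
  isNoetherian_of_tower k inferInstance

theorem isArtinianRing_of_finiteDimensional (k : Type) {A : Type} [Field k] [Ring A] [Algebra k A]
    [FiniteDimensional k A] : IsArtinianRing A :=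
  isArtinian_of_tower k inferInstance

theorem exists_universal_vector (k : Type) {A : Type} [Field k] [Ring A] [Algebra k A]
    [FiniteDimensional k A]
    (M : Type) [AddCommGroup M] [Module A M] [Module.Finite A M] :
    ∃ (d : ℕ) (w : Fin d → M), ∀ v : M, ∃ f : (Fin d → M) →ₗ[A] M, f w = v := by
  let _ : Module k M := Module.compHom M (algebraMap k A)
  have : IsScalarTower k A M := ⟨fun c a m => by
    change (c • a) • m = (algebraMap k A c) • a • m
    rw [smul_smul, Algebra.smul_def]⟩
  have : SMulCommClass A k M := IsScalarTower.to_smulCommClass'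
  have : Module.Finite k M := Module.Finite.trans A M
  let b := Module.finBasis k M
  refine ⟨_, b, fun v => ⟨∑ i, b.repr v i • LinearMap.proj i, ?_⟩⟩
  simp [b.sum_repr]

theorem exists_left_approx (k : Type) {A : Type} [Field k] [Ring A] [Algebra k A]
    [FiniteDimensional k A]
    (M : ModuleCat.{0} A) [Module.Finite A M] :
    ∃ (M0 : ModuleCat.{0} A) (w : M0), M0 ∈ Fac A M ∧ M0 ∈ Sub M ∧
      ∀ (Y : Type) [AddCommGroup Y] [Module A Y], Has (Fac A M) Y →
        ∀ y : Y, ∃ f : M0 →ₗ[A] Y, f w = y := by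
  have := isNoetherianRing_of_finiteDimensional k (A := A)
  have := isArtinianRing_of_finiteDimensional k (A := A)
  obtain ⟨d, w, hw⟩ := exists_universal_vector k (A := A) M
  refine ⟨ModuleCat.of A (Fin d → M), w, fac_has_pi M d, sub_has_pi M d, ?_⟩
  rintro Y _ _ ⟨n, f, hf⟩ y
  obtain ⟨m, rfl⟩ := hf y
  choose g hg using fun i => hw (m i)
  exact ⟨f ∘ₗ LinearMap.pi g, congrArg f (funext hg)⟩

end Universal

section MinimalApproximation

variable {A : Type} [Ring A]

/-- `w ∈ M₀` is universal: every element of every module in `T` is the image of `w`. -/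
def IsLeftApprox (T : Set (ModuleCat.{0} A)) (M₀ : ModuleCat.{0} A) (w : M₀) : Prop :=
  M₀ ∈ T ∧ ∀ (Y : Type) [AddCommGroup Y] [Module A Y], Has T Y → ∀ y : Y,
    ∃ f : M₀ →ₗ[A] Y, f w = y

variable [IsNoetherianRing A] [IsArtinianRing A] {T : Set (ModuleCat.{0} A)}

theorem IsLeftApprox.exists_minimal (hT : IsTorsionClass A T) {M : ModuleCat.{0} A} {w : M}
    (h : IsLeftApprox T M w) :
    ∃ (M₀ : ModuleCat.{0} A) (w₀ : M₀), IsLeftApprox T M₀ w₀ ∧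
      ∀ φ : M₀ →ₗ[A] M₀, φ w₀ = w₀ → Function.Bijective φ := by
  classical
  have hex : ∃ n, ∃ (M₀ : ModuleCat.{0} A) (w₀ : M₀), IsLeftApprox T M₀ w₀ ∧ len A M₀ = n :=
    ⟨_, M, w, h, rfl⟩
  obtain ⟨M₀, w₀, h₀, hn⟩ := Nat.find_spec hex
  refine ⟨M₀, w₀, h₀, fun φ hφ => ?_⟩
  have hfin : Module.Finite A M₀ := hT.1 _ h₀.1
  have hR : IsLeftApprox T (ModuleCat.of A (LinearMap.range φ)) ⟨w₀, w₀, hφ⟩ := by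
    refine ⟨hT.range (X := M₀) h₀.1 φ, fun Y _ _ hY y => ?_⟩
    obtain ⟨f, hf⟩ := h₀.2 Y hY y
    exact ⟨f ∘ₗ (LinearMap.range φ).subtype, hf⟩
  have hle : len A M₀ ≤ len A (LinearMap.range φ) := by
    rw [hn]
    exact Nat.find_min' hex ⟨_, _, hR, rfl⟩
  have hs : Function.Surjective φ := LinearMap.range_eq_top.1 (eq_top_of_len_le _ hle)
  exact ⟨IsNoetherian.injective_of_surjective_endomorphism φ hs, hs⟩

variable {M₀ : ModuleCat.{0} A} {w₀ : M₀}

/-- Minimal left approximations of the regular module are Ext-projective. -/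
theorem IsLeftApprox.splits (hT : IsTorsionClass A T) (h : IsLeftApprox T M₀ w₀)
    (hmin : ∀ φ : M₀ →ₗ[A] M₀, φ w₀ = w₀ → Function.Bijective φ)
    {E : Type} [AddCommGroup E] [Module A E] (g : E →ₗ[A] M₀) (hg : Function.Surjective g)
    (hk : Has T (LinearMap.ker g)) : ∃ s : M₀ →ₗ[A] E, ∀ m, g (s m) = m := by
  have hE : Has T E := hT.2.2.of_ker g hg hk h.1
  obtain ⟨e, he⟩ := hg w₀
  obtain ⟨f, hf⟩ := h.2 E hE e
  have hb := hmin (g ∘ₗ f) (by simp [hf, he])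
  let φ := LinearEquiv.ofBijective (g ∘ₗ f) hb
  refine ⟨f ∘ₗ φ.symm.toLinearMap, fun m => ?_⟩
  exact φ.apply_symm_apply m

/-- Maps from the kernel of a surjection onto an Ext-projective module extend. -/
theorem IsLeftApprox.extend (hT : IsTorsionClass A T) (h : IsLeftApprox T M₀ w₀)
    (hmin : ∀ φ : M₀ →ₗ[A] M₀, φ w₀ = w₀ → Function.Bijective φ)
    {P X : Type} [AddCommGroup P] [Module A P] [AddCommGroup X] [Module A X]
    (π : P →ₗ[A] M₀) (hπ : Function.Surjective π) (hX : Has T X)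
    (ψ : LinearMap.ker π →ₗ[A] X) :
    ∃ ψ' : P →ₗ[A] X, ∀ ω : LinearMap.ker π, ψ' ω = ψ ω := by
  let D : Submodule A (X × P) := LinearMap.range (ψ.prod (-(LinearMap.ker π).subtype))
  have hD : D ≤ LinearMap.ker (π ∘ₗ LinearMap.snd A X P) := by
    rintro _ ⟨ω, rfl⟩
    simp
  let g : ((X × P) ⧸ D) →ₗ[A] M₀ := D.liftQ (π ∘ₗ LinearMap.snd A X P) hD
  have hg : Function.Surjective g := fun m => by
    obtain ⟨p, rfl⟩ := hπ m
    exact ⟨D.mkQ (0, p), by simp [g]⟩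
  let ι : X →ₗ[A] ((X × P) ⧸ D) := D.mkQ ∘ₗ LinearMap.inl A X P
  have hι : Function.Injective ι := by
    rw [← LinearMap.ker_eq_bot, eq_bot_iff]
    intro x hx
    obtain ⟨ω, hω⟩ := (Submodule.Quotient.mk_eq_zero D).1 hx
    have h1 : ψ ω = x := congrArg Prod.fst hω
    have h2 : -(ω : P) = 0 := congrArg Prod.snd hω
    have h3 : ω = 0 := Subtype.ext (neg_eq_zero.1 h2)
    simp [← h1, h3]
  have hrel : ∀ ω : LinearMap.ker π, D.mkQ (0, (ω : P)) = ι (ψ ω) := fun ω => by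
    rw [eq_comm, ← sub_eq_zero]
    change D.mkQ (ψ ω, 0) - D.mkQ (0, (ω : P)) = 0
    rw [← map_sub]
    exact (Submodule.Quotient.mk_eq_zero D).2 ⟨ω, by simp⟩
  have hker : LinearMap.ker g = LinearMap.range ι := by
    apply le_antisymm
    · intro y hy
      obtain ⟨⟨x, p⟩, rfl⟩ := D.mkQ_surjective y
      have hp : π p = 0 := by simpa [g] using hy
      refine ⟨x + ψ ⟨p, hp⟩, ?_⟩
      rw [map_add, ← hrel ⟨p, hp⟩]
      change D.mkQ (x, 0) + D.mkQ (0, p) = _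
      rw [← map_add]
      simp
    · rintro _ ⟨x, rfl⟩
      simp [g, ι]
  have hk : Has T (LinearMap.ker g) := hker ▸ hT.range hX ι
  obtain ⟨s, hs⟩ := h.splits hT hmin g hg hk
  obtain ⟨v, hv⟩ := exists_factor_of_injective ι hι
    (D.mkQ ∘ₗ LinearMap.inr A X P - s ∘ₗ π) fun p => by
      rw [← hker]
      simp [g, hs]
  refine ⟨v, fun ω => hι ?_⟩
  rw [hv, ← hrel]
  have : π ω = 0 := ω.2
  simp [this]

end MinimalApproximation

section Fitting

variable {A : Type} [Ring A] [IsNoetherianRing A] [IsArtinianRing A]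

/-- A surjection from a finite free module onto its image can be cut down by an idempotent to
a projective cover. -/
theorem exists_idempotent_cover {a b : ℕ} (p : (Fin b → A) →ₗ[A] (Fin a → A)) :
    ∃ ε : (Fin b → A) →ₗ[A] (Fin b → A), (∀ v, ε (ε v) = ε v) ∧ (∀ v, p (ε v) = p v) ∧
      ∀ L : Submodule A (Fin b → A), L ≤ LinearMap.range ε →
        L.map p = LinearMap.range p → L = LinearMap.range ε := by
  classical
  have hex : ∃ n, ∃ ε : (Fin b → A) →ₗ[A] (Fin b → A), (∀ v, ε (ε v) = ε v) ∧
      (∀ v, p (ε v) = p v) ∧ len A (LinearMap.range ε) = n :=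
    ⟨_, LinearMap.id, fun _ => rfl, fun _ => rfl, rfl⟩
  obtain ⟨ε, h1, h2, hn⟩ := Nat.find_spec hex
  refine ⟨ε, h1, h2, fun L hL hp => ?_⟩
  have hlift : ∀ j : Fin b, ∃ x ∈ L, p x = p (Pi.single j 1) := fun j => by
    have : p (Pi.single j 1) ∈ L.map p := hp ▸ ⟨_, rfl⟩
    exact this
  choose x hx hpx using hlift
  let s : Module.End A (Fin b → A) := (Pi.basisFun A (Fin b)).constr ℕ x
  have hs : ∀ v, s v = ∑ j, v j • x j := fun v => by
    simp [s, Module.Basis.constr_apply_fintype]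
  have hsL : ∀ v, s v ∈ L := fun v => by
    rw [hs]
    exact Submodule.sum_mem _ fun j _ => L.smul_mem _ (hx j)
  have hps : ∀ v, p (s v) = p v := fun v => by
    rw [hs, map_sum, LinearMap.pi_apply_eq_sum_univ p v]
    refine Finset.sum_congr rfl fun j _ => ?_
    rw [map_smul, hpx]
    congr 2
    funext i
    simp [Pi.single_apply, eq_comm]
  have hpsn : ∀ n v, p ((s ^ n) v) = p v := fun n => by
    induction n with
    | zero => simp
    | succ n ih => intro v; rw [pow_succ', Module.End.mul_apply, hps, ih]
  obtain ⟨n, hn1, hc⟩ := ((Filter.eventually_ge_atTop 1).and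
    s.eventually_isCompl_ker_pow_range_pow).exists
  let ε' := (LinearMap.range (s ^ n)).projection _ hc.symm
  have hR : LinearMap.range ε' = LinearMap.range (s ^ n) := Submodule.range_projection _
  have hRL : LinearMap.range ε' ≤ L := by
    rw [hR]
    rintro _ ⟨v, rfl⟩
    obtain ⟨m, rfl⟩ : ∃ m, n = m + 1 := ⟨n - 1, by omega⟩
    rw [pow_succ']
    exact hsL _
  have hpε : ∀ v, p (ε' v) = p v := fun v => by
    obtain ⟨y, hy, z, hz, rfl⟩ := Submodule.mem_sup.1
      (hc.sup_eq_top ▸ Submodule.mem_top : v ∈ LinearMap.ker (s ^ n) ⊔ LinearMap.range (s ^ n))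
    have h1 : ε' y = 0 := (Submodule.projection_apply_eq_zero_iff hc.symm).2 hy
    have h2 : ε' z = z := Submodule.projection_apply_of_mem_left hc.symm hz
    have h3 : p y = 0 := by rw [← hpsn n y, LinearMap.mem_ker.1 hy, map_zero]
    rw [map_add, map_add, map_add, h1, h2, h3, map_zero]
  have hεε : ∀ v, ε' (ε' v) = ε' v := fun v =>
    Submodule.projection_apply_of_mem_left hc.symm (hR ▸ ⟨v, rfl⟩)
  have hmin : len A (LinearMap.range ε) ≤ len A (LinearMap.range ε') := by
    rw [hn]
    exact Nat.find_min' hex ⟨ε', hεε, hpε, rfl⟩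
  have hle := hRL.trans hL
  have := surjective_of_injective_of_len_le (Submodule.inclusion hle)
    (Submodule.inclusion_injective hle) hmin
  refine le_antisymm hL fun x hx => ?_
  obtain ⟨y, hy⟩ := this ⟨x, hx⟩
  have : (y : Fin b → A) = x := congrArg Subtype.val hy
  exact this ▸ hRL y.2

end Fitting

section Presentation

variable {A : Type} [Ring A] [IsNoetherianRing A] [IsArtinianRing A] {T : Set (ModuleCat.{0} A)}
variable {M₀ : ModuleCat.{0} A} {w₀ : M₀}

/-- The minimal presentation of an Ext-projective module is presilting. -/
theorem IsLeftApprox.exists_presentation (hT : IsTorsionClass A T) (h : IsLeftApprox T M₀ w₀)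
    (hmin : ∀ φ : M₀ →ₗ[A] M₀, φ w₀ = w₀ → Function.Bijective φ) :
    ∃ (a b : ℕ) (π : (Fin a → A) →ₗ[A] M₀) (p : (Fin b → A) →ₗ[A] (Fin a → A))
      (ε : (Fin b → A) →ₗ[A] (Fin b → A)),
      Function.Surjective π ∧ LinearMap.range p = LinearMap.ker π ∧ (∀ v, ε (ε v) = ε v) ∧
      (∀ v, p (ε v) = p v) ∧
      ∀ u : (Fin b → A) →ₗ[A] (Fin a → A), ∃ (g : (Fin a → A) →ₗ[A] (Fin a → A))
        (l : (Fin b → A) →ₗ[A] (Fin b → A)), ∀ v, u (ε v) = g (p v) + p (l (ε v)) := by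
  have hfin : Module.Finite A M₀ := hT.1 _ h.1
  obtain ⟨a, π, hπ⟩ := Module.Finite.exists_fin' A M₀
  obtain ⟨b, p₀, hp₀⟩ := Module.Finite.exists_fin' A (LinearMap.ker π)
  let p : (Fin b → A) →ₗ[A] (Fin a → A) := (LinearMap.ker π).subtype ∘ₗ p₀
  have hp : LinearMap.range p = LinearMap.ker π := by
    rw [LinearMap.range_comp, LinearMap.range_eq_top.2 hp₀]
    simp
  obtain ⟨ε, hε, hpε, hL⟩ := exists_idempotent_cover p
  refine ⟨a, b, π, p, ε, hπ, hp, hε, hpε, fun u => ?_⟩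
  let U : (Fin b → A) →ₗ[A] M₀ := π ∘ₗ u
  let B : Submodule A M₀ := (LinearMap.ker p).map (U ∘ₗ ε)
  have hX : Has T (M₀ ⧸ B) := hT.quot (X := M₀) h.1 B.mkQ B.mkQ_surjective
  obtain ⟨ψ, hψ⟩ := exists_factor_of_surjective p₀ hp₀ (B.mkQ ∘ₗ U ∘ₗ ε) fun v hv =>
    (Submodule.Quotient.mk_eq_zero B).2 ⟨v, by simp [p, hv], rfl⟩
  obtain ⟨ψ', hψ'⟩ := h.extend hT hmin π hπ hX ψ
  obtain ⟨g₀, hg₀⟩ := Module.projective_lifting_property B.mkQ ψ' B.mkQ_surjective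
  obtain ⟨g, hg⟩ := Module.projective_lifting_property π g₀ hπ
  have hgπ : ∀ x, π (g x) = g₀ x := fun x => LinearMap.congr_fun hg x
  have hmem : ∀ v, ∃ κ, p κ = 0 ∧ U (ε κ) = U (ε v) - g₀ (p v) := fun v => by
    have h1 : B.mkQ (g₀ (p v)) = B.mkQ (U (ε v)) := by
      have e1 : B.mkQ (g₀ (p v)) = ψ' (p v) := LinearMap.congr_fun hg₀ (p v)
      have e2 : ψ' (p v) = ψ (p₀ v) := hψ' (p₀ v)
      rw [e1, e2, hψ]
      rfl
    have h2 : U (ε v) - g₀ (p v) ∈ B := by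
      rw [← Submodule.Quotient.mk_eq_zero B]
      change B.mkQ _ = 0
      rw [map_sub, h1, sub_self]
    obtain ⟨κ, hκ, hκ'⟩ := h2
    exact ⟨κ, hκ, hκ'⟩
  let u' : (Fin b → A) →ₗ[A] M₀ := U ∘ₗ ε - g₀ ∘ₗ p
  have hLL := hL (LinearMap.ker u' ⊓ LinearMap.range ε) inf_le_right (by
    apply le_antisymm
    · rintro _ ⟨v, _, rfl⟩
      exact ⟨v, rfl⟩
    · rintro _ ⟨v, rfl⟩
      obtain ⟨κ, hκ, hκ'⟩ := hmem v
      refine ⟨ε (v - κ), ⟨?_, _, rfl⟩, ?_⟩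
      · change U (ε (ε (v - κ))) - g₀ (p (ε (v - κ))) = 0
        rw [hε, hpε, map_sub ε, map_sub U, map_sub p, hκ, hκ', sub_zero]
        abel
      · rw [hpε, map_sub, hκ, sub_zero])
  have hu' : ∀ v, U (ε v) = g₀ (p v) := fun v => by
    have : ε v ∈ LinearMap.ker u' ⊓ LinearMap.range ε := by
      rw [hLL]
      exact ⟨v, rfl⟩
    have h1 : U (ε (ε v)) - g₀ (p (ε v)) = 0 := this.1
    rwa [hε, hpε, sub_eq_zero] at h1
  obtain ⟨d, hd⟩ := exists_factor_of_injective (LinearMap.ker π).subtype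
    (Submodule.subtype_injective _) (u ∘ₗ ε - g ∘ₗ p) (fun v => by
      rw [Submodule.range_subtype]
      have := hu' v
      simp only [LinearMap.mem_ker, LinearMap.sub_apply, LinearMap.comp_apply, map_sub, hgπ]
      rw [← this]
      simp [U])
  obtain ⟨l, hl⟩ := Module.projective_lifting_property p₀ d hp₀
  refine ⟨g, l, fun v => ?_⟩
  have h1 : p (l (ε v)) = d (ε v) := congrArg Subtype.val (LinearMap.congr_fun hl (ε v))
  have h2 : ((d (ε v) : LinearMap.ker π) : Fin a → A) = u (ε (ε v)) - g (p (ε v)) := hd (ε v)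
  rw [h1, h2, hε, hpε]
  abel

end Presentation

section Coinduced

/-- The coinduced left module `Hom_k(A, E)`. -/
def Coind (k A E : Type) [Field k] [Ring A] [Algebra k A] [AddCommGroup E] [Module k E] : Type :=
  A →ₗ[k] E

variable {k A E : Type} [Field k] [Ring A] [Algebra k A] [AddCommGroup E] [Module k E]

instance : AddCommGroup (Coind k A E) := inferInstanceAs (AddCommGroup (A →ₗ[k] E))

instance : Module k (Coind k A E) := inferInstanceAs (Module k (A →ₗ[k] E))

/-- Evaluation of an element of the coinduced module. -/
def Coind.ev (n : Coind k A E) : A →ₗ[k] E := n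

theorem Coind.ext {n m : Coind k A E} (h : ∀ z, n.ev z = m.ev z) : n = m := LinearMap.ext h

instance : Module A (Coind k A E) where
  smul x n := (Coind.ev n).comp (LinearMap.mulRight k x)
  one_smul n := Coind.ext fun z => congrArg n.ev (mul_one z)
  mul_smul x y n := Coind.ext fun z => congrArg n.ev (mul_assoc z x y).symm
  smul_zero _ := rfl
  smul_add _ _ _ := rfl
  add_smul x y n := Coind.ext fun z => by
    change n.ev (z * (x + y)) = n.ev (z * x) + n.ev (z * y)
    rw [mul_add, map_add]
  zero_smul n := Coind.ext fun z => by
    change n.ev (z * 0) = 0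
    rw [mul_zero, map_zero]

theorem Coind.ev_add (z : A) (n m : Coind k A E) : (n + m).ev z = n.ev z + m.ev z := rfl

theorem Coind.ev_smul (x z : A) (n : Coind k A E) : (x • n).ev z = n.ev (z * x) := rfl

theorem Coind.ev_zero (z : A) : (0 : Coind k A E).ev z = 0 := rfl

theorem Coind.ev_sum {ι : Type*} (s : Finset ι) (n : ι → Coind k A E) (z : A) :
    (∑ i ∈ s, n i).ev z = ∑ i ∈ s, (n i).ev z :=
  LinearMap.sum_apply s (fun i => (n i).ev) z

instance : IsScalarTower k A (Coind k A E) := ⟨fun c x n => Coind.ext fun z => by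
  change n.ev (z * (c • x)) = c • n.ev (z * x)
  rw [mul_smul_comm, map_smul]⟩

instance [FiniteDimensional k A] [FiniteDimensional k E] : Module.Finite A (Coind k A E) := by
  have : Module.Finite k (Coind k A E) := inferInstanceAs (Module.Finite k (A →ₗ[k] E))
  exact Module.Finite.of_restrictScalars_finite k A _

/-- The map to a coinduced module given by a `k`-linear map. -/
def Coind.lift {V : Type} [AddCommGroup V] [Module k V] [Module A V] [IsScalarTower k A V]
    (θ : V →ₗ[k] E) : V →ₗ[A] Coind k A E where
  toFun v := θ.comp ((LinearMap.toSpanSingleton A V v).restrictScalars k)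
  map_add' v w := Coind.ext fun z => by
    change θ (z • (v + w)) = θ (z • v) + θ (z • w)
    rw [smul_add, map_add]
  map_smul' x v := Coind.ext fun z => by
    change θ (z • x • v) = θ ((z * x) • v)
    rw [smul_smul]

theorem Coind.lift_ev {V : Type} [AddCommGroup V] [Module k V] [Module A V] [IsScalarTower k A V]
    (θ : V →ₗ[k] E) (v : V) (z : A) : (Coind.lift (A := A) θ v).ev z = θ (z • v) := rfl

end Coinduced

section Cogenerator

theorem hom_eq_sum {A X : Type} [Ring A] [AddCommGroup X] [Module A X] {b : ℕ}
    (g : (Fin b → A) →ₗ[A] X) (v : Fin b → A) : g v = ∑ j, v j • g (Pi.single j 1) := by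
  rw [LinearMap.pi_apply_eq_sum_univ g v]
  refine Finset.sum_congr rfl fun j _ => ?_
  congr 2
  funext i
  simp [Pi.single_apply, eq_comm]

theorem klin_eq_sum {k V W : Type} [Field k] [AddCommGroup V] [Module k V] [AddCommGroup W]
    [Module k W] {b : ℕ} (g : (Fin b → V) →ₗ[k] W) (v : Fin b → V) :
    g v = ∑ j, g (Pi.single j (v j)) := by
  rw [← map_sum]
  congr 1
  exact (LinearMap.sum_single_apply (fun _ => V) v).symm

variable {k A : Type} [Field k] [Ring A] [Algebra k A] {a b : ℕ}

/-- The pairs consisting of a functional and a system of extensions of functionals along the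
presentation `p`; a model for a cogenerator of a torsionfree class. -/
def cogen (k : Type) {A : Type} [Field k] [Ring A] [Algebra k A] {a b : ℕ}
    (p : (Fin b → A) →ₗ[A] (Fin a → A)) (ε : (Fin b → A) →ₗ[A] (Fin b → A)) :
    Submodule A (Coind k A (k × ((Fin a → A) →ₗ[k] (Fin b → k)))) where
  carrier := {n | (∀ l j' z, ∑ j, (n.ev (ε (Pi.single j 1) j' * z)).2 l j = (n.ev z).2 l j') ∧
    ∀ (l : Fin a → A) q z, ∑ j, (n.ev (p (Pi.single j 1) q * z)).2 l j = (n.ev (l q * z)).1}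
  add_mem' {n m} hn hm := by
    refine ⟨fun l j' z => ?_, fun l q z => ?_⟩
    · simp only [Coind.ev_add, Prod.snd_add, LinearMap.add_apply, Pi.add_apply,
        Finset.sum_add_distrib, hn.1, hm.1]
    · simp only [Coind.ev_add, Prod.snd_add, LinearMap.add_apply, Pi.add_apply,
        Finset.sum_add_distrib, hn.2, hm.2, Prod.fst_add]
  zero_mem' := by
    refine ⟨fun l j' z => ?_, fun l q z => ?_⟩ <;> simp [Coind.ev_zero]
  smul_mem' x n hn := by
    refine ⟨fun l j' z => ?_, fun l q z => ?_⟩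
    · simp only [Coind.ev_smul, mul_assoc, hn.1]
    · simp only [Coind.ev_smul, mul_assoc, hn.2]

variable {p : (Fin b → A) →ₗ[A] (Fin a → A)} {ε : (Fin b → A) →ₗ[A] (Fin b → A)}

theorem eq_zero_of_sum_smul_cogen
    (hu : ∀ u : (Fin b → A) →ₗ[A] (Fin a → A), ∃ (g : (Fin a → A) →ₗ[A] (Fin a → A))
        (l : (Fin b → A) →ₗ[A] (Fin b → A)), ∀ v, u (ε v) = g (p v) + p (l (ε v)))
    (x : Fin a → cogen k p ε) (hx : ∀ j, ∑ q, p (Pi.single j 1) q • x q = 0) : x = 0 := by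
  classical
  let n : Fin a → Coind k A (k × ((Fin a → A) →ₗ[k] (Fin b → k))) := fun q => (x q).1
  have hn : ∀ j z, ∑ q, (n q).ev (z * p (Pi.single j 1) q) = 0 := fun j z => by
    have h1 := congrArg Subtype.val (hx j)
    have h2 := congrArg (fun m => Coind.ev m z) h1
    simpa [Coind.ev_sum, Coind.ev_smul, Coind.ev_zero, n] using h2
  have hi0 : ∀ l : Fin a → A, ∑ q, ((n q).ev (l q)).1 = 0 := fun l => by
    have h1 : ∀ q, ((n q).ev (l q)).1 = ∑ j, ((n q).ev (p (Pi.single j 1) q)).2 l j := fun q => by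
      have := (x q).2.2 l q 1
      simpa [n] using this.symm
    simp only [h1]
    rw [Finset.sum_comm]
    refine Finset.sum_eq_zero fun j _ => ?_
    have := congrArg (fun t => t.2 l j) (hn j 1)
    simpa [Prod.snd_sum, LinearMap.sum_apply, Finset.sum_apply] using this
  have hi : ∀ q z, ((n q).ev z).1 = 0 := fun q z => by
    have := hi0 (Pi.single q z)
    rw [Finset.sum_eq_single q] at this
    · simpa using this
    · intro q' _ hq'
      simp [Pi.single_eq_of_ne hq']
    · simp
  let Θ (l : Fin a → A) (c : (Fin b → A) →ₗ[A] (Fin a → A)) : k :=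
    ∑ j, ∑ q, ((n q).ev (c (Pi.single j 1) q)).2 l j
  have hΘ : ∀ l u, Θ l (u ∘ₗ ε) = Θ l u := fun l u => by
    have h1 : ∀ j q, (u ∘ₗ ε) (Pi.single j 1) q =
        ∑ j', ε (Pi.single j 1) j' * u (Pi.single j' 1) q := fun j q => by
      rw [LinearMap.comp_apply, hom_eq_sum u]
      simp
    simp only [Θ, h1, map_sum, Prod.snd_sum, LinearMap.sum_apply, Finset.sum_apply]
    have h2 : ∀ q j', ∑ j, ((n q).ev (ε (Pi.single j 1) j' * u (Pi.single j' 1) q)).2 l j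
      = ((n q).ev (u (Pi.single j' 1) q)).2 l j' := fun q j' => (x q).2.1 l j' _
    calc _ = ∑ j, ∑ j', ∑ q, ((n q).ev (ε (Pi.single j 1) j' * u (Pi.single j' 1) q)).2 l j :=
          Finset.sum_congr rfl fun j _ => Finset.sum_comm
      _ = ∑ j', ∑ j, ∑ q, ((n q).ev (ε (Pi.single j 1) j' * u (Pi.single j' 1) q)).2 l j :=
          Finset.sum_comm
      _ = ∑ j', ∑ q, ∑ j, ((n q).ev (ε (Pi.single j 1) j' * u (Pi.single j' 1) q)).2 l j :=
          Finset.sum_congr rfl fun j _ => Finset.sum_comm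
      _ = _ := by simp only [h2]
  have hΘ0 : ∀ l u, Θ l u = 0 := fun l u => by
    obtain ⟨g, m, hgm⟩ := hu u
    rw [← hΘ]
    have h1 : u ∘ₗ ε = g ∘ₗ p + p ∘ₗ (m ∘ₗ ε) := LinearMap.ext hgm
    have h2 : Θ l (u ∘ₗ ε) = Θ l (g ∘ₗ p) + Θ l (p ∘ₗ (m ∘ₗ ε)) := by
      simp only [Θ, h1, LinearMap.add_apply, Pi.add_apply, map_add, Prod.snd_add,
        Finset.sum_add_distrib]
    have h3 : Θ l (g ∘ₗ p) = 0 := by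
      have e1 : ∀ j q, (g ∘ₗ p) (Pi.single j 1) q =
          ∑ s, p (Pi.single j 1) s * g (Pi.single s 1) q := fun j q => by
        rw [LinearMap.comp_apply, hom_eq_sum g]
        simp
      simp only [Θ, e1, map_sum, Prod.snd_sum, LinearMap.sum_apply, Finset.sum_apply]
      rw [Finset.sum_comm]
      refine Finset.sum_eq_zero fun q _ => ?_
      rw [Finset.sum_comm]
      refine Finset.sum_eq_zero fun s _ => ?_
      rw [show ∑ j, ((n q).ev (p (Pi.single j 1) s * g (Pi.single s 1) q)).2 l j =
        ((n q).ev (l s * g (Pi.single s 1) q)).1 from (x q).2.2 l s _, hi]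
    have h4 : Θ l (p ∘ₗ (m ∘ₗ ε)) = 0 := by
      have e1 : ∀ j q, (p ∘ₗ (m ∘ₗ ε)) (Pi.single j 1) q =
          ∑ s, (m ∘ₗ ε) (Pi.single j 1) s * p (Pi.single s 1) q := fun j q => by
        rw [LinearMap.comp_apply, hom_eq_sum p]
        simp
      simp only [Θ, e1, map_sum, Prod.snd_sum, LinearMap.sum_apply, Finset.sum_apply]
      refine Finset.sum_eq_zero fun j _ => ?_
      rw [Finset.sum_comm]
      refine Finset.sum_eq_zero fun s _ => ?_
      have := congrArg (fun t => t.2 l j) (hn s ((m ∘ₗ ε) (Pi.single j 1) s))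
      simpa [Prod.snd_sum, LinearMap.sum_apply, Finset.sum_apply] using this
    rw [h2, h3, h4, add_zero]
  have hy : ∀ q z l j, ((n q).ev z).2 l j = 0 := fun q z l j => by
    let u : (Fin b → A) →ₗ[A] (Fin a → A) :=
      (LinearMap.toSpanSingleton A (Fin a → A) (Pi.single q z)) ∘ₗ LinearMap.proj j
    have := hΘ0 l u
    simp only [Θ] at this
    rw [Finset.sum_eq_single j, Finset.sum_eq_single q] at this
    · simpa [u] using this
    · intro q' _ hq'
      simp [u, Pi.single_eq_of_ne hq']
    · simp
    · intro j' _ hj'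
      simp [u, Pi.single_eq_of_ne (Ne.symm hj')]
    · simp
  funext q
  refine Subtype.ext (Coind.ext fun z => Prod.ext ?_ (LinearMap.ext fun l => funext fun j => ?_))
  · exact hi q z
  · exact hy q z l j

variable [FiniteDimensional k A]

theorem has_sub_cogen (hε : ∀ v, ε (ε v) = ε v) (hpε : ∀ v, p (ε v) = p v) {V : Type}
    [AddCommGroup V] [Module A V] [Module.Finite A V]
    (hV : ∀ x : Fin a → V, (∀ j, ∑ q, p (Pi.single j 1) q • x q = 0) → x = 0) :
    Has (Sub (ModuleCat.of A (cogen k p ε))) V := by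
  classical
  have := isNoetherianRing_of_finiteDimensional k (A := A)
  have := isArtinianRing_of_finiteDimensional k (A := A)
  let _ : Module k V := Module.compHom V (algebraMap k A)
  have : IsScalarTower k A V := ⟨fun c a m => by
    change (c • a) • m = (algebraMap k A c) • a • m
    rw [smul_smul, Algebra.smul_def]⟩
  have : SMulCommClass A k V := IsScalarTower.to_smulCommClass'
  refine has_sub_iff.2 ⟨inferInstance, fun v hv => ?_⟩
  have hker : ∀ φ : Module.Dual k V, φ v = 0 := fun φ => ?_
  · exact (Module.forall_dual_apply_eq_zero_iff k v).1 hker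
  let pV : (Fin a → V) →ₗ[k] (Fin b → V) :=
    { toFun := fun x j => ∑ q, p (Pi.single j 1) q • x q
      map_add' := fun x y => by
        funext j
        simp [Finset.sum_add_distrib]
      map_smul' := fun c x => by
        funext j
        simp [Finset.smul_sum, smul_comm c] }
  let εV : (Fin b → V) →ₗ[k] (Fin b → V) :=
    { toFun := fun x j => ∑ j', ε (Pi.single j 1) j' • x j'
      map_add' := fun x y => by
        funext j
        simp [Finset.sum_add_distrib]
      map_smul' := fun c x => by
        funext j
        simp [Finset.smul_sum, smul_comm c] }
  have hεε : ∀ y, εV (εV y) = εV y := fun y => by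
    funext j
    have h1 : ∀ i, ε (Pi.single j 1) i =
        ∑ j', ε (Pi.single j 1) j' * ε (Pi.single j' 1) i := fun i => by
      conv_lhs => rw [← hε (Pi.single j 1), hom_eq_sum ε (ε (Pi.single j 1))]
      simp
    change ∑ j', ε (Pi.single j 1) j' • (∑ i, ε (Pi.single j' 1) i • y i) =
      ∑ i, ε (Pi.single j 1) i • y i
    simp only [Finset.smul_sum, smul_smul]
    rw [Finset.sum_comm]
    refine Finset.sum_congr rfl fun i _ => ?_
    rw [← Finset.sum_smul, ← h1]
  have hεp : ∀ x, εV (pV x) = pV x := fun x => by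
    funext j
    have h1 : ∀ i, p (Pi.single j 1) i =
        ∑ j', ε (Pi.single j 1) j' * p (Pi.single j' 1) i := fun i => by
      conv_lhs => rw [← hpε (Pi.single j 1), hom_eq_sum p (ε (Pi.single j 1))]
      simp
    change ∑ j', ε (Pi.single j 1) j' • (∑ i, p (Pi.single j' 1) i • x i) =
      ∑ i, p (Pi.single j 1) i • x i
    simp only [Finset.smul_sum, smul_smul]
    rw [Finset.sum_comm]
    refine Finset.sum_congr rfl fun i _ => ?_
    rw [← Finset.sum_smul, ← h1]
  obtain ⟨ρ, hρ⟩ := LinearMap.exists_leftInverse_of_injective pV (by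
    rw [eq_bot_iff]
    intro x hx
    exact hV x fun j => congrFun hx j)
  have hρ' : ∀ x, ρ (pV x) = x := fun x => LinearMap.congr_fun hρ x
  let H : (Fin a → A) →ₗ[k] (Fin a → V) →ₗ[k] k :=
    LinearMap.mk₂ k (fun l x => ∑ q, φ (l q • x q))
      (fun l l' x => by simp [add_smul, Finset.sum_add_distrib])
      (fun c l x => by simp [Finset.mul_sum])
      (fun l x x' => by simp [Finset.sum_add_distrib])
      (fun c l x => by simp [Finset.mul_sum, smul_comm _ c])
  let θ₂ : V →ₗ[k] (Fin a → A) →ₗ[k] (Fin b → k) :=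
    LinearMap.mk₂ k (fun w l j => H l (ρ (εV (Pi.single j w))))
      (fun w w' l => by funext j; simp [Pi.single_add])
      (fun c w l => by funext j; simp [Pi.single_smul])
      (fun w l l' => by funext j; simp)
      (fun c w l => by funext j; simp)
  let θ : V →ₗ[k] k × ((Fin a → A) →ₗ[k] (Fin b → k)) := φ.prod θ₂
  have hsum : ∀ (l : Fin a → A) (w : Fin b → V),
      ∑ j, (θ (w j)).2 l j = H l (ρ (εV w)) := fun l w => by
    exact (klin_eq_sum (H l ∘ₗ ρ ∘ₗ εV) w).symm
  have hmem : ∀ w : V, Coind.lift (A := A) θ w ∈ cogen k p ε := fun w => by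
    refine ⟨fun l j' z => ?_, fun l q z => ?_⟩
    · simp only [Coind.lift_ev, mul_smul]
      rw [hsum l fun j => ε (Pi.single j 1) j' • z • w]
      have : (fun j => ε (Pi.single j 1) j' • z • w) = εV (Pi.single j' (z • w)) := by
        funext j
        change _ = ∑ i, ε (Pi.single j 1) i • (Pi.single j' (z • w) : Fin b → V) i
        rw [Finset.sum_eq_single j']
        · simp
        · intro i _ hi
          simp [Pi.single_eq_of_ne hi]
        · simp
      rw [this, hεε]
      rfl
    · simp only [Coind.lift_ev, mul_smul]
      rw [hsum l fun j => p (Pi.single j 1) q • z • w]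
      have : (fun j => p (Pi.single j 1) q • z • w) = pV (Pi.single q (z • w)) := by
        funext j
        change _ = ∑ i, p (Pi.single j 1) i • (Pi.single q (z • w) : Fin a → V) i
        rw [Finset.sum_eq_single q]
        · simp
        · intro i _ hi
          simp [Pi.single_eq_of_ne hi]
        · simp
      rw [this, hεp, hρ']
      change ∑ i, φ (l i • (Pi.single q (z • w) : Fin a → V) i) = φ (l q • z • w)
      rw [Finset.sum_eq_single q]
      · simp
      · intro i _ hi
        simp [Pi.single_eq_of_ne hi]
      · simp
  have h1 := hv (LinearMap.codRestrict _ (Coind.lift θ) hmem)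
  have h2 := congrArg (fun n : cogen k p ε => (Coind.ev n.1 1).1) h1
  have h3 : φ ((1 : A) • v) = 0 := h2
  rwa [one_smul] at h3

/-- The torsionfree class of a functorially finite torsion class has a finite cogenerator. -/
theorem exists_cogenerator (k : Type) {A : Type} [Field k] [Ring A] [Algebra k A]
    [FiniteDimensional k A] (M : ModuleCat.{0} A) [Module.Finite A M]
    (hT : IsTorsionClass A (Fac A M)) :
    ∃ N : ModuleCat.{0} A, Module.Finite A N ∧ rperp A (Fac A M) = Sub N := by
  classical
  have := isNoetherianRing_of_finiteDimensional k (A := A)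
  have := isArtinianRing_of_finiteDimensional k (A := A)
  obtain ⟨M₁, w₁, hM₁, -, hw₁⟩ := exists_left_approx k (A := A) M
  obtain ⟨M₀, w₀, h₀, hmin⟩ := IsLeftApprox.exists_minimal hT (w := w₁) ⟨hM₁, hw₁⟩
  obtain ⟨a, b, π, p, ε, hπ, hp, hε, hpε, hu⟩ := h₀.exists_presentation hT hmin
  have key : ∀ (V : Type) [AddCommGroup V] [Module A V], Module.Finite A V →
      (Has (rperp A (Fac A M)) V ↔
        ∀ x : Fin a → V, (∀ j, ∑ q, p (Pi.single j 1) q • x q = 0) → x = 0) := by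
    intro V _ _ hVf
    rw [has_rperp]
    constructor
    · rintro ⟨-, h⟩ x hx
      let g : (Fin a → A) →ₗ[A] V := (Pi.basisFun A (Fin a)).constr ℕ x
      have hg : ∀ v, g v = ∑ q, v q • x q := fun v => by
        simp [g, Module.Basis.constr_apply_fintype]
      obtain ⟨f, hf⟩ := exists_factor_of_surjective π hπ g fun v hv => by
        obtain ⟨c, rfl⟩ : v ∈ LinearMap.range p := hp ▸ hv
        have : (g ∘ₗ p) c = 0 := by
          rw [hom_eq_sum (g ∘ₗ p)]
          refine Finset.sum_eq_zero fun j _ => ?_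
          rw [LinearMap.comp_apply, hg, hx, smul_zero]
        exact this
      have hf0 := h M₀ h₀.1 f
      funext q
      have := hf (Pi.single q 1)
      rw [hf0, hg, Finset.sum_eq_single q] at this
      · simpa using this.symm
      · intro q' _ hq'
        simp [Pi.single_eq_of_ne hq']
      · simp
    · intro h
      refine ⟨hVf, fun Y _ _ hY f => ?_⟩
      have hM₀ : ∀ g : M₀ →ₗ[A] V, g = 0 := fun g => by
        have h1 := h (fun q => g (π (Pi.single q 1))) fun j => by
          refine (hom_eq_sum (g ∘ₗ π) (p (Pi.single j 1))).symm.trans ?_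
          have : π (p (Pi.single j 1)) = 0 := by
            rw [← LinearMap.mem_ker, ← hp]
            exact ⟨_, rfl⟩
          simp [this]
        ext m
        obtain ⟨v, rfl⟩ := hπ m
        have : (g ∘ₗ π) v = 0 := by
          rw [hom_eq_sum (g ∘ₗ π)]
          refine Finset.sum_eq_zero fun j _ => ?_
          rw [LinearMap.comp_apply, congrFun h1 j]
          simp
        exact this
      ext y
      obtain ⟨g, rfl⟩ := h₀.2 Y hY y
      exact LinearMap.congr_fun (hM₀ (f ∘ₗ g)) w₀
  refine ⟨ModuleCat.of A (cogen k p ε), (inferInstance : Module.Finite A (cogen k p ε)), ?_⟩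
  apply Set.Subset.antisymm
  · intro V hV
    have hVf : Module.Finite A V := hV.1
    exact has_sub_cogen hε hpε ((key V hVf).1 hV)
  · refine (isTorsionFreeClass_rperp (Fac A M)).sub_subset ?_
    refine (key (cogen k p ε) inferInstance).2 fun x hx => eq_zero_of_sum_smul_cogen hu x hx

end Cogenerator

section Brick

variable {A : Type} [Ring A]

/-- `B` is a torsionfree module for `m` whose proper quotients are torsion and which has no
proper torsionfree extensions by torsion modules. -/
structure IsMinExtending (m : Set (ModuleCat.{0} A)) (B : ModuleCat.{0} A) : Prop where
  nontrivial : Nontrivial B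
  mem : Has (rperp A m) B
  quot : ∀ (Y : Type) [AddCommGroup Y] [Module A Y] (f : B →ₗ[A] Y), Function.Surjective f →
    ¬ Function.Injective f → Has m Y
  ext : ∀ (X : Type) [AddCommGroup X] [Module A X] (i : B →ₗ[A] X), Function.Injective i →
    Has (rperp A m) X → Has m (X ⧸ LinearMap.range i) → Function.Surjective i

/-- The torsion class generated by `m` and `B`. -/
def adjoin (m : Set (ModuleCat.{0} A)) (B : ModuleCat.{0} A) : Set (ModuleCat.{0} A) :=
  lperp A {Y | Y ∈ rperp A m ∧ ∀ f : B →ₗ[A] Y, f = 0}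

variable [IsNoetherianRing A] [IsArtinianRing A] {m : Set (ModuleCat.{0} A)} {B : ModuleCat.{0} A}

theorem isTorsionClass_adjoin : IsTorsionClass A (adjoin m B) := isTorsionClass_lperp _

theorem subset_adjoin (hm : IsTorsionClass A m) : m ⊆ adjoin m B :=
  fun X hX => ⟨hm.1 X hX, fun _ hY f => hY.1.2 X hX f⟩

theorem IsMinExtending.mem_adjoin (hB : IsMinExtending m B) : B ∈ adjoin m B :=
  ⟨hB.mem.1, fun _ hY f => hY.2 f⟩

theorem adjoin_subset {U : Set (ModuleCat.{0} A)} (hU : IsTorsionClass A U) (h : m ⊆ U)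
    (hBU : B ∈ U) : adjoin m B ⊆ U := by
  intro X hX
  rw [← hU.lperp_rperp ⟨B, hBU⟩]
  exact ⟨hX.1, fun Y hY f => hX.2 Y ⟨⟨hY.1, fun Z hZ => hY.2 Z (h hZ)⟩, hY.2 B hBU⟩ f⟩

variable {X Y Z V : Type} [AddCommGroup X] [Module A X] [AddCommGroup Y] [Module A Y]
  [AddCommGroup Z] [Module A Z] [AddCommGroup V] [Module A V]

theorem IsMinExtending.injective (hB : IsMinExtending m B) (hX : Has (rperp A m) X)
    (f : B →ₗ[A] X) (hf : f ≠ 0) : Function.Injective f := by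
  by_contra h
  apply hf
  have h1 : Has m (LinearMap.range f) := hB.quot _ f.rangeRestrict f.surjective_rangeRestrict
    fun hi => h fun x y hxy => hi (Subtype.ext hxy)
  have h2 := (has_rperp.1 hX).2 _ h1 (LinearMap.range f).subtype
  ext b
  exact LinearMap.congr_fun h2 ⟨f b, b, rfl⟩

theorem IsMinExtending.quot_mem (hm : IsTorsionClass A m) (hne : m.Nonempty)
    (hB : IsMinExtending m B) (hX : Has (rperp A m) X) (i : B →ₗ[A] X)
    (hi : Function.Injective i) : Has (rperp A m) (X ⧸ LinearMap.range i) := by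
  have hXf : Module.Finite A X := (has_rperp.1 hX).1
  obtain ⟨S, hS, hS'⟩ := hm.exists_radical hne (X ⧸ LinearMap.range i)
  let X1 : Submodule A X := S.comap (LinearMap.range i).mkQ
  let i1 : B →ₗ[A] X1 := i.codRestrict X1 fun b => by
    have : (LinearMap.range i).mkQ (i b) = 0 := (Submodule.Quotient.mk_eq_zero _).2 ⟨b, rfl⟩
    exact Submodule.mem_comap.2 (this ▸ zero_mem _)
  have hi1 : Function.Injective i1 := fun a b h => hi (congrArg Subtype.val h)
  let g : X1 →ₗ[A] S := (LinearMap.range i).mkQ.restrict fun x hx => hx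
  have hg : Has m (X1 ⧸ LinearMap.range i1) := by
    have hk : ∀ s : S, ∃ x : X1, g x = s := by
      rintro ⟨s, hs⟩
      obtain ⟨x, rfl⟩ := (LinearMap.range i).mkQ_surjective s
      exact ⟨⟨x, hs⟩, rfl⟩
    obtain ⟨v, hv⟩ := exists_factor_of_surjective g hk (LinearMap.range i1).mkQ fun x hx => by
      obtain ⟨b, hb⟩ := (Submodule.Quotient.mk_eq_zero _).1 (congrArg Subtype.val hx)
      exact (Submodule.Quotient.mk_eq_zero _).2 ⟨b, Subtype.ext hb⟩
    refine hm.quot hS v fun y => ?_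
    obtain ⟨x, rfl⟩ := (LinearMap.range i1).mkQ_surjective y
    exact ⟨g x, hv x⟩
  have hX1 : Has (rperp A m) X1 :=
    (isTorsionFreeClass_rperp m).sub hX X1.subtype X1.subtype_injective
  have hs := hB.ext X1 i1 hi1 hX1 hg
  have hS0 : S = ⊥ := by
    rw [eq_bot_iff]
    intro s hs'
    obtain ⟨x, rfl⟩ := (LinearMap.range i).mkQ_surjective s
    obtain ⟨b, hb⟩ := hs ⟨x, hs'⟩
    exact (Submodule.Quotient.mk_eq_zero _).2 ⟨b, congrArg Subtype.val hb⟩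
  exact (isTorsionFreeClass_rperp m).equiv hS' (Submodule.quotEquivOfEqBot S hS0)

theorem IsMinExtending.exists_sub (hm : IsTorsionClass A m) (hne : m.Nonempty)
    (hB : IsMinExtending m B) (hV : Has (adjoin m B) V) (hV' : Has (rperp A m) V)
    [Nontrivial V] : ∃ j : B →ₗ[A] V, Function.Injective j ∧
      Has (adjoin m B) (V ⧸ LinearMap.range j) ∧ Has (rperp A m) (V ⧸ LinearMap.range j) := by
  have : ∃ j : B →ₗ[A] V, j ≠ 0 := by
    by_contra! h
    have h1 := hV.2 (ModuleCat.of A V) ⟨hV', h⟩ LinearMap.id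
    obtain ⟨v, hv⟩ := exists_ne (0 : V)
    exact hv (LinearMap.congr_fun h1 v)
  obtain ⟨j, hj⟩ := this
  have hji := hB.injective hV' j hj
  exact ⟨j, hji, isTorsionClass_adjoin.quot hV _ (Submodule.mkQ_surjective _),
    hB.quot_mem hm hne hV' j hji⟩

theorem IsMinExtending.len_quot_lt (hB : IsMinExtending m B) [Module.Finite A V]
    (j : B →ₗ[A] V) (hj : Function.Injective j) :
    len A (V ⧸ LinearMap.range j) < len A V := by
  have h1 := len_sub_add (LinearMap.range j)
  have h2 : len A (LinearMap.range j) ≠ 0 := by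
    rw [Ne, len_eq_zero, not_subsingleton_iff_nontrivial]
    have := hB.nontrivial
    exact (LinearEquiv.ofInjective j hj).symm.toEquiv.nontrivial
  omega

theorem IsMinExtending.quot_mem_of_adjoin (hm : IsTorsionClass A m) (hne : m.Nonempty)
    (hB : IsMinExtending m B) (n : ℕ) : ∀ (V X Z : Type) [AddCommGroup V] [Module A V]
    [AddCommGroup X] [Module A X] [AddCommGroup Z] [Module A Z] (i : V →ₗ[A] X) (q : X →ₗ[A] Z),
    len A V ≤ n → Function.Injective i → Function.Surjective q →
    (LinearMap.ker q = LinearMap.range i) → Has (adjoin m B) V → Has (rperp A m) X →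
    Has (rperp A m) Z := by
  induction n with
  | zero =>
    intro V X Z _ _ _ _ _ _ i q hn hi hq hk hV hX
    have := isTorsionClass_adjoin.finite hV
    have hs : Subsingleton V := len_eq_zero.1 (Nat.le_zero.1 hn)
    have hqi : Function.Injective q := by
      rw [← LinearMap.ker_eq_bot, hk, eq_bot_iff]
      rintro _ ⟨v, rfl⟩
      simp [Subsingleton.elim v 0]
    exact (isTorsionFreeClass_rperp m).equiv hX (LinearEquiv.ofBijective q ⟨hqi, hq⟩)
  | succ n ih =>
    intro V X Z _ _ _ _ _ _ i q hn hi hq hk hV hX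
    have := isTorsionClass_adjoin.finite hV
    rcases subsingleton_or_nontrivial V with hs | hs
    · exact ih V X Z i q (by rw [len_eq_zero.2 hs]; exact Nat.zero_le _) hi hq hk hV hX
    have hV' := (isTorsionFreeClass_rperp m).sub hX i hi
    obtain ⟨j, hj, h1, h2⟩ := hB.exists_sub hm hne hV hV'
    have hX' := hB.quot_mem hm hne hX (i ∘ₗ j) (hi.comp hj)
    have hle : LinearMap.range j ≤ (LinearMap.range (i ∘ₗ j)).comap i := by
      rintro _ ⟨b, rfl⟩
      exact ⟨b, rfl⟩
    let i' := (LinearMap.range j).mapQ (LinearMap.range (i ∘ₗ j)) i hle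
    have hle2 : LinearMap.range (i ∘ₗ j) ≤ LinearMap.ker q := by
      rw [hk]
      rintro _ ⟨b, rfl⟩
      exact ⟨j b, rfl⟩
    let q' := (LinearMap.range (i ∘ₗ j)).liftQ q hle2
    refine ih _ _ Z i' q' ?_ ?_ ?_ ?_ h1 hX'
    · have := hB.len_quot_lt j hj
      omega
    · rw [← LinearMap.ker_eq_bot, eq_bot_iff]
      intro x hx
      obtain ⟨v, rfl⟩ := (LinearMap.range j).mkQ_surjective x
      obtain ⟨b, hb⟩ := (Submodule.Quotient.mk_eq_zero _).1 hx
      exact (Submodule.Quotient.mk_eq_zero _).2 ⟨b, hi hb⟩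
    · intro z
      obtain ⟨x, rfl⟩ := hq z
      exact ⟨Submodule.mkQ _ x, rfl⟩
    · ext x
      obtain ⟨x, rfl⟩ := (LinearMap.range (i ∘ₗ j)).mkQ_surjective x
      constructor
      · intro h
        have h : x ∈ LinearMap.ker q := h
        rw [hk] at h
        obtain ⟨v, rfl⟩ := h
        exact ⟨Submodule.mkQ _ v, rfl⟩
      · rintro ⟨v, hv⟩
        obtain ⟨v, rfl⟩ := (LinearMap.range j).mkQ_surjective v
        have : q' (i' (Submodule.mkQ _ v)) = 0 := by
          change q (i v) = 0
          rw [← LinearMap.mem_ker, hk]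
          exact ⟨v, rfl⟩
        rw [hv] at this
        exact this

theorem IsMinExtending.injective_of_ker (hm : IsTorsionClass A m) (hne : m.Nonempty)
    (hB : IsMinExtending m B) (n : ℕ) : ∀ (V Y : Type) [AddCommGroup V] [Module A V]
    [AddCommGroup Y] [Module A Y] (f : V →ₗ[A] Y),
    len A V ≤ n → Has (adjoin m B) V → Has (rperp A m) V → Has (rperp A m) Y →
    (∀ g : B →ₗ[A] V, (∀ b, f (g b) = 0) → g = 0) → Function.Injective f := by
  induction n with
  | zero =>
    intro V Y _ _ _ _ f hn hV hV' hY h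
    have := isTorsionClass_adjoin.finite hV
    have hs : Subsingleton V := len_eq_zero.1 (Nat.le_zero.1 hn)
    exact fun x y _ => Subsingleton.elim x y
  | succ n ih =>
    intro V Y _ _ _ _ f hn hV hV' hY h
    have := isTorsionClass_adjoin.finite hV
    rcases subsingleton_or_nontrivial V with hs | hs
    · exact fun x y _ => Subsingleton.elim x y
    obtain ⟨j, hj, h1, h2⟩ := hB.exists_sub hm hne hV hV'
    have hfj : Function.Injective (f ∘ₗ j) := hB.injective hY _ fun h0 => by
      have hj0 := h j fun b => LinearMap.congr_fun h0 b
      have := hB.nontrivial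
      obtain ⟨b, hb⟩ := exists_ne (0 : B)
      exact hb (hj (by simp [hj0]))
    have hle : LinearMap.range j ≤ (LinearMap.range (f ∘ₗ j)).comap f := by
      rintro _ ⟨b, rfl⟩
      exact ⟨b, rfl⟩
    let f' := (LinearMap.range j).mapQ (LinearMap.range (f ∘ₗ j)) f hle
    have hker : ∀ v : V, f' (Submodule.mkQ _ v) = 0 →
        ∃ v' : LinearMap.ker f, Submodule.mkQ (LinearMap.range j) v'.1 = Submodule.mkQ _ v := by
      intro v hv
      obtain ⟨b, hb⟩ := (Submodule.Quotient.mk_eq_zero _).1 hv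
      refine ⟨⟨v - j b, ?_⟩, ?_⟩
      · rw [LinearMap.mem_ker, map_sub, ← hb]
        simp
      · rw [map_sub, sub_eq_self]
        exact (Submodule.Quotient.mk_eq_zero _).2 ⟨b, rfl⟩
    have hinj : Function.Injective ((LinearMap.range j).mkQ ∘ₗ (LinearMap.ker f).subtype) := by
      rw [← LinearMap.ker_eq_bot, eq_bot_iff]
      rintro ⟨v, hv⟩ hx
      obtain ⟨b, rfl⟩ := (Submodule.Quotient.mk_eq_zero _).1 hx
      have : b = 0 := hfj (by rw [map_zero]; exact hv)
      simp [this]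
    have hf' : Function.Injective f' := by
      refine ih _ _ f' ?_ h1 h2 (hB.quot_mem hm hne hY _ hfj) fun g hg => ?_
      · have := hB.len_quot_lt j hj
        omega
      · obtain ⟨g', hg'⟩ := exists_factor_of_injective _ hinj g fun b => by
          obtain ⟨v, hv⟩ := (LinearMap.range j).mkQ_surjective (g b)
          obtain ⟨v', hv'⟩ := hker v (by rw [hv, hg])
          exact ⟨v', hv'.trans hv⟩
        have h0 := h ((LinearMap.ker f).subtype ∘ₗ g') fun b => (g' b).2
        ext b
        rw [← hg']
        have : ((g' b : LinearMap.ker f) : V) = 0 := LinearMap.congr_fun h0 b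
        simp [this]
    rw [← LinearMap.ker_eq_bot, eq_bot_iff]
    intro v hv
    have h3 : Submodule.mkQ (LinearMap.range j) v = 0 := hf' (by
      rw [map_zero]
      change Submodule.mkQ _ (f v) = 0
      rw [LinearMap.mem_ker.1 hv, map_zero])
    have h4 : (⟨v, hv⟩ : LinearMap.ker f) = 0 := hinj (by rw [map_zero]; exact h3)
    exact congrArg Subtype.val h4

theorem IsMinExtending.ker_mem (hm : IsTorsionClass A m) (hne : m.Nonempty)
    (hB : IsMinExtending m B) (hV : Has (adjoin m B) V) (hV' : Has (rperp A m) V)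
    (hY : Has (rperp A m) Y) (f : V →ₗ[A] Y) : Has (adjoin m B) (LinearMap.ker f) := by
  have := isTorsionClass_adjoin.finite hV
  have hne' : (adjoin m B).Nonempty := ⟨B, hB.mem_adjoin⟩
  obtain ⟨S, hS, hS'⟩ := isTorsionClass_adjoin.exists_radical hne' (LinearMap.ker f)
  let S' : Submodule A V := S.map (LinearMap.ker f).subtype
  have hSS' : Has (adjoin m B) S' := isTorsionClass_adjoin.equiv hS
    (Submodule.equivMapOfInjective _ (Submodule.subtype_injective _) S)
  have hle : S' ≤ LinearMap.ker f := Submodule.map_subtype_le _ _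
  have hVF := hB.quot_mem_of_adjoin hm hne _ S' V (V ⧸ S') S'.subtype S'.mkQ le_rfl
    S'.subtype_injective S'.mkQ_surjective (by simp) hSS' hV'
  have hVE : Has (adjoin m B) (V ⧸ S') := isTorsionClass_adjoin.quot hV _ S'.mkQ_surjective
  have hinj := hB.injective_of_ker hm hne _ (V ⧸ S') Y (S'.liftQ f hle) le_rfl hVE hVF hY
    fun g hg => by
      let ι : (LinearMap.ker f ⧸ S) →ₗ[A] (V ⧸ S') :=
        S.mapQ S' (LinearMap.ker f).subtype fun s hs => ⟨s, hs, rfl⟩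
      have hι : Function.Injective ι := by
        rw [← LinearMap.ker_eq_bot, eq_bot_iff]
        intro x hx
        obtain ⟨v, rfl⟩ := S.mkQ_surjective x
        obtain ⟨s, hs, hsv⟩ := (Submodule.Quotient.mk_eq_zero _).1 hx
        have : s = v := Subtype.ext hsv
        exact (Submodule.Quotient.mk_eq_zero _).2 (this ▸ hs)
      obtain ⟨g', hg'⟩ := exists_factor_of_injective ι hι g fun b => by
        obtain ⟨v, hv⟩ := S'.mkQ_surjective (g b)
        have h0 : f v = 0 := by
          have := hg b
          rw [← hv] at this
          exact this
        exact ⟨S.mkQ ⟨v, h0⟩, hv⟩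
      have h0 := (has_rperp.1 hS').2 B hB.mem_adjoin g'
      ext b
      rw [← hg', h0]
      simp
  have hSt : S = ⊤ := by
    rw [eq_top_iff]
    rintro ⟨v, hv⟩ _
    have h1 : S'.mkQ v = 0 := hinj (by rw [map_zero]; exact hv)
    obtain ⟨s, hs, hsv⟩ := (Submodule.Quotient.mk_eq_zero _).1 h1
    have : s = ⟨v, hv⟩ := Subtype.ext hsv
    exact this ▸ hs
  subst hSt
  exact isTorsionClass_adjoin.equiv hS Submodule.topEquiv

end Brick

section ExistsBrick

theorem exists_le_of_measure {α : Type*} (s : Set α) (μ : α → ℕ) (hs : s.Nonempty) :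
    ∃ a ∈ s, ∀ b ∈ s, μ a ≤ μ b := by
  obtain ⟨a, ha, h⟩ := exists_minimalFor_of_wellFoundedLT (· ∈ s) μ hs
  refine ⟨a, ha, fun b hb => ?_⟩
  by_contra hlt
  exact hlt (h hb (le_of_not_ge hlt))

variable {k A : Type} [Field k] [Ring A] [Algebra k A] [FiniteDimensional k A]
variable {N : Type} [AddCommGroup N] [Module A N] [Module k N] [IsScalarTower k A N]
  [SMulCommClass A k N] [Module.Finite A N]
variable {X Y : Type} [AddCommGroup X] [Module A X] [AddCommGroup Y] [Module A Y]

theorem finiteDimensional_hom [Module.Finite A X] : FiniteDimensional k (X →ₗ[A] N) := by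
  obtain ⟨n, f, hf⟩ := Module.Finite.exists_fin' A X
  have : Module.Finite k N := Module.Finite.trans A N
  let ev : (X →ₗ[A] N) →ₗ[k] (Fin n → N) :=
    { toFun := fun g i => g (f (Pi.single i 1))
      map_add' := fun _ _ => rfl
      map_smul' := fun _ _ => rfl }
  refine Module.Finite.of_injective ev fun g h hgh => ?_
  ext x
  obtain ⟨v, rfl⟩ := hf x
  rw [← LinearMap.comp_apply, ← LinearMap.comp_apply, hom_eq_sum, hom_eq_sum (h ∘ₗ f)]
  exact Finset.sum_congr rfl fun i _ => congrArg _ (congrFun hgh i)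

theorem finrank_hom_le (f : X →ₗ[A] Y) [Module.Finite A X]
    (hf : ∀ g : Y →ₗ[A] N, g ∘ₗ f = 0 → g = 0) :
    Module.finrank k (Y →ₗ[A] N) ≤ Module.finrank k (X →ₗ[A] N) := by
  have := finiteDimensional_hom (k := k) (A := A) (N := N) (X := X)
  let r : (Y →ₗ[A] N) →ₗ[k] (X →ₗ[A] N) :=
    { toFun := fun g => g ∘ₗ f
      map_add' := fun _ _ => rfl
      map_smul' := fun _ _ => rfl }
  exact LinearMap.finrank_le_finrank_of_injective (f := r)
    ((injective_iff_map_eq_zero r).2 hf)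

theorem finrank_hom_lt (f : X →ₗ[A] Y) (hf : Function.Surjective f) [Module.Finite A X]
    {x : X} (hx : f x = 0) (g : X →ₗ[A] N) (hg : g x ≠ 0) :
    Module.finrank k (Y →ₗ[A] N) < Module.finrank k (X →ₗ[A] N) := by
  have := finiteDimensional_hom (k := k) (A := A) (N := N) (X := X)
  let r : (Y →ₗ[A] N) →ₗ[k] (X →ₗ[A] N) :=
    { toFun := fun g => g ∘ₗ f
      map_add' := fun _ _ => rfl
      map_smul' := fun _ _ => rfl }
  have hr : Function.Injective r := fun g h hgh => by
    ext y
    obtain ⟨x, rfl⟩ := hf y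
    exact LinearMap.congr_fun hgh x
  rw [← LinearMap.finrank_range_of_inj hr]
  refine Submodule.finrank_lt fun htop => hg ?_
  obtain ⟨h, hh⟩ : g ∈ LinearMap.range r := htop ▸ Submodule.mem_top
  rw [← hh]
  change h (f x) = 0
  rw [hx, map_zero]

theorem len_le_finrank_hom_mul (hX : Has (Sub (ModuleCat.of A N)) X) :
    len A X ≤ Module.finrank k (X →ₗ[A] N) * len A N := by
  have := isNoetherianRing_of_finiteDimensional k (A := A)
  have := isArtinianRing_of_finiteDimensional k (A := A)
  obtain ⟨hfin, hX⟩ := has_sub_iff.1 hX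
  have := finiteDimensional_hom (k := k) (A := A) (N := N) (X := X)
  let b := Module.finBasis k (X →ₗ[A] N)
  rw [← len_pi]
  refine len_le_of_injective (LinearMap.pi fun i => b i) ((injective_iff_map_eq_zero _).2 ?_)
  intro x hx
  refine hX x fun f => ?_
  have : f = ∑ i, b.repr f i • b i := (b.sum_repr f).symm
  rw [this, LinearMap.sum_apply]
  refine Finset.sum_eq_zero fun i _ => ?_
  rw [LinearMap.smul_apply, show b i x = 0 from congrFun hx i, smul_zero]

end ExistsBrick

section ExistsMin

variable {A : Type} [Ring A]

theorem exists_isMinExtending (k : Type) [Field k] [Algebra k A] [FiniteDimensional k A]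
    {m U : Set (ModuleCat.{0} A)} (hm : IsTorsionClass A m) (hne : m.Nonempty)
    (N : ModuleCat.{0} A) [Module.Finite A N] (hN : rperp A m = Sub N)
    (hU : IsTorsionClass A U) (hmU : m ⊂ U) : ∃ B ∈ U, IsMinExtending m B := by
  have := isNoetherianRing_of_finiteDimensional k (A := A)
  have := isArtinianRing_of_finiteDimensional k (A := A)
  let _ : Module k N := Module.compHom N (algebraMap k A)
  have : IsScalarTower k A N := ⟨fun c a m => by
    change (c • a) • m = (algebraMap k A c) • a • m
    rw [smul_smul, Algebra.smul_def]⟩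
  have : SMulCommClass A k N := IsScalarTower.to_smulCommClass'
  have hF := isTorsionFreeClass_rperp m
  obtain ⟨X, hXU, hXm⟩ := Set.exists_of_ssubset hmU
  have hne' : U.Nonempty := ⟨X, hXU⟩
  have hXf : Module.Finite A X := hU.1 X hXU
  let s : Set (ModuleCat.{0} A) := {B | B ∈ U ∧ B ∈ rperp A m ∧ Nontrivial B}
  have key : ∀ (Y : Type) [AddCommGroup Y] [Module A Y], Has U Y → ¬ Has m Y →
      ∃ S : Submodule A Y, ModuleCat.of A (Y ⧸ S) ∈ s := fun Y _ _ hYU hYm => by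
    have : Module.Finite A Y := hU.finite hYU
    obtain ⟨S, hS, hS'⟩ := hm.exists_radical hne Y
    refine ⟨S, hU.quot hYU S.mkQ S.mkQ_surjective, hS', ?_⟩
    by_contra hnt
    have : Subsingleton (Y ⧸ S) := not_nontrivial_iff_subsingleton.1 hnt
    exact hYm (hm.2.2.of_sub S hS (hm.zero hne))
  let h : ModuleCat.{0} A → ℕ := fun B => Module.finrank k (B →ₗ[A] N)
  obtain ⟨B₀, hB₀, hmin₀⟩ := exists_le_of_measure s h (by
    obtain ⟨S, hS⟩ := key X hXU hXm
    exact ⟨_, hS⟩)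
  obtain ⟨B, ⟨hB, hBh⟩, hmax⟩ := exists_le_of_measure {B | B ∈ s ∧ h B = h B₀}
    (fun B => h B₀ * len A N - len A B) ⟨B₀, hB₀, rfl⟩
  have hBf : Module.Finite A B := hU.1 B hB.1
  refine ⟨B, hB.1, hB.2.2, hB.2.1, fun Y _ _ f hf hinj => ?_, fun Y _ _ i hi hY hY' => ?_⟩
  · by_contra hY
    obtain ⟨S, hS⟩ := key Y (hU.quot hB.1 f hf) hY
    rw [injective_iff_map_eq_zero] at hinj
    push Not at hinj
    obtain ⟨x, hx, hx0⟩ := hinj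
    have hBsub : Has (Sub N) B := hN ▸ hB.2.1
    have : ∃ g : B →ₗ[A] N, g x ≠ 0 := by
      by_contra! hg
      exact hx0 ((has_sub_iff.1 hBsub).2 x hg)
    obtain ⟨g, hg⟩ := this
    have := finrank_hom_lt (k := k) (S.mkQ ∘ₗ f) (S.mkQ_surjective.comp hf) (x := x)
      (by rw [LinearMap.comp_apply, hx, map_zero]) g hg
    have h2 := hmin₀ _ hS
    rw [← hBh] at h2
    exact absurd this (not_lt.2 h2)
  · have hYU : Has U Y := hU.2.2.ses i (LinearMap.range i).mkQ hi (Submodule.mkQ_surjective _)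
      (by simp) hB.1 (hmU.subset hY')
    have hYf := hU.finite hYU
    have hs : ModuleCat.of A Y ∈ s := ⟨hYU, hY, by
      have := hB.2.2
      exact hi.nontrivial⟩
    have hle : h (ModuleCat.of A Y) ≤ h B := finrank_hom_le (k := k) i fun g hg => by
      obtain ⟨v, hv⟩ := exists_factor_of_surjective (LinearMap.range i).mkQ
        (Submodule.mkQ_surjective _) g fun y hy => by
          obtain ⟨b, rfl⟩ := (Submodule.Quotient.mk_eq_zero _).1 hy
          exact LinearMap.congr_fun hg b
      have hN' : Has (rperp A m) N := hN ▸ self_mem_sub N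
      have := (has_rperp.1 hN').2 _ hY' v
      ext y
      rw [← hv, this]
      rfl
    have heq : h (ModuleCat.of A Y) = h B₀ := le_antisymm (hle.trans hBh.le) (hmin₀ _ hs)
    have h3 := hmax _ ⟨hs, heq⟩
    have h4 : len A Y ≤ h (ModuleCat.of A Y) * len A N := len_le_finrank_hom_mul (hN ▸ hY)
    rw [heq] at h4
    refine surjective_of_injective_of_len_le i hi ?_
    change h B₀ * len A N - len A B ≤ h B₀ * len A N - len A Y at h3
    have h5 := len_le_of_injective i hi
    omega

end ExistsMin

section Intermediate

variable {A : Type} [Ring A]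

theorem IsMinExtending.exists_universal (k : Type) [Field k] [Algebra k A] [FiniteDimensional k A]
    {m : Set (ModuleCat.{0} A)} (hm : IsTorsionClass A m) (hne : m.Nonempty)
    (N : ModuleCat.{0} A) [Module.Finite A N] (hN : rperp A m = Sub N) {B : ModuleCat.{0} A}
    (hB : IsMinExtending m B) :
    ∃ (X : ModuleCat.{0} A) (w : X), X ∈ adjoin m B ∧
      ∀ (V : Type) [AddCommGroup V] [Module A V], Has (adjoin m B) V → Has (rperp A m) V →
        ∀ v : V, ∃ f : X →ₗ[A] V, f w = v := by
  have := isNoetherianRing_of_finiteDimensional k (A := A)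
  have := isArtinianRing_of_finiteDimensional k (A := A)
  have hF := isTorsionFreeClass_rperp m
  have hFne := rperp_nonempty m
  have hT : IsTorsionClass A (adjoin m B) := isTorsionClass_adjoin
  have hTne : (adjoin m B).Nonempty := ⟨B, hB.mem_adjoin⟩
  obtain ⟨I, hI, hI'⟩ := hT.exists_radical hTne N
  have hNF : Has (rperp A m) N := hN ▸ self_mem_sub N
  have hIF : Has (rperp A m) I := hF.sub hNF I.subtype I.subtype_injective
  have hIfin := hF.finite hIF
  obtain ⟨d, w, hw⟩ := exists_universal_vector (A := A) k I
  have hId : Has (adjoin m B) (Fin d → I) := hT.pi hTne fun _ => hI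
  obtain ⟨S, ⟨hwS, hS⟩, hmin⟩ := exists_le_of_measure
    {S : Submodule A (Fin d → I) | w ∈ S ∧ Has (adjoin m B) S} (fun S => len A S)
    ⟨⊤, Submodule.mem_top, hT.equiv hId Submodule.topEquiv.symm⟩
  have hSF : Has (rperp A m) S := hF.sub (hF.pi hFne fun _ => hIF) S.subtype S.subtype_injective
  have hSfin := hT.finite hS
  refine ⟨ModuleCat.of A S, ⟨w, hwS⟩, hS, fun V _ _ hV hV' v => ?_⟩
  obtain ⟨-, n, i₀, hi₀⟩ : Has (Sub N) V := hN ▸ hV'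
  have hland : ∀ j x, i₀ x j ∈ I := fun j x => by
    have := (has_rperp.1 hI').2 V hV (I.mkQ ∘ₗ LinearMap.proj j ∘ₗ i₀)
    exact (Submodule.Quotient.mk_eq_zero I).1 (LinearMap.congr_fun this x)
  let i : V →ₗ[A] (Fin n → I) := LinearMap.pi fun j =>
    (LinearMap.proj j ∘ₗ i₀).codRestrict I (hland j)
  have hi : Function.Injective i := fun x y hxy => hi₀ <| funext fun j =>
    congrArg Subtype.val (congrFun hxy j)
  choose g hg using fun j => hw (i v j)
  let q := (LinearMap.range i).mkQ
  have hZ : Has (rperp A m) ((Fin n → I) ⧸ LinearMap.range i) :=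
    hB.quot_mem_of_adjoin hm hne (len A V) V _ _ i q le_rfl hi (Submodule.mkQ_surjective _)
      (by simp [q]) hV (hF.pi hFne fun _ => hIF)
  let f : S →ₗ[A] (Fin n → I) := LinearMap.pi g ∘ₗ S.subtype
  have hker := hB.ker_mem hm hne hS hSF hZ (q ∘ₗ f)
  have hwf : f ⟨w, hwS⟩ = i v := funext hg
  have hle := hmin ((LinearMap.ker (q ∘ₗ f)).map S.subtype) ⟨⟨⟨w, hwS⟩, by
      change q (f ⟨w, hwS⟩) = 0
      rw [hwf]
      exact (Submodule.Quotient.mk_eq_zero _).2 ⟨v, rfl⟩, rfl⟩,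
    hT.equiv hker (Submodule.equivMapOfInjective _ S.subtype_injective _)⟩
  have htop := eq_top_of_len_le _ (hle.trans_eq
    (len_equiv (Submodule.equivMapOfInjective S.subtype S.subtype_injective _)).symm)
  obtain ⟨u, hu⟩ := exists_factor_of_injective i hi f fun x =>
    (Submodule.Quotient.mk_eq_zero _).1 (htop ▸ Submodule.mem_top : x ∈ LinearMap.ker (q ∘ₗ f))
  exact ⟨u, hi (by rw [hu]; exact hwf)⟩

/-- Between a functorially finite torsion class and a larger torsion class there is another
functorially finite torsion class. -/
theorem exists_intermediate (k : Type) [Field k] [Algebra k A] [FiniteDimensional k A]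
    (M : ModuleCat.{0} A) [Module.Finite A M] (hm : IsTorsionClass A (Fac A M))
    {U : Set (ModuleCat.{0} A)} (hU : IsTorsionClass A U) (hmU : Fac A M ⊂ U) :
    ∃ E : ModuleCat.{0} A, Module.Finite A E ∧ IsTorsionClass A (Fac A E) ∧
      Fac A M ⊂ Fac A E ∧ Fac A E ⊆ U := by
  classical
  have := isNoetherianRing_of_finiteDimensional k (A := A)
  have := isArtinianRing_of_finiteDimensional k (A := A)
  have hne : (Fac A M).Nonempty := ⟨M, self_mem_fac M⟩
  obtain ⟨N, hNfin, hN⟩ := exists_cogenerator k M hm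
  obtain ⟨B, hBU, hB⟩ := exists_isMinExtending k hm hne N hN hU hmU
  obtain ⟨X, w, hX, huniv⟩ := hB.exists_universal k hm hne N hN
  have hT : IsTorsionClass A (adjoin (Fac A M) B) := isTorsionClass_adjoin
  suffices h : ∃ E : ModuleCat.{0} A, Module.Finite A E ∧ Fac A E = adjoin (Fac A M) B by
    obtain ⟨E, hE, hEq⟩ := h
    refine ⟨E, hE, hEq ▸ hT, hEq ▸ ⟨subset_adjoin hm, fun hsub => ?_⟩,
      hEq ▸ adjoin_subset hU hmU.subset hBU⟩
    have h0 := hB.mem.2 B (hsub hB.mem_adjoin) LinearMap.id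
    have := hB.nontrivial
    obtain ⟨b, hb⟩ := exists_ne (0 : B)
    exact hb (LinearMap.congr_fun h0 b)
  obtain ⟨M₀, w₀, hM₀, -, hM₀u⟩ := exists_left_approx k M
  have hM₀fin : Module.Finite A M₀ := finMods_fac M M₀ hM₀
  have hXfin : Module.Finite A X := hT.1 X hX
  obtain ⟨s, p₀, hp₀⟩ := Module.Finite.exists_fin' A X
  -- a free cover of `X` in which the first basis vector is sent to `w`
  let p : (A × (Fin s → A)) →ₗ[A] X := (LinearMap.toSpanSingleton A X w).coprod p₀
  have hp : Function.Surjective p := fun x => by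
    obtain ⟨y, hy⟩ := hp₀ x
    exact ⟨(0, y), by simp [p, hy]⟩
  obtain ⟨r, x, hx⟩ := Submodule.fg_iff_exists_fin_generating_family.1
    (IsNoetherian.noetherian (LinearMap.ker p))
  let D : Submodule A ((Fin r → M₀) × (A × (Fin s → A))) :=
    Submodule.span A (Set.range fun i => (Pi.single i w₀, - x i))
  let E := ((Fin r → M₀) × (A × (Fin s → A))) ⧸ D
  have hxK : ∀ i, p (x i) = 0 := fun i =>
    (hx ▸ Submodule.subset_span ⟨i, rfl⟩ : x i ∈ LinearMap.ker p)
  let ι : (Fin r → M₀) →ₗ[A] E := D.mkQ ∘ₗ LinearMap.inl A _ _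
  let π : E →ₗ[A] X := D.liftQ (p ∘ₗ LinearMap.snd A _ _) (by
    rw [Submodule.span_le]
    rintro _ ⟨i, rfl⟩
    simp [hxK])
  have hπ : Function.Surjective π := fun y => by
    obtain ⟨l, rfl⟩ := hp y
    exact ⟨D.mkQ (0, l), rfl⟩
  have hEm : Has (adjoin (Fac A M) B) E := by
    refine hT.2.2.of_ker π hπ (subset_adjoin hm ?_) hX
    have h1 : LinearMap.range ι = LinearMap.ker π := by
      apply le_antisymm
      · rintro _ ⟨y, rfl⟩
        change p 0 = 0
        exact map_zero p
      · intro e he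
        obtain ⟨⟨y, l⟩, rfl⟩ := D.mkQ_surjective e
        have hl : l ∈ Submodule.span A (Set.range x) := hx ▸ (he : p l = 0)
        have h2 : ∀ l ∈ Submodule.span A (Set.range x), D.mkQ (0, l) ∈ LinearMap.range ι := by
          intro l hl
          induction hl using Submodule.span_induction with
          | mem l hl =>
            obtain ⟨i, rfl⟩ := hl
            refine ⟨Pi.single i w₀, ?_⟩
            rw [← sub_eq_zero]
            change D.mkQ (Pi.single i w₀, 0) - D.mkQ (0, x i) = 0
            rw [← map_sub]
            refine (Submodule.Quotient.mk_eq_zero D).2 (Submodule.subset_span ⟨i, ?_⟩)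
            simp
          | zero => exact zero_mem (LinearMap.range ι)
          | add a b _ _ ha hb =>
            have : D.mkQ (0, a + b) = D.mkQ (0, a) + D.mkQ (0, b) := by
              rw [← map_add]
              simp
            rw [this]
            exact add_mem ha hb
          | smul c a _ ha =>
            have : D.mkQ (0, c • a) = c • D.mkQ (0, a) := by
              rw [← map_smul]
              simp
            rw [this]
            exact Submodule.smul_mem _ c ha
        have h3 : D.mkQ (y, l) = ι y + D.mkQ (0, l) := by
          change _ = D.mkQ (y, 0) + _
          rw [← map_add]
          simp
        rw [h3]
        exact add_mem ⟨y, rfl⟩ (h2 l hl)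
    rw [← h1]
    exact hm.range (hm.pi hne fun _ => hM₀) ι
  have hEfin : Module.Finite A E := hT.finite hEm
  refine ⟨ModuleCat.of A E, hEfin, (hT.fac_subset hEm).antisymm fun Y hY => ?_⟩
  have hYfin : Module.Finite A Y := hT.1 Y hY
  refine has_fac_iff.2 fun y => ?_
  obtain ⟨t, ht, ht'⟩ := hm.exists_radical hne Y
  obtain ⟨g, hg⟩ := huniv (Y ⧸ t) (hT.quot hY t.mkQ t.mkQ_surjective) ht' (t.mkQ y)
  obtain ⟨h₀, hh₀⟩ := Module.projective_lifting_property t.mkQ (g ∘ₗ p₀) t.mkQ_surjective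
  let h : (A × (Fin s → A)) →ₗ[A] Y := (LinearMap.toSpanSingleton A Y y).coprod h₀
  have hh : ∀ l, t.mkQ (h l) = g (p l) := fun l => by
    have := LinearMap.congr_fun hh₀ l.2
    rw [LinearMap.comp_apply, LinearMap.comp_apply] at this
    simp only [h, p, LinearMap.coprod_apply, LinearMap.toSpanSingleton_apply, map_add, map_smul,
      this, hg]
  have hxt : ∀ i, h (x i) ∈ t := fun i => (Submodule.Quotient.mk_eq_zero t).1 (by
    have := hh (x i)
    rwa [hxK, map_zero] at this)
  choose φ hφ using fun i => hM₀u t ht ⟨h (x i), hxt i⟩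
  let Ψ₀ : ((Fin r → M₀) × (A × (Fin s → A))) →ₗ[A] Y :=
    (∑ i, t.subtype ∘ₗ φ i ∘ₗ LinearMap.proj i).coprod h
  let Ψ : E →ₗ[A] Y := D.liftQ Ψ₀ (by
    rw [Submodule.span_le]
    rintro _ ⟨i, rfl⟩
    have h4 : ∑ j, ((φ j ((Pi.single i w₀ : Fin r → M₀) j) : t) : Y) = h (x i) := by
      rw [Finset.sum_eq_single i]
      · simp [hφ]
      · intro j _ hj
        simp [Pi.single_eq_of_ne hj]
      · simp
    simp [Ψ₀, h4])
  refine Submodule.mem_iSup_of_mem Ψ ⟨D.mkQ (0, (1, 0)), ?_⟩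
  change Ψ₀ (0, (1, 0)) = y
  simp [Ψ₀, h]

end Intermediate

section Duality

/-- A `k`-linear anti-isomorphism of algebras. -/
structure AntiEquiv (k A B : Type) [Field k] [Ring A] [Algebra k A] [Ring B] [Algebra k B] where
  toEquiv : A ≃ₗ[k] B
  map_mul : ∀ a b, toEquiv (a * b) = toEquiv b * toEquiv a

namespace AntiEquiv

variable {k A B : Type} [Field k] [Ring A] [Algebra k A] [Ring B] [Algebra k B]

theorem map_one (σ : AntiEquiv k A B) : σ.toEquiv 1 = 1 := by
  obtain ⟨u, hu⟩ := σ.toEquiv.surjective 1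
  have := σ.map_mul u 1
  rw [mul_one, hu, mul_one] at this
  exact this.symm

theorem map_algebraMap (σ : AntiEquiv k A B) (c : k) :
    σ.toEquiv (algebraMap k A c) = algebraMap k B c := by
  rw [Algebra.algebraMap_eq_smul_one, map_smul, σ.map_one, Algebra.algebraMap_eq_smul_one]

/-- The inverse anti-isomorphism. -/
def symm (σ : AntiEquiv k A B) : AntiEquiv k B A :=
  ⟨σ.toEquiv.symm, fun a b => σ.toEquiv.injective (by simp [σ.map_mul])⟩

/-- The canonical anti-isomorphism onto the opposite algebra. -/
def op (k A : Type) [Field k] [Ring A] [Algebra k A] : AntiEquiv k A Aᵐᵒᵖ :=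
  ⟨MulOpposite.opLinearEquiv k, fun a b => by simp⟩

end AntiEquiv

variable {k A B : Type} [Field k] [Ring A] [Algebra k A] [Ring B] [Algebra k B]

/-- A perfect `k`-bilinear pairing of an `A`-module and a `B`-module which is compatible with the
actions along `σ`. -/
structure Pairing (σ : AntiEquiv k A B) (X Y : Type) [AddCommGroup X] [Module A X]
    [AddCommGroup Y] [Module B Y] where
  val : X →+ Y →+ k
  smul : ∀ a x y, val (a • x) y = val x (σ.toEquiv a • y)
  scalar : ∀ c x y, val (algebraMap k A c • x) y = c * val x y
  left_surj : ∀ φ : X →+ k, (∀ c x, φ (algebraMap k A c • x) = c * φ x) →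
    ∃ y, ∀ x, val x y = φ x
  left_inj : ∀ y, (∀ x, val x y = 0) → y = 0
  right_surj : ∀ φ : Y →+ k, (∀ c y, φ (algebraMap k B c • y) = c * φ y) →
    ∃ x, ∀ y, val x y = φ y
  right_inj : ∀ x, (∀ y, val x y = 0) → x = 0

namespace Pairing

variable {σ : AntiEquiv k A B} {X Y X' Y' X'' Y'' : Type} [AddCommGroup X] [Module A X]
  [AddCommGroup Y] [Module B Y] [AddCommGroup X'] [Module A X'] [AddCommGroup Y'] [Module B Y']
  [AddCommGroup X''] [Module A X''] [AddCommGroup Y''] [Module B Y'']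

theorem scalar' (β : Pairing σ X Y) (c : k) (x : X) (y : Y) :
    β.val x (algebraMap k B c • y) = c * β.val x y := by
  rw [← σ.map_algebraMap, ← β.smul, β.scalar]

/-- The pairing with the roles of the two modules exchanged. -/
def symm (β : Pairing σ X Y) : Pairing σ.symm Y X where
  val := β.val.flip
  smul a y x := by
    simp only [AddMonoidHom.flip_apply, AntiEquiv.symm]
    rw [β.smul, LinearEquiv.apply_symm_apply]
  scalar c y x := β.scalar' c x y
  left_surj := β.right_surj
  left_inj := β.right_inj
  right_surj := β.left_surj
  right_inj := β.left_inj

theorem ext_right (β : Pairing σ X Y) {y y' : Y} (h : ∀ x, β.val x y = β.val x y') : y = y' :=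
  sub_eq_zero.1 (β.left_inj _ fun x => by rw [map_sub, h, sub_self])

theorem exists_adjoint (β : Pairing σ X Y) (β' : Pairing σ X' Y') (f : X →ₗ[A] X') :
    ∃ g : Y' →ₗ[B] Y, ∀ x y, β.val x (g y) = β'.val (f x) y := by
  have h : ∀ y, ∃ z, ∀ x, β.val x z = β'.val (f x) y := fun y =>
    β.left_surj ((β'.val.flip y).comp f.toAddMonoidHom) fun c x => by
      change β'.val (f _) y = c * β'.val (f x) y
      rw [map_smul, β'.scalar]
  choose g hg using h
  refine ⟨{ toFun := g, map_add' := fun a b => ?_, map_smul' := fun b y => ?_ }, fun x y => hg y x⟩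
  · exact β.ext_right fun x => by simp [hg]
  · refine β.ext_right fun x => ?_
    obtain ⟨a, rfl⟩ := σ.toEquiv.surjective b
    rw [hg, RingHom.id_apply, ← β'.smul, ← β.smul, hg, f.map_smul]

theorem injective_adjoint (β : Pairing σ X Y) (β' : Pairing σ X' Y') {f : X →ₗ[A] X'}
    {g : Y' →ₗ[B] Y} (h : ∀ x y, β.val x (g y) = β'.val (f x) y) (hf : Function.Surjective f) :
    Function.Injective g := by
  refine (injective_iff_map_eq_zero g).2 fun y hy => β'.left_inj y fun x => ?_
  obtain ⟨x, rfl⟩ := hf x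
  rw [← h, hy, map_zero]

/-- A functional vanishing on the kernel of `g` factors through the surjection `g`. -/
theorem exists_functional (g : X →ₗ[A] X') (hg : Function.Surjective g) (φ : X →+ k)
    (hφ : ∀ c x, φ (algebraMap k A c • x) = c * φ x) (h : ∀ x, g x = 0 → φ x = 0) :
    ∃ ψ : X' →+ k, (∀ c x, ψ (algebraMap k A c • x) = c * ψ x) ∧ ∀ x, ψ (g x) = φ x := by
  have key : ∀ a b, g a = g b → φ a = φ b := fun a b hab =>
    sub_eq_zero.1 (by rw [← map_sub]; exact h _ (by rw [map_sub, hab, sub_self]))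
  choose s hs using hg
  refine ⟨⟨⟨fun x => φ (s x), ?_⟩, fun x y => ?_⟩, fun c x => ?_, fun x => key _ _ (hs _)⟩
  · exact h _ (hs 0)
  · change φ _ = φ _ + φ _
    rw [← map_add]
    exact key _ _ (by rw [map_add, hs, hs, hs])
  · change φ _ = c * φ _
    rw [← hφ]
    exact key _ _ (by rw [map_smul, hs, hs])

theorem surjective_adjoint (β : Pairing σ X Y) (β' : Pairing σ X' Y') {f : X →ₗ[A] X'}
    {g : Y' →ₗ[B] Y} (h : ∀ x y, β.val x (g y) = β'.val (f x) y) (hf : Function.Injective f) :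
    Function.Surjective g := by
  intro y
  let _ : Module k X := Module.compHom X (algebraMap k A)
  let _ : Module k X' := Module.compHom X' (algebraMap k A)
  let fk : X →ₗ[k] X' :=
    { toFun := f, map_add' := map_add f, map_smul' := fun c x => f.map_smul _ x }
  let φ : X →ₗ[k] k :=
    { toFun := fun x => β.val x y, map_add' := fun a b => by simp,
      map_smul' := fun c x => β.scalar c x y }
  obtain ⟨ρ, hρ⟩ := fk.exists_leftInverse_of_injective (LinearMap.ker_eq_bot.2 hf)
  obtain ⟨y', hy'⟩ := β'.left_surj (φ ∘ₗ ρ).toAddMonoidHom fun c x => (φ ∘ₗ ρ).map_smul c x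
  refine ⟨y', β.ext_right fun x => ?_⟩
  rw [h, hy']
  exact congrArg φ (LinearMap.congr_fun hρ x)

theorem exact_adjoint (β : Pairing σ X Y) (β' : Pairing σ X' Y') (β'' : Pairing σ X'' Y'')
    {f : X →ₗ[A] X'} {f' : X' →ₗ[A] X''} {g : Y' →ₗ[B] Y} {g' : Y'' →ₗ[B] Y'}
    (h : ∀ x y, β.val x (g y) = β'.val (f x) y) (h' : ∀ x y, β'.val x (g' y) = β''.val (f' x) y)
    (hf' : Function.Surjective f') (he : LinearMap.range f = LinearMap.ker f') :
    LinearMap.range g' = LinearMap.ker g := by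
  apply le_antisymm
  · rintro _ ⟨y, rfl⟩
    refine β.left_inj _ fun x => ?_
    have : f' (f x) = 0 := (he ▸ ⟨x, rfl⟩ : f x ∈ LinearMap.ker f')
    rw [h, h', this, map_zero, AddMonoidHom.zero_apply]
  · intro y hy
    obtain ⟨ψ, hψ, hψ'⟩ := exists_functional f' hf' (β'.val.flip y) (fun c x => β'.scalar c x y)
      fun x hx => by
        obtain ⟨z, rfl⟩ : x ∈ LinearMap.range f := he ▸ hx
        change β'.val (f z) y = 0
        rw [← h, (hy : g y = 0), map_zero]
    obtain ⟨y'', hy''⟩ := β''.left_surj ψ hψ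
    exact ⟨y'', β'.ext_right fun x => by rw [h', hy'', hψ']; rfl⟩

/-- The coordinatewise pairing of powers. -/
def pi (β : Pairing σ X Y) (n : ℕ) : Pairing σ (Fin n → X) (Fin n → Y) where
  val := AddMonoidHom.mk' (fun x => AddMonoidHom.mk' (fun y => ∑ i, β.val (x i) (y i))
    fun y y' => by simp [Finset.sum_add_distrib]) fun x x' => by
      ext y; simp [Finset.sum_add_distrib]
  smul a x y := by simp [β.smul]
  scalar c x y := by simp [β.scalar, Finset.mul_sum]
  left_surj φ hφ := by
    choose y hy using fun i => β.left_surj (φ.comp (AddMonoidHom.single (fun _ => X) i))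
      fun c x => by
        have := hφ c (Pi.single i x)
        rwa [← Pi.single_smul] at this
    refine ⟨y, fun x => ?_⟩
    have : φ x = ∑ i, φ (Pi.single i (x i)) := by
      rw [← map_sum, Finset.univ_sum_single]
    rw [this]
    simp only [AddMonoidHom.mk'_apply]
    exact Finset.sum_congr rfl fun i _ => hy i (x i)
  left_inj y hy := funext fun i => β.left_inj _ fun x => by
    have := hy (Pi.single i x)
    simp only [AddMonoidHom.mk'_apply] at this
    rw [Finset.sum_eq_single i (fun j _ hj => by simp [Pi.single_eq_of_ne hj]) (by simp)] at this
    simpa using this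
  right_surj φ hφ := by
    choose y hy using fun i => β.right_surj (φ.comp (AddMonoidHom.single (fun _ => Y) i))
      fun c x => by
        have := hφ c (Pi.single i x)
        rwa [← Pi.single_smul] at this
    refine ⟨y, fun x => ?_⟩
    have : φ x = ∑ i, φ (Pi.single i (x i)) := by
      rw [← map_sum, Finset.univ_sum_single]
    rw [this]
    simp only [AddMonoidHom.mk'_apply]
    exact Finset.sum_congr rfl fun i _ => hy i (x i)
  right_inj y hy := funext fun i => β.right_inj _ fun x => by
    have := hy (Pi.single i x)
    simp only [AddMonoidHom.mk'_apply] at this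
    rw [Finset.sum_eq_single i (fun j _ hj => by simp [Pi.single_eq_of_ne hj]) (by simp)] at this
    simpa using this

variable [FiniteDimensional k A]

theorem exists_right (σ : AntiEquiv k A B) (X : Type) [AddCommGroup X] [Module A X]
    [Module.Finite A X] :
    ∃ Y : ModuleCat.{0} B, Module.Finite B Y ∧ Nonempty (Pairing σ X Y) := by
  let _ : Module k X := Module.compHom X (algebraMap k A)
  have : IsScalarTower k A X := ⟨fun c a m => by
    change (c • a) • m = (algebraMap k A c) • a • m
    rw [smul_smul, Algebra.smul_def]⟩
  have : SMulCommClass A k X := IsScalarTower.to_smulCommClass'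
  have : Module.Finite k X := Module.Finite.trans A X
  let D := X →ₗ[k] k
  let act (b : B) : X →ₗ[k] X :=
    { toFun := fun x => σ.symm.toEquiv b • x
      map_add' := smul_add _
      map_smul' := fun c x => smul_comm _ _ _ }
  let _ : Module B D :=
    { smul := fun b φ => φ ∘ₗ act b
      one_smul := fun φ => LinearMap.ext fun x => by
        change φ (σ.symm.toEquiv 1 • x) = φ x
        rw [σ.symm.map_one, one_smul]
      mul_smul := fun a b φ => LinearMap.ext fun x => by
        change φ (σ.symm.toEquiv (a * b) • x) = φ (σ.symm.toEquiv b • σ.symm.toEquiv a • x)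
        rw [σ.symm.map_mul, mul_smul]
      smul_zero := fun a => rfl
      smul_add := fun a φ ψ => rfl
      add_smul := fun a b φ => LinearMap.ext fun x => by
        change φ (σ.symm.toEquiv (a + b) • x) =
          φ (σ.symm.toEquiv a • x) + φ (σ.symm.toEquiv b • x)
        rw [map_add, add_smul, map_add]
      zero_smul := fun φ => LinearMap.ext fun x => by
        change φ (σ.symm.toEquiv 0 • x) = 0
        rw [map_zero, zero_smul, map_zero] }
  have hs : ∀ (b : B) (φ : D) (x : X), (b • φ) x = φ (σ.symm.toEquiv b • x) := fun _ _ _ => rfl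
  have hc : ∀ (c : k) (φ : D), algebraMap k B c • φ = c • φ := fun c φ => LinearMap.ext fun x => by
    rw [hs, σ.symm.map_algebraMap]
    exact φ.map_smul c x
  refine ⟨ModuleCat.of B D, ?_, ⟨⟨AddMonoidHom.mk' (fun x => AddMonoidHom.mk' (fun φ : D => φ x)
    fun _ _ => rfl) fun a b => by ext φ; exact map_add φ a b, ?_, ?_, ?_, ?_, ?_, ?_⟩⟩⟩
  · obtain ⟨s, hs⟩ : (⊤ : Submodule k D).FG := Module.Finite.fg_top
    refine ⟨⟨s, eq_top_iff.2 fun φ _ => ?_⟩⟩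
    have hφ : φ ∈ Submodule.span k (s : Set D) := hs ▸ Submodule.mem_top
    induction hφ using Submodule.span_induction with
    | mem x hx => exact Submodule.subset_span hx
    | zero => exact zero_mem _
    | add x y _ _ h1 h2 => exact add_mem (h1 trivial) (h2 trivial)
    | smul c x _ h1 => rw [← hc]; exact Submodule.smul_mem _ _ (h1 trivial)
  · intro a x φ
    change φ (a • x) = φ (σ.toEquiv.symm (σ.toEquiv a) • x)
    rw [LinearEquiv.symm_apply_apply]
  · intro c x φ
    exact φ.map_smul c x
  · intro φ hφ
    exact ⟨(⟨⟨φ, map_add φ⟩, hφ⟩ : D), fun x => rfl⟩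
  · intro φ hφ
    exact LinearMap.ext hφ
  · intro φ hφ
    let φ' : Module.Dual k (Module.Dual k X) :=
      ⟨⟨φ, map_add φ⟩, fun c y => by
        change φ (c • y) = c * φ y
        rw [← hφ]
        exact congrArg φ (hc c y).symm⟩
    obtain ⟨x, hx⟩ := (Module.evalEquiv k X).surjective φ'
    exact ⟨x, fun y => LinearMap.congr_fun hx y⟩
  · intro x hx
    exact (Module.forall_dual_apply_eq_zero_iff k x).1 hx

end Pairing

end Duality

section DualClass

variable {k A B : Type} [Field k] [Ring A] [Algebra k A] [Ring B] [Algebra k B]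
  [FiniteDimensional k A] [FiniteDimensional k B] {σ : AntiEquiv k A B}
variable {X Y X' Y' : Type} [AddCommGroup X] [Module A X]
  [AddCommGroup Y] [Module B Y] [AddCommGroup X'] [Module A X'] [AddCommGroup Y'] [Module B Y']

theorem Pairing.exists_left (σ : AntiEquiv k A B) (Y : Type) [AddCommGroup Y] [Module B Y]
    [Module.Finite B Y] :
    ∃ X : ModuleCat.{0} A, Module.Finite A X ∧ Nonempty (Pairing σ X Y) := by
  obtain ⟨X, hX, ⟨β⟩⟩ := Pairing.exists_right σ.symm Y
  exact ⟨X, hX, ⟨β.symm⟩⟩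

theorem Pairing.nonempty_equiv (β : Pairing σ X Y) (β' : Pairing σ X' Y) :
    Nonempty (X ≃ₗ[A] X') := by
  obtain ⟨g, hg⟩ := β'.symm.exists_adjoint β.symm LinearMap.id
  exact ⟨LinearEquiv.ofBijective g
    ⟨β'.symm.injective_adjoint β.symm hg Function.surjective_id,
      β'.symm.surjective_adjoint β.symm hg Function.injective_id⟩⟩

/-- The finite modules paired with a module in `F`. -/
def dualClass (σ : AntiEquiv k A B) (F : Set (ModuleCat.{0} A)) : Set (ModuleCat.{0} B) :=
  {Y | Module.Finite B Y ∧ ∃ X ∈ F, Nonempty (Pairing σ X Y)}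

/-- `F` is closed under isomorphisms. -/
def IsoClosed (F : Set (ModuleCat.{0} A)) : Prop :=
  ∀ (X Y : ModuleCat.{0} A), X ∈ F → Nonempty (X ≃ₗ[A] Y) → Y ∈ F

variable {F G : Set (ModuleCat.{0} A)}

theorem IsTorsionClass.isoClosed (hT : IsTorsionClass A F) : IsoClosed F :=
  fun _ _ hX ⟨e⟩ => hT.equiv hX e

theorem IsTorsionFreeClass.isoClosed (hT : IsTorsionFreeClass A F) : IsoClosed F :=
  fun _ _ hX ⟨e⟩ => hT.equiv hX e

theorem IsoClosed.of_dualClass (hF : IsoClosed F) (h : Has (dualClass σ F) Y)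
    (β : Pairing σ X Y) : Has F X := by
  obtain ⟨-, X', hX', ⟨β'⟩⟩ := h
  exact hF X' (ModuleCat.of A X) hX' (β'.nonempty_equiv β)

theorem dualClass_mono (h : F ⊆ G) : dualClass σ F ⊆ dualClass σ G :=
  fun _ ⟨hY, X, hX, hβ⟩ => ⟨hY, X, h hX, hβ⟩

theorem dualClass_symm (hF : IsoClosed F) (hfin : FinMods A F) :
    dualClass σ.symm (dualClass σ F) = F := by
  ext X
  constructor
  · rintro ⟨-, Y, hY, ⟨β⟩⟩
    exact hF.of_dualClass hY β.symm
  · intro hX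
    have := hfin X hX
    obtain ⟨Y, hY, ⟨β⟩⟩ := Pairing.exists_right σ X
    exact ⟨this, Y, ⟨hY, X, hX, ⟨β⟩⟩, ⟨β.symm⟩⟩

theorem IsTorsionFreeClass.dualClass (hF : IsTorsionFreeClass A F) :
    IsTorsionClass B (dualClass σ F) := by
  refine ⟨fun Y h => h.1, fun Y hY Z f hf => ?_, fun X Y Z f g ⟨hf, hg, hfg⟩ hX hZ => ?_⟩
  · obtain ⟨hYf, X, hX, ⟨β⟩⟩ := hY
    have := Module.Finite.of_surjective f hf
    obtain ⟨X', hX'f, ⟨β'⟩⟩ := Pairing.exists_left σ Z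
    obtain ⟨f', hf'⟩ := β.symm.exists_adjoint β'.symm f
    exact ⟨this, X', hF.sub hX f' (β.symm.injective_adjoint β'.symm hf' hf), ⟨β'⟩⟩
  · have := isNoetherianRing_of_finiteDimensional k (A := B)
    obtain ⟨hXf, X', hX', ⟨β⟩⟩ := hX
    obtain ⟨hZf, Z', hZ', ⟨γ⟩⟩ := hZ
    have : Module.Finite B (Y ⧸ LinearMap.range f) := by
      rw [hfg]
      exact Module.Finite.equiv (g.quotKerEquivOfSurjective hg).symm
    have : Module.Finite B Y := Module.Finite.of_submodule_quotient (LinearMap.range f)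
    obtain ⟨Y', hY'f, ⟨δ⟩⟩ := Pairing.exists_left σ Y
    obtain ⟨f', hf'⟩ := β.symm.exists_adjoint δ.symm f
    obtain ⟨g', hg'⟩ := δ.symm.exists_adjoint γ.symm g
    exact ⟨this, Y', hF.2.2.ses g' f' (δ.symm.injective_adjoint γ.symm hg' hg)
      (β.symm.surjective_adjoint δ.symm hf' hf)
      (Pairing.exact_adjoint β.symm δ.symm γ.symm hf' hg' hg hfg) hZ' hX', ⟨δ⟩⟩

theorem IsTorsionClass.dualClass (hF : IsTorsionClass A F) :
    IsTorsionFreeClass B (dualClass σ F) := by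
  have := isNoetherianRing_of_finiteDimensional k (A := B)
  refine ⟨fun Y h => h.1, fun Y hY Z f hf => ?_, fun X Y Z f g ⟨hf, hg, hfg⟩ hX hZ => ?_⟩
  · obtain ⟨hYf, X, hX, ⟨β⟩⟩ := hY
    have := Module.Finite.of_injective f hf
    obtain ⟨X', hX'f, ⟨β'⟩⟩ := Pairing.exists_left σ Z
    obtain ⟨f', hf'⟩ := β'.symm.exists_adjoint β.symm f
    exact ⟨this, X', hF.quot hX f' (β'.symm.surjective_adjoint β.symm hf' hf), ⟨β'⟩⟩
  · obtain ⟨hXf, X', hX', ⟨β⟩⟩ := hX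
    obtain ⟨hZf, Z', hZ', ⟨γ⟩⟩ := hZ
    have : Module.Finite B (Y ⧸ LinearMap.range f) := by
      rw [hfg]
      exact Module.Finite.equiv (g.quotKerEquivOfSurjective hg).symm
    have : Module.Finite B Y := Module.Finite.of_submodule_quotient (LinearMap.range f)
    obtain ⟨Y', hY'f, ⟨δ⟩⟩ := Pairing.exists_left σ Y
    obtain ⟨f', hf'⟩ := β.symm.exists_adjoint δ.symm f
    obtain ⟨g', hg'⟩ := δ.symm.exists_adjoint γ.symm g
    exact ⟨this, Y', hF.2.2.ses g' f' (δ.symm.injective_adjoint γ.symm hg' hg)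
      (β.symm.surjective_adjoint δ.symm hf' hf)
      (Pairing.exact_adjoint β.symm δ.symm γ.symm hf' hg' hg hfg) hZ' hX', ⟨δ⟩⟩

theorem dualClass_sub {N : ModuleCat.{0} A} {N' : ModuleCat.{0} B} [Module.Finite B N']
    (β : Pairing σ N N') : dualClass σ (Sub N) = Fac B N' := by
  have := isNoetherianRing_of_finiteDimensional k (A := A)
  ext Y
  constructor
  · rintro ⟨hY, X, ⟨hX, n, f, hf⟩, ⟨γ⟩⟩
    obtain ⟨g, hg⟩ := γ.exists_adjoint (β.pi n) f
    exact ⟨n, g, γ.surjective_adjoint (β.pi n) hg hf⟩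
  · rintro ⟨n, f, hf⟩
    have : Module.Finite B Y := Module.Finite.of_surjective f hf
    obtain ⟨X, hX, ⟨γ⟩⟩ := Pairing.exists_left σ Y
    obtain ⟨g, hg⟩ := (β.pi n).symm.exists_adjoint γ.symm f
    exact ⟨this, X, ⟨hX, n, g, (β.pi n).symm.injective_adjoint γ.symm hg hf⟩, ⟨γ⟩⟩

theorem dualClass_fac {N : ModuleCat.{0} A} {N' : ModuleCat.{0} B} [Module.Finite B N']
    (β : Pairing σ N N') : dualClass σ (Fac A N) = Sub N' := by
  have := isNoetherianRing_of_finiteDimensional k (A := A)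
  ext Y
  constructor
  · rintro ⟨hY, X, ⟨n, f, hf⟩, ⟨γ⟩⟩
    obtain ⟨g, hg⟩ := (β.pi n).exists_adjoint γ f
    exact ⟨hY, n, g, (β.pi n).injective_adjoint γ hg hf⟩
  · rintro ⟨hY, n, f, hf⟩
    obtain ⟨X, hX, ⟨γ⟩⟩ := Pairing.exists_left σ Y
    obtain ⟨g, hg⟩ := γ.symm.exists_adjoint (β.pi n).symm f
    exact ⟨hY, X, ⟨n, g, γ.symm.surjective_adjoint (β.pi n).symm hg hf⟩, ⟨γ⟩⟩

theorem dualClass_lperp (hfin : FinMods A F) :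
    dualClass σ (lperp A F) = rperp B (dualClass σ F) := by
  ext Y
  constructor
  · rintro ⟨hY, X, hX, ⟨β⟩⟩
    refine ⟨hY, fun T ⟨_, T', hT', ⟨γ⟩⟩ f => ?_⟩
    obtain ⟨g, hg⟩ := γ.symm.exists_adjoint β.symm f
    rw [hX.2 T' hT' g] at hg
    ext t
    exact β.left_inj _ fun x => (hg t x).symm.trans (map_zero _)
  · intro hY
    have := hY.1
    obtain ⟨X, hX, ⟨β⟩⟩ := Pairing.exists_left σ Y
    refine ⟨hY.1, X, ⟨hX, fun T hT f => ?_⟩, ⟨β⟩⟩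
    have := hfin T hT
    obtain ⟨T', hT', ⟨γ⟩⟩ := Pairing.exists_right σ T
    obtain ⟨g, hg⟩ := β.exists_adjoint γ f
    rw [hY.2 T' ⟨hT', T, hT, ⟨γ⟩⟩ g] at hg
    ext t
    exact γ.right_inj _ fun x => (hg t x).symm.trans (map_zero _)

end DualClass

section Consequences

variable {A : Type} [Ring A]

theorem isFTorsionClass_lperp_sub (k : Type) [Field k] [Algebra k A]
    [FiniteDimensional k A] (N : ModuleCat.{0} A) [Module.Finite A N]
    (hF : IsTorsionFreeClass A (Sub N)) : IsFTorsionClass A (lperp A (Sub N)) := by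
  have := isNoetherianRing_of_finiteDimensional k (A := A)
  have := isArtinianRing_of_finiteDimensional k (A := A)
  refine ⟨isTorsionClass_lperp _, ?_⟩
  let σ := AntiEquiv.op k A
  have : FiniteDimensional k Aᵐᵒᵖ := Module.Finite.equiv σ.toEquiv
  obtain ⟨N', hN', ⟨β⟩⟩ := Pairing.exists_right σ N
  have hd := dualClass_sub β
  obtain ⟨Z', hZ', hZ'eq⟩ := exists_cogenerator k N' (hd ▸ hF.dualClass)
  obtain ⟨Z, hZ, ⟨γ⟩⟩ := Pairing.exists_left σ Z'
  refine ⟨Z, hZ, ?_⟩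
  rw [← dualClass_symm (σ := σ) (isTorsionClass_lperp _).isoClosed (isTorsionClass_lperp _).1,
    dualClass_lperp (finMods_sub N), hd, hZ'eq, dualClass_sub γ.symm]

/-- Between a torsionfree class cogenerated by one module and a larger torsionfree class there is
another torsionfree class cogenerated by one module. -/
theorem exists_intermediate_torsionFree (k : Type) [Field k] [Algebra k A]
    [FiniteDimensional k A] (N : ModuleCat.{0} A) [Module.Finite A N]
    (hF : IsTorsionFreeClass A (Sub N)) {G : Set (ModuleCat.{0} A)} (hG : IsTorsionFreeClass A G)
    (h : Sub N ⊂ G) : ∃ E : ModuleCat.{0} A, Module.Finite A E ∧ IsTorsionFreeClass A (Sub E) ∧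
      Sub N ⊂ Sub E ∧ Sub E ⊆ G := by
  let σ := AntiEquiv.op k A
  have : FiniteDimensional k Aᵐᵒᵖ := Module.Finite.equiv σ.toEquiv
  obtain ⟨N', hN', ⟨β⟩⟩ := Pairing.exists_right σ N
  have hd := dualClass_sub β
  obtain ⟨E', hE', hE't, hlt, hle⟩ := exists_intermediate k N' (hd ▸ hF.dualClass)
    (hG.dualClass (σ := σ)) (hd ▸ ⟨dualClass_mono h.1, fun hsub => h.2 (by
      have := dualClass_mono (σ := σ.symm) hsub
      rwa [dualClass_symm hG.isoClosed hG.1, dualClass_symm hF.isoClosed hF.1] at this)⟩)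
  obtain ⟨E, hE, ⟨γ⟩⟩ := Pairing.exists_left σ E'
  have hdE := dualClass_sub γ
  have hEd : dualClass σ.symm (Fac _ E') = Sub E := dualClass_fac γ.symm
  refine ⟨E, hE, hEd ▸ hE't.dualClass, ⟨?_, fun hsub => hlt.2 ?_⟩, ?_⟩
  · rw [← hEd, ← dualClass_symm (σ := σ) hF.isoClosed hF.1, hd]
    exact dualClass_mono hlt.1
  · rw [← hd, ← hdE]
    exact dualClass_mono hsub
  · rw [← hEd, ← dualClass_symm (σ := σ) hG.isoClosed hG.1]
    exact dualClass_mono hle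

/-- Between a torsion class and a larger functorially finite torsion class there is another
functorially finite torsion class. -/
theorem exists_intermediate_below (k : Type) [Field k] [Algebra k A]
    [FiniteDimensional k A] (M : ModuleCat.{0} A) [Module.Finite A M]
    (hM : IsTorsionClass A (Fac A M)) {J : Set (ModuleCat.{0} A)} (hJ : IsTorsionClass A J)
    (hne : J.Nonempty) (h : J ⊂ Fac A M) :
    ∃ T, IsFTorsionClass A T ∧ J ⊆ T ∧ T ⊂ Fac A M := by
  have := isNoetherianRing_of_finiteDimensional k (A := A)
  have := isArtinianRing_of_finiteDimensional k (A := A)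
  obtain ⟨N, hN, hNeq⟩ := exists_cogenerator k M hM
  have hMne : (Fac A M).Nonempty := ⟨M, self_mem_fac M⟩
  have hsub : Sub N ⊂ rperp A J := by
    rw [← hNeq]
    refine ⟨fun X hX => ⟨hX.1, fun T hT f => hX.2 T (h.1 hT) f⟩, fun hle => h.2 ?_⟩
    rw [← hJ.lperp_rperp hne, ← hM.lperp_rperp hMne]
    exact fun X hX => ⟨hX.1, fun T hT f => hX.2 T (hle hT) f⟩
  obtain ⟨E, hE, hEt, hlt, hle⟩ := exists_intermediate_torsionFree k N
    (hNeq ▸ isTorsionFreeClass_rperp _) (isTorsionFreeClass_rperp J) hsub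
  have hanti : lperp A (Sub E) ⊆ Fac A M := by
    rw [← hM.lperp_rperp hMne, hNeq]
    exact fun X hX => ⟨hX.1, fun T hT f => hX.2 T (hlt.1 hT) f⟩
  refine ⟨_, isFTorsionClass_lperp_sub k E hEt, ?_, hanti, fun hsup => hlt.2 ?_⟩
  · rw [← hJ.lperp_rperp hne]
    exact fun X hX => ⟨hX.1, fun T hT f => hX.2 T (hle hT) f⟩
  · rw [← hEt.rperp_lperp ⟨E, self_mem_sub E⟩, ← hNeq]
    exact fun X hX => ⟨hX.1, fun T hT f => hX.2 T (hsup hT) f⟩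

end Consequences

section Decomposition

variable {A : Type} [Ring A] {S S' : Set (ModuleCat.{0} A)}
variable {X Y Z : Type} [AddCommGroup X] [Module A X] [AddCommGroup Y] [Module A Y]
  [AddCommGroup Z] [Module A Z]

theorem AddOfSet.equiv (hX : Has (AddOfSet A S) X) (e : X ≃ₗ[A] Y) : Has (AddOfSet A S) Y := by
  obtain ⟨n, C, hC, ⟨f⟩⟩ := hX
  exact ⟨n, C, hC, ⟨e.symm.trans f⟩⟩

theorem AddOfSet.of_subsingleton [Subsingleton X] : Has (AddOfSet A S) X :=
  ⟨0, fun i => i.elim0, fun i => i.elim0, ⟨LinearEquiv.ofBijective (0 : X →ₗ[A] _)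
    ⟨fun _ _ _ => Subsingleton.elim _ _, fun _ => ⟨0, Subsingleton.elim _ _⟩⟩⟩⟩

theorem AddOfSet.of_mem {M : ModuleCat.{0} A} (hM : M ∈ S) : M ∈ AddOfSet A S :=
  ⟨1, fun _ => M, fun _ => hM, ⟨(LinearEquiv.funUnique (Fin 1) A M).symm⟩⟩

theorem AddOfSet.prod (hX : Has (AddOfSet A S) X) (hY : Has (AddOfSet A S) Y) :
    Has (AddOfSet A S) (X × Y) := by
  obtain ⟨n, C, hC, ⟨e⟩⟩ := hX
  obtain ⟨m, D, hD, ⟨f⟩⟩ := hY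
  let E : Fin n ⊕ Fin m → ModuleCat.{0} A := Sum.elim C D
  have hE : ∀ i, E i ∈ S := by
    rintro (j | j)
    exacts [hC j, hD j]
  exact ⟨n + m, fun i => E (finSumFinEquiv.symm i), fun i => hE _, ⟨(e.prodCongr f).trans
    ((LinearEquiv.sumPiEquivProdPi A (Fin n) (Fin m) (fun i => (E i : Type))).symm.trans
      (LinearEquiv.piCongrLeft' A (fun i => (E i : Type)) finSumFinEquiv))⟩⟩

theorem AddOfSet.hom_eq_zero (h : ∀ M ∈ S, ∀ N ∈ S', HomZero A M N) (hX : Has (AddOfSet A S) X)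
    (hY : Has (AddOfSet A S') Y) (f : X →ₗ[A] Y) : f = 0 := by
  obtain ⟨n, C, hC, ⟨e⟩⟩ := hX
  obtain ⟨m, D, hD, ⟨d⟩⟩ := hY
  have h1 : d.toLinearMap ∘ₗ f ∘ₗ e.symm.toLinearMap = 0 := by
    refine LinearMap.pi_ext' fun i => ?_
    ext x j
    exact LinearMap.congr_fun (h _ (hC i) _ (hD j) (LinearMap.proj j ∘ₗ
      (d.toLinearMap ∘ₗ f ∘ₗ e.symm.toLinearMap) ∘ₗ LinearMap.single A (fun i => (C i : Type)) i)) x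
  ext x
  have := LinearMap.congr_fun h1 (e x)
  simpa using this

theorem AddOfSet.finite (h : ∀ M ∈ S, Module.Finite A M) (hX : Has (AddOfSet A S) X) :
    Module.Finite A X := by
  obtain ⟨n, C, hC, ⟨e⟩⟩ := hX
  have := fun i => h _ (hC i)
  exact Module.Finite.equiv e.symm

/-- Indecomposable finite modules lie in one of four classes `P`, `R`, `Q`, `O`, such that
`Hom(R, P)`, `Hom(Q, R)`, `Hom(Q, P)`, `Hom(R, O)` and `Hom(O, R)` vanish. -/
structure Separation (P R Q O : Set (ModuleCat.{0} A)) : Prop where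
  cover : ∀ X : ModuleCat.{0} A, Module.Finite A X → Indecomp A X →
    X ∈ P ∨ X ∈ R ∨ X ∈ Q ∨ X ∈ O
  finite : ∀ X ∈ R, Module.Finite A X
  hom_RP : ∀ X ∈ R, ∀ Y ∈ P, HomZero A X Y
  hom_QR : ∀ X ∈ Q, ∀ Y ∈ R, HomZero A X Y
  hom_QP : ∀ X ∈ Q, ∀ Y ∈ P, HomZero A X Y
  hom_RO : ∀ X ∈ R, ∀ Y ∈ O, HomZero A X Y
  hom_OR : ∀ X ∈ O, ∀ Y ∈ R, HomZero A X Y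

/-- A decomposition of a module into summands from four additive classes, given by mutually
inverse maps. -/
structure Decomp (P R Q O : Set (ModuleCat.{0} A)) (X : Type) [AddCommGroup X] [Module A X] where
  (XP XR XQ XO : ModuleCat.{0} A)
  memP : XP ∈ AddOfSet A P
  memR : XR ∈ AddOfSet A R
  memQ : XQ ∈ AddOfSet A Q
  memO : XO ∈ AddOfSet A O
  e : X ≃ₗ[A] (XP × XR) × (XQ × XO)

/-- Interchange of the middle factors of a product of products. -/
def prodInterchange (X Y X' Y' : Type) [AddCommGroup X] [Module A X] [AddCommGroup Y] [Module A Y]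
    [AddCommGroup X'] [Module A X'] [AddCommGroup Y'] [Module A Y'] :
    ((X × Y) × (X' × Y')) ≃ₗ[A] (X × X') × (Y × Y') where
  toFun p := ((p.1.1, p.2.1), (p.1.2, p.2.2))
  invFun p := ((p.1.1, p.2.1), (p.1.2, p.2.2))
  map_add' _ _ := rfl
  map_smul' _ _ := rfl
  left_inv _ := rfl
  right_inv _ := rfl

theorem Decomp.prod {P R Q O : Set (ModuleCat.{0} A)} (d : Decomp P R Q O X)
    (d' : Decomp P R Q O Y) : Nonempty (Decomp P R Q O (X × Y)) :=
  ⟨⟨ModuleCat.of A (d.XP × d'.XP), ModuleCat.of A (d.XR × d'.XR), ModuleCat.of A (d.XQ × d'.XQ),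
    ModuleCat.of A (d.XO × d'.XO), AddOfSet.prod d.memP d'.memP, AddOfSet.prod d.memR d'.memR,
    AddOfSet.prod d.memQ d'.memQ, AddOfSet.prod d.memO d'.memO,
    (d.e.prodCongr d'.e).trans ((prodInterchange _ _ _ _).trans
      ((prodInterchange _ _ _ _).prodCongr (prodInterchange _ _ _ _)))⟩⟩

theorem Decomp.of_equiv {P R Q O : Set (ModuleCat.{0} A)} (d : Decomp P R Q O X)
    (e : Y ≃ₗ[A] X) : Nonempty (Decomp P R Q O Y) :=
  ⟨{ d with e := e.trans d.e }⟩

theorem exists_decomp [IsNoetherianRing A] [IsArtinianRing A] {P R Q O : Set (ModuleCat.{0} A)}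
    (cover : ∀ X : ModuleCat.{0} A, Module.Finite A X → Indecomp A X →
      X ∈ P ∨ X ∈ R ∨ X ∈ Q ∨ X ∈ O) (n : ℕ) :
    ∀ (X : Type) [AddCommGroup X] [Module A X] [Module.Finite A X], len A X ≤ n →
      Nonempty (Decomp P R Q O X) := by
  let U := ModuleCat.of A PUnit
  have hU : ∀ S : Set (ModuleCat.{0} A), U ∈ AddOfSet A S := fun S =>
    AddOfSet.of_subsingleton (X := PUnit)
  have h0 : ∀ (X : Type) [AddCommGroup X] [Module A X] [Subsingleton X],
      Nonempty (Decomp P R Q O X) := fun X _ _ _ =>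
    ⟨⟨U, U, U, U, hU P, hU R, hU Q, hU O, LinearEquiv.ofBijective 0
      ⟨fun _ _ _ => Subsingleton.elim _ _, fun y => ⟨0, Subsingleton.elim _ _⟩⟩⟩⟩
  induction n with
  | zero =>
    intro X _ _ _ hX
    have : Subsingleton X := len_eq_zero.1 (Nat.le_zero.1 hX)
    exact h0 X
  | succ n ih =>
    intro X _ _ _ hX
    rcases subsingleton_or_nontrivial X with hs | hs
    · exact h0 X
    by_cases hind : Indecomp A (ModuleCat.of A X)
    · rcases cover (ModuleCat.of A X) ‹_› hind with h | h | h | h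
      · exact ⟨⟨ModuleCat.of A X, U, U, U, AddOfSet.of_mem h, hU R, hU Q, hU O,
          LinearEquiv.ofBijective (LinearMap.inl A _ _ ∘ₗ LinearMap.inl A X U)
            ⟨fun x y hxy => congrArg (fun p => p.1.1) hxy, fun p => ⟨p.1.1, rfl⟩⟩⟩⟩
      · exact ⟨⟨U, ModuleCat.of A X, U, U, hU P, AddOfSet.of_mem h, hU Q, hU O,
          LinearEquiv.ofBijective (LinearMap.inl A _ _ ∘ₗ LinearMap.inr A U X)
            ⟨fun x y hxy => congrArg (fun p => p.1.2) hxy, fun p => ⟨p.1.2, rfl⟩⟩⟩⟩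
      · exact ⟨⟨U, U, ModuleCat.of A X, U, hU P, hU R, AddOfSet.of_mem h, hU O,
          LinearEquiv.ofBijective (LinearMap.inr A _ _ ∘ₗ LinearMap.inl A X U)
            ⟨fun x y hxy => congrArg (fun p => p.2.1) hxy, fun p => ⟨p.2.1, rfl⟩⟩⟩⟩
      · exact ⟨⟨U, U, U, ModuleCat.of A X, hU P, hU R, hU Q, AddOfSet.of_mem h,
          LinearEquiv.ofBijective (LinearMap.inr A _ _ ∘ₗ LinearMap.inr A U X)
            ⟨fun x y hxy => congrArg (fun p => p.2.2) hxy, fun p => ⟨p.2.2, rfl⟩⟩⟩⟩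
    · obtain ⟨e, he, he0, he1⟩ : ∃ e : X →ₗ[A] X, e ∘ₗ e = e ∧ e ≠ 0 ∧ e ≠ LinearMap.id := by
        by_contra! h
        exact hind ⟨hs, fun e he => or_iff_not_imp_left.2 (h e he)⟩
      have hee : ∀ x, e (e x) = e x := fun x => LinearMap.congr_fun he x
      have hlen := len_ker_add e
      have h1 : len A (LinearMap.range e) ≠ 0 := fun h => he0 (by
        have := len_eq_zero.1 h
        ext x
        exact congrArg Subtype.val (Subsingleton.elim (⟨e x, x, rfl⟩ : LinearMap.range e) 0))
      have h2 : len A (LinearMap.ker e) ≠ 0 := fun h => he1 (by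
        have := len_eq_zero.1 h
        ext x
        have := congrArg Subtype.val (Subsingleton.elim
          (⟨x - e x, by simp [hee]⟩ : LinearMap.ker e) 0)
        exact (sub_eq_zero.1 this).symm)
      obtain ⟨d⟩ := ih (LinearMap.ker e) (by omega)
      obtain ⟨d'⟩ := ih (LinearMap.range e) (by omega)
      obtain ⟨dd⟩ := d.prod d'
      refine dd.of_equiv (LinearEquiv.ofBijective
        ((LinearMap.ker e).subtype.coprod (LinearMap.range e).subtype) ⟨?_, ?_⟩).symm
      · refine (injective_iff_map_eq_zero _).2 ?_
        rintro ⟨⟨x, hx⟩, ⟨_, y, rfl⟩⟩ hxy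
        change x + e y = 0 at hxy
        have h3 : e y = 0 := by
          have := congrArg e hxy
          rwa [map_add, (hx : e x = 0), hee, zero_add, map_zero] at this
        rw [h3, add_zero] at hxy
        ext <;> simp [h3, hxy]
      · intro x
        exact ⟨(⟨x - e x, by simp [hee]⟩, ⟨e x, x, rfl⟩), sub_add_cancel _ _⟩

namespace Decomp

variable {P R Q O : Set (ModuleCat.{0} A)} (d : Decomp P R Q O X)

/-- The projection onto the first summand. -/
def pP : X →ₗ[A] d.XP := LinearMap.fst A _ _ ∘ₗ LinearMap.fst A _ _ ∘ₗ d.e.toLinearMap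

/-- The projection onto the second summand. -/
def pR : X →ₗ[A] d.XR := LinearMap.snd A _ _ ∘ₗ LinearMap.fst A _ _ ∘ₗ d.e.toLinearMap

/-- The projection onto the third summand. -/
def pQ : X →ₗ[A] d.XQ := LinearMap.fst A _ _ ∘ₗ LinearMap.snd A _ _ ∘ₗ d.e.toLinearMap

/-- The projection onto the fourth summand. -/
def pO : X →ₗ[A] d.XO := LinearMap.snd A _ _ ∘ₗ LinearMap.snd A _ _ ∘ₗ d.e.toLinearMap

/-- The inclusion of the first summand. -/
def iP : d.XP →ₗ[A] X := d.e.symm.toLinearMap ∘ₗ LinearMap.inl A _ _ ∘ₗ LinearMap.inl A _ _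

/-- The inclusion of the second summand. -/
def iR : d.XR →ₗ[A] X := d.e.symm.toLinearMap ∘ₗ LinearMap.inl A _ _ ∘ₗ LinearMap.inr A _ _

/-- The inclusion of the third summand. -/
def iQ : d.XQ →ₗ[A] X := d.e.symm.toLinearMap ∘ₗ LinearMap.inr A _ _ ∘ₗ LinearMap.inl A _ _

/-- The inclusion of the fourth summand. -/
def iO : d.XO →ₗ[A] X := d.e.symm.toLinearMap ∘ₗ LinearMap.inr A _ _ ∘ₗ LinearMap.inr A _ _

theorem pR_iR (x : d.XR) : d.pR (d.iR x) = x := by simp [pR, iR]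

theorem pQ_iQ (x : d.XQ) : d.pQ (d.iQ x) = x := by simp [pQ, iQ]

theorem pO_iO (x : d.XO) : d.pO (d.iO x) = x := by simp [pO, iO]

theorem sum_eq (x : X) : d.iP (d.pP x) + d.iR (d.pR x) + d.iQ (d.pQ x) + d.iO (d.pO x) = x := by
  apply d.e.injective
  ext <;> simp [pP, pR, pQ, pO, iP, iR, iQ, iO]

theorem pP_eq_zero_of_surjective (h : ∀ f : Y →ₗ[A] d.XP, f = 0) (f : Y →ₗ[A] X)
    (hf : Function.Surjective f) (x : X) : d.pP x = 0 := by
  obtain ⟨y, rfl⟩ := hf x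
  exact LinearMap.congr_fun (h (d.pP ∘ₗ f)) y

theorem pO_eq_zero_of_surjective (h : ∀ f : Y →ₗ[A] d.XO, f = 0) (f : Y →ₗ[A] X)
    (hf : Function.Surjective f) (x : X) : d.pO x = 0 := by
  obtain ⟨y, rfl⟩ := hf x
  exact LinearMap.congr_fun (h (d.pO ∘ₗ f)) y

theorem pQ_eq_zero_of_injective (h : ∀ f : d.XQ →ₗ[A] Y, f = 0) (f : X →ₗ[A] Y)
    (hf : Function.Injective f) (x : X) : d.pQ x = 0 := by
  have := (injective_iff_map_eq_zero f).1 hf _ (LinearMap.congr_fun (h (f ∘ₗ d.iQ)) (d.pQ x))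
  rw [← d.pQ_iQ (d.pQ x), this, map_zero]

theorem pO_eq_zero_of_injective (h : ∀ f : d.XO →ₗ[A] Y, f = 0) (f : X →ₗ[A] Y)
    (hf : Function.Injective f) (x : X) : d.pO x = 0 := by
  have := (injective_iff_map_eq_zero f).1 hf _ (LinearMap.congr_fun (h (f ∘ₗ d.iO)) (d.pO x))
  rw [← d.pO_iO (d.pO x), this, map_zero]

theorem has_addOfSet (hP : ∀ x, d.pP x = 0) (hQ : ∀ x, d.pQ x = 0) (hO : ∀ x, d.pO x = 0) :
    Has (AddOfSet A R) X :=
  AddOfSet.equiv d.memR (LinearEquiv.ofBijective d.iR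
    ⟨fun x y hxy => by rw [← d.pR_iR x, hxy, pR_iR], fun x => ⟨d.pR x, by
      simpa [hP, hQ, hO] using d.sum_eq x⟩⟩)

end Decomp

theorem has_addOfSet_of_surjective_of_injective [IsNoetherianRing A] [IsArtinianRing A]
    {P R Q O : Set (ModuleCat.{0} A)} (hs : Separation P R Q O) [Module.Finite A X]
    (hY : Has (AddOfSet A R) Y) (f : Y →ₗ[A] X) (hf : Function.Surjective f)
    (hZ : Has (AddOfSet A R) Z) (g : X →ₗ[A] Z) (hg : Function.Injective g) :
    Has (AddOfSet A R) X := by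
  obtain ⟨d⟩ := exists_decomp hs.cover (len A X) X le_rfl
  exact d.has_addOfSet
    (d.pP_eq_zero_of_surjective (AddOfSet.hom_eq_zero hs.hom_RP hY d.memP) f hf)
    (d.pQ_eq_zero_of_injective (AddOfSet.hom_eq_zero hs.hom_QR d.memQ hZ) g hg)
    (d.pO_eq_zero_of_surjective (AddOfSet.hom_eq_zero hs.hom_RO hY d.memO) f hf)

end Decomposition

section CyclicQuiver

variable {k : Type} [Field k] {r : ℕ}

section Shift

variable {V V' : ZMod r → Type} [∀ i, AddCommGroup (V i)] [∀ i, Module k (V i)]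
  [∀ i, AddCommGroup (V' i)] [∀ i, Module k (V' i)]
  (g : ∀ i, V i →ₗ[k] V (i + 1)) (g' : ∀ i, V' i →ₗ[k] V' (i + 1))

theorem forall_zmod_of_succ {p : ZMod r → Prop} (h : ∀ i, p (i + 1)) (i : ZMod r) : p i :=
  sub_add_cancel i 1 ▸ h (i - 1)

@[simp]
theorem cshift_succ (w : ∀ i, V i) (i : ZMod r) : cshift k V g w (i + 1) = g i (w i) := by
  have : ∀ j (_ : j = i) (h : j + 1 = i + 1), (h ▸ g j (w j) : V (i + 1)) = g i (w i) := by
    rintro _ rfl _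
    rfl
  exact this _ (add_sub_cancel_right i 1) _

theorem semiconj_cshift (φ : ∀ i, V i →ₗ[k] V' i)
    (comm : ∀ i v, φ (i + 1) (g i v) = g' i (φ i v)) :
    Function.Semiconj (fun (w : ∀ i, V i) i => φ i (w i)) (cshift k V g) (cshift k V' g') :=
  fun w => funext <| forall_zmod_of_succ fun i => by simp [comm]

theorem iterate_cshift_const {W : Type} [AddCommGroup W] [Module k W] (T : W →ₗ[k] W) (u : W)
    (m : ℕ) : (cshift k (fun _ : ZMod r => W) fun _ => T)^[m] (fun _ => u) =
      fun _ => (T ^ m) u := by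
  induction m with
  | zero => rfl
  | succ m ih =>
    rw [Function.iterate_succ_apply', ih]
    refine funext <| forall_zmod_of_succ fun i => ?_
    rw [cshift_succ, pow_succ', Module.End.mul_apply]

theorem iterate_cshift_add {W : Type} [AddCommGroup W] [Module k W] (T : W →ₗ[k] W)
    (w : ZMod r → W) (m : ℕ) (i : ZMod r) :
    (cshift k (fun _ : ZMod r => W) fun _ => T)^[m] w (i + m) = (T ^ m) (w i) := by
  induction m with
  | zero => simp
  | succ m ih =>
    rw [Function.iterate_succ_apply', Nat.cast_succ, ← add_assoc, cshift_succ, ih, pow_succ',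
      Module.End.mul_apply]

end Shift

namespace CycHom

variable {X Y Z : CycRep k r}

theorem ext_apply {f g : CycHom k X Y} (h : ∀ i v, f.φ i v = g.φ i v) : f = g := by
  obtain ⟨φ, _⟩ := f
  obtain ⟨ψ, _⟩ := g
  have : φ = ψ := funext fun i => LinearMap.ext (h i)
  subst this
  rfl

/-- The identity morphism. -/
def one (X : CycRep k r) : CycHom k X X := ⟨fun _ => LinearMap.id, fun _ _ => rfl⟩

instance : Zero (CycHom k X Y) := ⟨⟨fun _ => 0, fun i v => by simp⟩⟩

@[simp]
theorem zero_apply (i : ZMod r) (v : X.V i) : (0 : CycHom k X Y).φ i v = 0 := rfl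

@[simp]
theorem comp_apply (g : CycHom k Y Z) (f : CycHom k X Y) (i : ZMod r) (v : X.V i) :
    (CycHom.comp k g f).φ i v = g.φ i (f.φ i v) := rfl

end CycHom

namespace CycRep

theorem nilp_of_injective (Y : CycRep k r) {V : ZMod r → Type} [∀ i, AddCommGroup (V i)]
    [∀ i, Module k (V i)] (g : ∀ i, V i →ₗ[k] V (i + 1)) (φ : ∀ i, V i →ₗ[k] Y.V i)
    (comm : ∀ i v, φ (i + 1) (g i v) = Y.g i (φ i v)) (hφ : ∀ i, Function.Injective (φ i)) :
    ∃ n : ℕ, ∀ w : (∀ i, V i), (cshift k V g)^[n] w = fun _ => 0 := by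
  obtain ⟨n, hn⟩ := Y.nilp
  refine ⟨n, fun w => funext fun i => hφ i ?_⟩
  have := congrFun (((semiconj_cshift g Y.g φ comm).iterate_right n).eq w) i
  rw [hn] at this
  exact this.trans (map_zero _).symm

theorem nilp_of_surjective (Y : CycRep k r) {V : ZMod r → Type} [∀ i, AddCommGroup (V i)]
    [∀ i, Module k (V i)] (g : ∀ i, V i →ₗ[k] V (i + 1)) (φ : ∀ i, Y.V i →ₗ[k] V i)
    (comm : ∀ i v, φ (i + 1) (Y.g i v) = g i (φ i v)) (hφ : ∀ i, Function.Surjective (φ i)) :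
    ∃ n : ℕ, ∀ w : (∀ i, V i), (cshift k V g)^[n] w = fun _ => 0 := by
  obtain ⟨n, hn⟩ := Y.nilp
  refine ⟨n, fun w => funext fun i => ?_⟩
  choose u hu using fun i => hφ i (w i)
  have := congrFun (((semiconj_cshift Y.g g φ comm).iterate_right n).eq u) i
  rw [hn, funext hu] at this
  exact this.symm.trans (map_zero _)

/-- The subrepresentation given by a family of subspaces. -/
def sub (Y : CycRep k r) (U : ∀ i, Submodule k (Y.V i)) (hU : ∀ i, ∀ v ∈ U i, Y.g i v ∈ U (i + 1)) :
    CycRep k r where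
  V i := U i
  g i := (Y.g i).restrict (hU i)
  fin i := by
    have := Y.fin i
    infer_instance
  nilp := Y.nilp_of_injective _ (fun i => (U i).subtype) (fun _ _ => rfl)
    fun i => (U i).injective_subtype

/-- The quotient representation given by a family of subspaces. -/
def quot (Y : CycRep k r) (U : ∀ i, Submodule k (Y.V i))
    (hU : ∀ i, ∀ v ∈ U i, Y.g i v ∈ U (i + 1)) : CycRep k r where
  V i := Y.V i ⧸ U i
  g i := (U i).mapQ (U (i + 1)) (Y.g i) (hU i)
  fin i := by
    have := Y.fin i
    infer_instance
  nilp := Y.nilp_of_surjective _ (fun i => (U i).mkQ) (fun _ _ => rfl) fun i => (U i).mkQ_surjective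

variable (Y : CycRep k r) (U : ∀ i, Submodule k (Y.V i))
  (hU : ∀ i, ∀ v ∈ U i, Y.g i v ∈ U (i + 1))

/-- The inclusion of a subrepresentation. -/
def incl : CycHom k (Y.sub U hU) Y := ⟨fun i => (U i).subtype, fun _ _ => rfl⟩

/-- The projection onto a quotient representation. -/
def proj : CycHom k Y (Y.quot U hU) := ⟨fun i => (U i).mkQ, fun _ _ => rfl⟩

/-- The one-dimensional representation supported at the vertex `i`. -/
def simple (k : Type) [Field k] {r : ℕ} (i : ZMod r) : CycRep k r where
  V l := open Classical in ↥(if l = i then ⊤ else ⊥ : Submodule k k)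
  g _ := 0
  fin _ := inferInstance
  nilp := ⟨1, fun w => funext <| forall_zmod_of_succ fun l => by simp⟩

/-- The generator of the one-dimensional representation supported at `i`. -/
def simpleGen (k : Type) [Field k] {r : ℕ} (i : ZMod r) : (simple k i).V i := ⟨1, by simp⟩

theorem simple_eq_zero {i l : ZMod r} (h : l ≠ i) (x : (simple k i).V l) : x = 0 := by
  obtain ⟨x, hx⟩ := x
  rw [if_neg h] at hx
  exact Subtype.ext hx

theorem simple_eq_smul {i : ZMod r} (x : (simple k i).V i) : x = x.1 • simpleGen k i :=
  Subtype.ext (mul_one x.1).symm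

theorem simpleGen_ne_zero (i : ZMod r) : simpleGen k i ≠ 0 := fun h =>
  one_ne_zero (congrArg Subtype.val h)

open Classical in
/-- The morphism from the one-dimensional representation at `i` given by a vector killed by
the outgoing arrow. -/
def ofSimple (Y : CycRep k r) {i : ZMod r} (v : Y.V i) (hv : Y.g i v = 0) :
    CycHom k (simple k i) Y where
  φ l := (LinearMap.toSpanSingleton k _ (Pi.single i v l)) ∘ₗ Submodule.subtype _
  comm l x := by
    have : Y.g l (Pi.single i v l) = 0 := by
      by_cases h : l = i
      · subst h
        simpa using hv
      · simp [h]
    change (0 : k) • (_ : Y.V (l + 1)) = Y.g l (x.1 • _)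
    rw [map_smul, this, smul_zero, zero_smul]

theorem ofSimple_simpleGen (Y : CycRep k r) {i : ZMod r} (v : Y.V i) (hv : Y.g i v = 0) :
    (Y.ofSimple v hv).φ i (simpleGen k i) = v := by
  change (1 : k) • Pi.single i v i = v
  simp

open Classical in
/-- The morphism to the one-dimensional representation at `i` given by a functional vanishing on
the image of the incoming arrow. -/
def toSimple (Y : CycRep k r) {i : ZMod r} (ψ : Y.V i →ₗ[k] k)
    (hψ : ∀ w, ψ (cshift k Y.V Y.g w i) = 0) : CycHom k Y (simple k i) where
  φ l := LinearMap.codRestrict (if l = i then ⊤ else ⊥ : Submodule k k)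
    (Pi.single (M := fun l => Y.V l →ₗ[k] k) i ψ l) fun v => by
    by_cases h : l = i
    · rw [if_pos h]
      exact Submodule.mem_top
    · rw [if_neg h, Pi.single_eq_of_ne h]
      exact Submodule.zero_mem _
  comm l v := by
    refine Subtype.ext ?_
    change Pi.single (M := fun l => Y.V l →ₗ[k] k) i ψ (l + 1) (Y.g l v) = 0
    by_cases h : l + 1 = i
    · subst h
      simpa using hψ (Pi.single l v)
    · simp [h]

theorem toSimple_apply (Y : CycRep k r) {i : ZMod r} (ψ : Y.V i →ₗ[k] k)
    (hψ : ∀ w, ψ (cshift k Y.V Y.g w i) = 0) (v : Y.V i) :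
    ((Y.toSimple ψ hψ).φ i v).1 = ψ v := by
  change Pi.single (M := fun l => Y.V l →ₗ[k] k) i ψ i v = _
  simp

theorem hom_simple_ext {i : ZMod r} {f g : CycHom k (simple k i) Y}
    (h : f.φ i (simpleGen k i) = g.φ i (simpleGen k i)) : f = g := by
  refine CycHom.ext_apply fun l x => ?_
  by_cases hl : l = i
  · subst hl
    rw [simple_eq_smul x, map_smul, map_smul, h]
  · rw [simple_eq_zero hl x, map_zero, map_zero]

theorem g_hom_simpleGen {i : ZMod r} (f : CycHom k (simple k i) Y) :
    Y.g i (f.φ i (simpleGen k i)) = 0 := by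
  rw [← f.comm]
  exact map_zero _

theorem hom_to_simple_ext {i : ZMod r} {f g : CycHom k Y (simple k i)}
    (h : ∀ v, f.φ i v = g.φ i v) : f = g := by
  refine CycHom.ext_apply fun l x => ?_
  by_cases hl : l = i
  · subst hl
    exact h x
  · rw [simple_eq_zero hl (f.φ l x), simple_eq_zero hl (g.φ l x)]

theorem hom_simple_injective {i : ZMod r} {f : CycHom k (simple k i) Y} (hf : f ≠ 0) (l : ZMod r) :
    Function.Injective (f.φ l) := by
  refine (injective_iff_map_eq_zero _).2 fun x hx => ?_
  by_cases hl : l = i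
  · subst hl
    rw [simple_eq_smul x, map_smul] at hx
    rw [simple_eq_smul x]
    rcases smul_eq_zero.1 hx with h | h
    · rw [h, zero_smul]
    · exact absurd (hom_simple_ext Y (f := f) (g := 0) h) hf
  · exact simple_eq_zero hl x

theorem hom_to_simple_surjective {i : ZMod r} {f : CycHom k Y (simple k i)} (hf : f ≠ 0)
    (l : ZMod r) : Function.Surjective (f.φ l) := by
  intro x
  by_cases hl : l = i
  · subst hl
    obtain ⟨v, hv⟩ : ∃ v, f.φ l v ≠ 0 := by
      by_contra! h
      exact hf (hom_to_simple_ext Y h)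
    have hv' : (f.φ l v).1 ≠ 0 := fun h => hv (Subtype.ext h)
    refine ⟨(x.1 * (f.φ l v).1⁻¹) • v, Subtype.ext ?_⟩
    rw [map_smul]
    change x.1 * (f.φ l v).1⁻¹ * (f.φ l v).1 = x.1
    rw [mul_assoc, inv_mul_cancel₀ hv', mul_one]
  · exact ⟨0, by rw [simple_eq_zero hl x, map_zero]⟩

theorem exists_hom_simple {Y : CycRep k r} (hY : ¬ ∀ i, Subsingleton (Y.V i)) :
    ∃ (i : ZMod r) (f : CycHom k (simple k i) Y), f ≠ 0 := by
  by_contra! h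
  have h1 : ∀ i, Function.Injective (Y.g i) := fun i =>
    (injective_iff_map_eq_zero _).2 fun v hv => by
      have := ofSimple_simpleGen Y v hv
      rwa [h i (Y.ofSimple v hv), CycHom.zero_apply, eq_comm] at this
  have h2 : Function.Injective (cshift k Y.V Y.g) := fun w w' hw => funext fun i => h1 i (by
    simpa using congrFun hw (i + 1))
  obtain ⟨n, hn⟩ := Y.nilp
  classical
  refine hY fun i => ⟨fun v v' => ?_⟩
  have := h2.iterate n ((hn (Pi.single i v)).trans (hn (Pi.single i v')).symm)
  simpa using congrFun this i

theorem exists_hom_to_simple {Y : CycRep k r} (hY : ¬ ∀ i, Subsingleton (Y.V i)) :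
    ∃ (i : ZMod r) (f : CycHom k Y (simple k i)), f ≠ 0 := by
  by_contra! h
  have h1 : ∀ i, Function.Surjective (Y.g i) := fun i => by
    rw [← LinearMap.range_eq_top]
    by_contra hne
    obtain ⟨ψ, hψ, hle⟩ := Submodule.exists_le_ker_of_lt_top _ (lt_top_iff_ne_top.2 hne)
    refine hψ (LinearMap.ext fun v => ?_)
    have hψ' : ∀ w, ψ (cshift k Y.V Y.g w (i + 1)) = 0 := fun w => by
      rw [cshift_succ]
      exact hle ⟨_, rfl⟩
    have := toSimple_apply Y ψ hψ' v
    rwa [h _ (Y.toSimple ψ hψ'), CycHom.zero_apply, eq_comm] at this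
  have h2 : Function.Surjective (cshift k Y.V Y.g) := fun w => by
    choose u hu using fun i => h1 i (w (i + 1))
    exact ⟨u, funext <| forall_zmod_of_succ fun i => by simp [hu]⟩
  obtain ⟨n, hn⟩ := Y.nilp
  classical
  refine hY fun i => subsingleton_of_forall_eq 0 fun v => ?_
  obtain ⟨w, hw⟩ := h2.iterate n (Pi.single i v)
  rw [hn] at hw
  simpa using (congrFun hw i).symm

/-- A short exact sequence of representations of the cyclic quiver. -/
structure IsExact {X Y Z : CycRep k r} (α : CycHom k X Y) (β : CycHom k Y Z) : Prop where
  inj : ∀ i, Function.Injective (α.φ i)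
  surj : ∀ i, Function.Surjective (β.φ i)
  exact : ∀ i, LinearMap.range (α.φ i) = LinearMap.ker (β.φ i)

theorem exists_isExact_of_injective {X : CycRep k r} (α : CycHom k X Y)
    (h : ∀ i, Function.Injective (α.φ i)) : ∃ (Z : CycRep k r) (β : CycHom k Y Z), IsExact α β := by
  refine ⟨_, Y.proj (fun i => LinearMap.range (α.φ i)) ?_, h, fun i => Submodule.mkQ_surjective _,
    fun i => (Submodule.ker_mkQ _).symm⟩
  rintro i _ ⟨v, rfl⟩
  exact ⟨_, α.comm i v⟩

theorem exists_isExact_of_surjective {Z : CycRep k r} (β : CycHom k Y Z)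
    (h : ∀ i, Function.Surjective (β.φ i)) :
    ∃ (X : CycRep k r) (α : CycHom k X Y), IsExact α β := by
  refine ⟨_, Y.incl (fun i => LinearMap.ker (β.φ i)) ?_, fun i => Submodule.injective_subtype _, h,
    fun i => Submodule.range_subtype _⟩
  intro i v hv
  rw [LinearMap.mem_ker] at hv ⊢
  rw [β.comm, hv, map_zero]

variable {Y}
variable {X Z W : CycRep k r} {α : CycHom k X Y} {β : CycHom k Y Z}

theorem IsExact.comp_eq_zero (h : IsExact α β) : CycHom.comp k β α = 0 :=
  CycHom.ext_apply fun i v => (h.exact i).le ⟨v, rfl⟩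

theorem IsExact.exists_lift (h : IsExact α β) (γ : CycHom k W Y) (hγ : CycHom.comp k β γ = 0) :
    ∃ δ : CycHom k W X, γ = CycHom.comp k α δ := by
  have h1 : ∀ i v, γ.φ i v ∈ LinearMap.range (α.φ i) := fun i v =>
    (h.exact i).ge (congrArg (fun f : CycHom k W Z => f.φ i v) hγ)
  choose δ hδ using fun i => exists_factor_of_injective (α.φ i) (h.inj i) (γ.φ i) (h1 i)
  refine ⟨⟨δ, fun i v => h.inj _ ?_⟩, CycHom.ext_apply fun i v => (hδ i v).symm⟩
  rw [hδ, γ.comm, α.comm, hδ]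

theorem IsExact.exists_desc (h : IsExact α β) (γ : CycHom k Y W) (hγ : CycHom.comp k γ α = 0) :
    ∃ δ : CycHom k Z W, γ = CycHom.comp k δ β := by
  have h1 : ∀ i v, β.φ i v = 0 → γ.φ i v = 0 := fun i v hv => by
    obtain ⟨x, rfl⟩ := (h.exact i).ge hv
    exact congrArg (fun f : CycHom k X W => f.φ i x) hγ
  choose δ hδ using fun i => exists_factor_of_surjective (β.φ i) (h.surj i) (γ.φ i) (h1 i)
  refine ⟨⟨δ, fun i v => ?_⟩, CycHom.ext_apply fun i v => (hδ i v).symm⟩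
  obtain ⟨y, rfl⟩ := h.surj i v
  rw [hδ, ← β.comm, hδ, γ.comm]

end CycRep

end CyclicQuiver

section CyclicQuiverSimple

variable {k : Type} [Field k] {r : ℕ}

theorem exists_nilpotent_endomorphism (k : Type) [Field k] (n : ℕ) :
    ∃ (W : Type) (_ : AddCommGroup W) (_ : Module k W) (_ : Module.Finite k W) (T : W →ₗ[k] W),
      T ^ (n + 1) = 0 ∧ T ^ n ≠ 0 := by
  have hm : (Polynomial.X ^ (n + 1) : Polynomial k).Monic := Polynomial.monic_X_pow _
  refine ⟨AdjoinRoot (Polynomial.X ^ (n + 1) : Polynomial k), inferInstance, inferInstance,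
    hm.finite_adjoinRoot, LinearMap.mulLeft k (AdjoinRoot.mk _ Polynomial.X), ?_, ?_⟩
  · rw [LinearMap.pow_mulLeft, ← map_pow, AdjoinRoot.mk_self, LinearMap.mulLeft_zero_eq_zero]
  · rw [LinearMap.pow_mulLeft, ← map_pow, Ne, LinearMap.mulLeft_eq_zero_iff,
      AdjoinRoot.mk_eq_zero, Polynomial.X_pow_dvd_iff]
    intro h
    have := h n (Nat.lt_succ_self n)
    simp at this

namespace CycRep

/-- The simultaneous action of the arrows as a linear map. -/
def shiftLin (Y : CycRep k r) : (∀ i, Y.V i) →ₗ[k] ∀ i, Y.V i where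
  toFun := cshift k Y.V Y.g
  map_add' w w' := funext <| forall_zmod_of_succ fun i => by simp
  map_smul' c w := funext <| forall_zmod_of_succ fun i => by simp

theorem exists_quot_of_simple (h1 : (1 : ZMod r) ≠ 0) (Y : CycRep k r) (i : ZMod r) :
    ∃ (C : CycRep k r) (β : CycHom k Y C), (∀ f : CycHom k (simple k i) C, f = 0) ∧
      (β = 0 → ∀ f : CycHom k Y (simple k i), f ≠ 0 →
        ∃ s : CycHom k (simple k i) Y, CycHom.comp k f s = CycHom.one _) := by
  classical
  let U : ∀ l, Submodule k (Y.V l) := fun l => if l = i then LinearMap.ker (Y.g l) else ⊥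
  have hUi : U i = LinearMap.ker (Y.g i) := if_pos rfl
  have hUl : ∀ l, l ≠ i → U l = ⊥ := fun l hl => if_neg hl
  have hU0 : ∀ l, ∀ v ∈ U l, Y.g l v = 0 := fun l v hv => by
    by_cases h : l = i
    · subst h
      rwa [hUi] at hv
    · rw [hUl l h, Submodule.mem_bot] at hv
      rw [hv, map_zero]
  have hU : ∀ l, ∀ v ∈ U l, Y.g l v ∈ U (l + 1) := fun l v hv => by
    rw [hU0 l v hv]
    exact Submodule.zero_mem _
  refine ⟨Y.quot U hU, Y.proj U hU, fun f => hom_simple_ext _ ?_, fun hβ f hf => ?_⟩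
  · have hg := g_hom_simpleGen _ f
    obtain ⟨v, hv⟩ := (U i).mkQ_surjective (f.φ i (simpleGen k i))
    rw [CycHom.zero_apply, ← hv]
    rw [← hv] at hg
    have h2 : Y.g i v ∈ U (i + 1) := (Submodule.Quotient.mk_eq_zero (U (i + 1))).1 hg
    rw [hUl (i + 1) (by simpa using h1), Submodule.mem_bot] at h2
    refine (Submodule.Quotient.mk_eq_zero (U i)).2 ?_
    rw [hUi]
    exact h2
  · obtain ⟨v, hv⟩ : ∃ v, f.φ i v ≠ 0 := by
      by_contra! h
      exact hf (hom_to_simple_ext Y h)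
    have hv' : (f.φ i v).1 ≠ 0 := fun h => hv (Subtype.ext h)
    have hgv : Y.g i v = 0 := hU0 i v ((Submodule.Quotient.mk_eq_zero (U i)).1
      (congrArg (fun γ : CycHom k Y (Y.quot U hU) => γ.φ i v) hβ))
    refine ⟨Y.ofSimple ((f.φ i v).1⁻¹ • v) (by rw [map_smul, hgv, smul_zero]),
      hom_simple_ext _ ?_⟩
    rw [CycHom.comp_apply, ofSimple_simpleGen, map_smul]
    exact Subtype.ext (inv_mul_cancel₀ hv')

theorem exists_sub_to_simple (h1 : (1 : ZMod r) ≠ 0) (Y : CycRep k r) (i : ZMod r) :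
    ∃ (B : CycRep k r) (α : CycHom k B Y), (∀ f : CycHom k B (simple k i), f = 0) ∧
      (α = 0 → ∀ f : CycHom k (simple k i) Y, f ≠ 0 →
        ∃ t : CycHom k Y (simple k i), CycHom.comp k t f = CycHom.one _) := by
  classical
  let U : ∀ l, Submodule k (Y.V l) := fun l =>
    if l = i then (LinearMap.range Y.shiftLin).map (LinearMap.proj l) else ⊤
  have hUi : U i = (LinearMap.range Y.shiftLin).map (LinearMap.proj i) := if_pos rfl
  have hUl : ∀ l, l ≠ i → U l = ⊤ := fun l hl => if_neg hl
  have hU : ∀ l, ∀ v ∈ U l, Y.g l v ∈ U (l + 1) := fun l v _ => by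
    by_cases h : l + 1 = i
    · subst h
      rw [hUi]
      refine ⟨_, ⟨Pi.single l v, rfl⟩, ?_⟩
      change cshift k Y.V Y.g _ (l + 1) = _
      simp
    · rw [hUl _ h]
      exact Submodule.mem_top
  refine ⟨Y.sub U hU, Y.incl U hU, fun f => hom_to_simple_ext _ ?_, fun hα f hf => ?_⟩
  · rintro ⟨v, hv⟩
    obtain ⟨j, rfl⟩ : ∃ j, i = j + 1 := ⟨i - 1, (sub_add_cancel i 1).symm⟩
    have hv' := hv
    rw [hUi] at hv'
    obtain ⟨_, ⟨w, rfl⟩, hw⟩ := hv'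
    have hw' : Y.g j (w j) = v := by
      rw [← hw]
      exact (cshift_succ Y.g w j).symm
    have hj : w j ∈ U j := by
      rw [hUl j (by simpa using h1)]
      exact Submodule.mem_top
    have : (⟨v, hv⟩ : U (j + 1)) = (Y.sub U hU).g j ⟨w j, hj⟩ := Subtype.ext hw'.symm
    exact (congrArg (f.φ (j + 1)) this).trans (f.comm j _)
  · have hne : f.φ i (simpleGen k i) ≠ 0 := fun h => hf (hom_simple_ext Y h)
    obtain ⟨ψ, hψ⟩ : ∃ ψ : Y.V i →ₗ[k] k, ψ (f.φ i (simpleGen k i)) ≠ 0 := by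
      by_contra! h
      exact hne ((Module.forall_dual_apply_eq_zero_iff k _).1 h)
    have h0 : ∀ w, cshift k Y.V Y.g w i = 0 := fun w => by
      have hw : cshift k Y.V Y.g w i ∈ U i := by
        rw [hUi]
        exact ⟨_, ⟨w, rfl⟩, rfl⟩
      exact congrArg (fun γ : CycHom k (Y.sub U hU) Y => γ.φ i ⟨_, hw⟩) hα
    have hψ' : ∀ w, ((ψ (f.φ i (simpleGen k i)))⁻¹ • ψ) (cshift k Y.V Y.g w i) = 0 := fun w => by
      rw [h0, map_zero]
    refine ⟨Y.toSimple _ hψ', hom_simple_ext _ (Subtype.ext ?_)⟩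
    rw [CycHom.comp_apply, toSimple_apply]
    exact inv_mul_cancel₀ hψ

theorem exists_rep_of_nilpotency (n : ℕ) (i : ZMod r) :
    ∃ (Z : CycRep k r) (ψ : CycHom k Z (simple k i)), ψ ≠ 0 ∧ ∀ Y : CycRep k r,
      (∀ w, (cshift k Y.V Y.g)^[n] w = fun _ => 0) → ∀ φ : CycHom k Y Z,
        CycHom.comp k ψ φ = 0 := by
  obtain ⟨W, _, _, hfin, T, hT1, hT⟩ := exists_nilpotent_endomorphism k n
  let Z : CycRep k r := ⟨fun _ => W, fun _ => T, fun _ => hfin, n + 1, fun w => funext fun l => by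
    have := iterate_cshift_add T w (n + 1) (l - (n + 1 : ℕ))
    rwa [sub_add_cancel, hT1] at this⟩
  have hne : LinearMap.ker (T ^ n) ⊔ LinearMap.range T ≠ ⊤ := fun h =>
      hT <| LinearMap.ext fun w => by
    obtain ⟨x, hx, _, ⟨y, rfl⟩, rfl⟩ := Submodule.mem_sup.1 (h.ge (Submodule.mem_top (x := w)))
    rw [map_add, LinearMap.mem_ker.1 hx, ← Module.End.mul_apply, ← pow_succ, hT1]
    simp
  obtain ⟨ψ, hψ, hle⟩ := Submodule.exists_le_ker_of_lt_top _ (lt_top_iff_ne_top.2 hne)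
  have hψ' : ∀ w, ψ (cshift k Z.V Z.g w i) = 0 := by
    obtain ⟨j, rfl⟩ : ∃ j, i = j + 1 := ⟨i - 1, (sub_add_cancel i 1).symm⟩
    intro w
    rw [cshift_succ]
    exact hle (Submodule.mem_sup_right ⟨_, rfl⟩)
  refine ⟨Z, Z.toSimple (i := i) ψ hψ', fun h => hψ (LinearMap.ext fun w => ?_),
    fun Y hY φ => hom_to_simple_ext _ fun v => Subtype.ext ?_⟩
  · have := toSimple_apply Z (i := i) ψ hψ' w
    rwa [h, CycHom.zero_apply, eq_comm] at this
  · rw [CycHom.comp_apply, toSimple_apply]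
    refine hle (Submodule.mem_sup_left ?_)
    classical
    have h1 := congrFun (((semiconj_cshift Y.g Z.g φ.φ φ.comm).iterate_right n).eq
      (Pi.single i v)) (i + n)
    rw [hY] at h1
    have h2 := iterate_cshift_add T (fun l => φ.φ l ((Pi.single i v : ∀ l, Y.V l) l)) n i
    rw [LinearMap.mem_ker]
    have h3 := h2.symm.trans (h1.symm.trans (map_zero _))
    rwa [Pi.single_eq_same] at h3

theorem exists_rep_of_nilpotency_dual (n : ℕ) (i : ZMod r) :
    ∃ (Z : CycRep k r) (s : CycHom k (simple k i) Z), s ≠ 0 ∧ ∀ Y : CycRep k r,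
      (∀ w, (cshift k Y.V Y.g)^[n] w = fun _ => 0) → ∀ φ : CycHom k Z Y,
        CycHom.comp k φ s = 0 := by
  obtain ⟨W, _, _, hfin, T, hT1, hT⟩ := exists_nilpotent_endomorphism k n
  let Z : CycRep k r := ⟨fun _ => W, fun _ => T, fun _ => hfin, n + 1, fun w => funext fun l => by
    have := iterate_cshift_add T w (n + 1) (l - (n + 1 : ℕ))
    rwa [sub_add_cancel, hT1] at this⟩
  obtain ⟨u, hu⟩ : ∃ u, (T ^ n) u ≠ 0 := by
    by_contra! h
    exact hT (LinearMap.ext h)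
  have hg : Z.g i ((T ^ n) u) = 0 := by
    change T ((T ^ n) u) = 0
    rw [← Module.End.mul_apply, ← pow_succ', hT1]
    rfl
  refine ⟨Z, Z.ofSimple (i := i) ((T ^ n) u) hg, fun h => hu ?_, fun Y hY φ => hom_simple_ext _ ?_⟩
  · have := ofSimple_simpleGen Z (i := i) ((T ^ n) u) hg
    rwa [h, CycHom.zero_apply, eq_comm] at this
  · rw [CycHom.comp_apply, ofSimple_simpleGen]
    have h1 := congrFun (((semiconj_cshift Z.g Y.g φ.φ φ.comm).iterate_right n).eq
      (fun _ => u)) i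
    rw [hY] at h1
    have h2 := congrFun (iterate_cshift_const (r := r) T u n) i
    exact (congrArg (φ.φ i) h2).symm.trans h1

end CycRep

end CyclicQuiverSimple

section Tube

variable {k A : Type} [Field k] [Ring A] {r : ℕ}

/-- An equivalence from the category of nilpotent representations of a cyclic quiver to the
additive closure of a class of modules. -/
structure TubeModel (k A : Type) [Field k] [Ring A] (R : Set (ModuleCat.{0} A)) (r : ℕ) where
  obj : CycRep k r → ModuleCat.{0} A
  map : ∀ {X Y : CycRep k r}, CycHom k X Y → (obj X →ₗ[A] obj Y)
  mem : ∀ X, obj X ∈ AddOfSet A R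
  surj : ∀ Y ∈ AddOfSet A R, ∃ X, Nonempty (obj X ≃ₗ[A] Y)
  bij : ∀ X Y : CycRep k r, Function.Bijective fun f : CycHom k X Y => map f
  add : ∀ (X Y : CycRep k r) (f g : CycHom k X Y), map (f + g) = map f + map g
  comp : ∀ (X Y Z : CycRep k r) (f : CycHom k X Y) (g : CycHom k Y Z),
    map (CycHom.comp k g f) = map g ∘ₗ map f

theorem IsStandardStableTube.nonempty_tubeModel [Algebra k A] {R : Set (ModuleCat.{0} A)}
    (h : IsStandardStableTube k A R r) : Nonempty (TubeModel k A R r) := by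
  obtain ⟨-, -, -, Φ, Φh, h1, h2, h3, h4, -, h6⟩ := h
  exact ⟨⟨Φ, Φh, h1, h2, h3, h4, h6⟩⟩

namespace TubeModel

variable {P R Q O : Set (ModuleCat.{0} A)} (Φ : TubeModel k A R r) {X Y Z : CycRep k r}

theorem map_zero : Φ.map (0 : CycHom k X Y) = 0 := by
  have h : (0 : CycHom k X Y) + 0 = 0 := CycHom.ext_apply fun i v => add_zero _
  have := Φ.add _ _ (0 : CycHom k X Y) 0
  rwa [h, left_eq_add] at this

theorem map_eq_zero_iff {f : CycHom k X Y} : Φ.map f = 0 ↔ f = 0 :=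
  ⟨fun h => (Φ.bij X Y).1 (h.trans Φ.map_zero.symm), fun h => h ▸ Φ.map_zero⟩

theorem exists_map_eq (u : Φ.obj X →ₗ[A] Φ.obj Y) : ∃ f : CycHom k X Y, Φ.map f = u :=
  (Φ.bij X Y).2 u

theorem map_one : Φ.map (CycHom.one X) = LinearMap.id := by
  obtain ⟨f, hf⟩ := Φ.exists_map_eq (LinearMap.id : Φ.obj X →ₗ[A] Φ.obj X)
  have : CycHom.comp k f (CycHom.one X) = CycHom.one X := (Φ.bij X X).1 <| by
    change Φ.map _ = Φ.map _
    rw [Φ.comp, hf, LinearMap.id_comp]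
  have h2 : f = CycHom.one X := (CycHom.ext_apply fun _ _ => rfl).trans this
  rw [← h2, hf]

theorem map_comp_apply (g : CycHom k Y Z) (f : CycHom k X Y) (x : Φ.obj X) :
    Φ.map g (Φ.map f x) = Φ.map (CycHom.comp k g f) x := by
  rw [Φ.comp, LinearMap.comp_apply]

theorem not_forall_subsingleton [Nontrivial (Φ.obj Y)] : ¬ ∀ i, Subsingleton (Y.V i) := fun h => by
  have h1 : CycHom.one Y = 0 := CycHom.ext_apply fun i v => Subsingleton.elim _ _
  have h2 := Φ.map_one (X := Y)
  rw [h1, Φ.map_zero] at h2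
  obtain ⟨x, hx⟩ := exists_ne (0 : Φ.obj Y)
  exact hx (LinearMap.congr_fun h2 x).symm

instance nontrivial_obj_simple (i : ZMod r) : Nontrivial (Φ.obj (CycRep.simple k i)) := by
  by_contra h
  rw [not_nontrivial_iff_subsingleton] at h
  have h1 : Φ.map (CycHom.one (CycRep.simple k i)) = 0 :=
    LinearMap.ext fun x => Subsingleton.elim _ _
  have h2 := Φ.map_eq_zero_iff.1 h1
  exact CycRep.simpleGen_ne_zero (k := k) i
    (congrArg (fun f : CycHom k _ _ => f.φ i (CycRep.simpleGen k i)) h2)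

theorem finite_obj (hs : Separation P R Q O) (X : CycRep k r) : Module.Finite A (Φ.obj X) :=
  AddOfSet.finite hs.finite (Φ.mem X)

variable [IsNoetherianRing A] [IsArtinianRing A]

theorem ker_map_eq_range_map (hs : Separation P R Q O) {α : CycHom k X Y} {β : CycHom k Y Z}
    (h : CycRep.IsExact α β) : LinearMap.ker (Φ.map β) = LinearMap.range (Φ.map α) := by
  have := Φ.finite_obj hs Y
  have hα : ∀ x, Φ.map α x ∈ LinearMap.ker (Φ.map β) := fun x => by
    rw [LinearMap.mem_ker, Φ.map_comp_apply, h.comp_eq_zero, Φ.map_zero]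
    rfl
  obtain ⟨d⟩ := exists_decomp hs.cover (len A (LinearMap.ker (Φ.map β)))
    (LinearMap.ker (Φ.map β)) le_rfl
  have hQ := d.pQ_eq_zero_of_injective (AddOfSet.hom_eq_zero hs.hom_QR d.memQ (Φ.mem Y))
    (LinearMap.ker (Φ.map β)).subtype (Submodule.injective_subtype _)
  have hO := d.pO_eq_zero_of_injective (AddOfSet.hom_eq_zero hs.hom_OR d.memO (Φ.mem Y))
    (LinearMap.ker (Φ.map β)).subtype (Submodule.injective_subtype _)
  have hKR : ∀ x, d.pP x = 0 → x.1 ∈ LinearMap.range (Φ.map α) := fun x hx => by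
    obtain ⟨W, ⟨e⟩⟩ := Φ.surj _ d.memR
    obtain ⟨γ, hγ⟩ := Φ.exists_map_eq
      ((LinearMap.ker (Φ.map β)).subtype ∘ₗ d.iR ∘ₗ e.toLinearMap)
    obtain ⟨δ, rfl⟩ := h.exists_lift γ (Φ.map_eq_zero_iff.1 (LinearMap.ext fun y => by
      rw [Φ.comp, hγ]
      exact (d.iR (e y)).2))
    have h1 : d.iR (d.pR x) = x := by simpa [hx, hQ, hO] using d.sum_eq x
    refine ⟨Φ.map δ (e.symm (d.pR x)), ?_⟩
    rw [Φ.map_comp_apply, hγ]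
    simp [h1]
  have hαP : ∀ x : LinearMap.ker (Φ.map β), x.1 ∈ LinearMap.range (Φ.map α) → d.pP x = 0 := by
    rintro ⟨_, hx⟩ ⟨y, rfl⟩
    exact LinearMap.congr_fun (AddOfSet.hom_eq_zero hs.hom_RP (Φ.mem X) d.memP
      (d.pP ∘ₗ (Φ.map α).codRestrict _ hα)) y
  set N := LinearMap.range (Φ.map α) with hN
  obtain ⟨d'⟩ := exists_decomp hs.cover (len A (Φ.obj Y ⧸ N)) (Φ.obj Y ⧸ N) le_rfl
  have hP' := d'.pP_eq_zero_of_surjective (AddOfSet.hom_eq_zero hs.hom_RP (Φ.mem Y) d'.memP)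
    N.mkQ N.mkQ_surjective
  have hO' := d'.pO_eq_zero_of_surjective (AddOfSet.hom_eq_zero hs.hom_RO (Φ.mem Y) d'.memO)
    N.mkQ N.mkQ_surjective
  have hQ' : ∀ x, d'.pQ x = 0 := by
    obtain ⟨b, hb⟩ := exists_factor_of_surjective N.mkQ N.mkQ_surjective (Φ.map β) fun y hy => by
      obtain ⟨x, rfl⟩ := (Submodule.Quotient.mk_eq_zero N).1 hy
      exact hα x
    let θ := N.mkQ ∘ₗ (LinearMap.ker (Φ.map β)).subtype
    obtain ⟨v, hv⟩ := exists_factor_of_surjective θ.rangeRestrict θ.surjective_rangeRestrict d.pP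
      fun x hx => hαP x ((Submodule.Quotient.mk_eq_zero N).1 (congrArg Subtype.val hx))
    have hu : ∀ y, d'.iQ y ∈ LinearMap.range θ := fun y => by
      obtain ⟨x, hx⟩ := N.mkQ_surjective (d'.iQ y)
      have : Φ.map β x = 0 := by
        rw [← hb, hx]
        exact LinearMap.congr_fun
          (AddOfSet.hom_eq_zero hs.hom_QR d'.memQ (Φ.mem Z) (b ∘ₗ d'.iQ)) y
      exact ⟨⟨x, this⟩, hx⟩
    intro z
    obtain ⟨x, hx⟩ := hu (d'.pQ z)
    have h1 : v ((d'.iQ.codRestrict _ hu) (d'.pQ z)) = 0 := LinearMap.congr_fun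
      (AddOfSet.hom_eq_zero hs.hom_QP d'.memQ d.memP (v ∘ₗ d'.iQ.codRestrict _ hu)) _
    have h2 : (d'.iQ.codRestrict _ hu) (d'.pQ z) = θ.rangeRestrict x := Subtype.ext hx.symm
    rw [h2, hv] at h1
    have h3 : θ x = 0 := (Submodule.Quotient.mk_eq_zero N).2 (hKR x h1)
    rw [← d'.pQ_iQ (d'.pQ z), ← hx, h3, _root_.map_zero]
  obtain ⟨W, ⟨e⟩⟩ := Φ.surj _ (d'.has_addOfSet hP' hQ' hO')
  obtain ⟨ρ, hρ⟩ := Φ.exists_map_eq (e.symm.toLinearMap ∘ₗ N.mkQ)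
  obtain ⟨δ, rfl⟩ := h.exists_desc ρ (Φ.map_eq_zero_iff.1 (LinearMap.ext fun y => by
    rw [Φ.comp, hρ]
    have : N.mkQ (Φ.map α y) = 0 := (Submodule.Quotient.mk_eq_zero N).2 ⟨y, rfl⟩
    simp [this]))
  refine le_antisymm (fun x hx => ?_) ?_
  · have h1 := LinearMap.congr_fun hρ x
    rw [Φ.comp, LinearMap.comp_apply, LinearMap.mem_ker.1 hx, _root_.map_zero] at h1
    exact (Submodule.Quotient.mk_eq_zero N).1
      (e.symm.injective (h1.symm.trans (_root_.map_zero _).symm))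
  · rintro _ ⟨x, rfl⟩
    exact hα x

end TubeModel

end Tube

section FacSub

variable {A : Type} [Ring A]
variable {X Y Z : Type} [AddCommGroup X] [Module A X] [AddCommGroup Y] [Module A Y]
  [AddCommGroup Z] [Module A Z]

variable [IsNoetherianRing A] [IsArtinianRing A]

theorem hom_eq_zero_of_fac {M : ModuleCat.{0} A} (hX : Has (Fac A M) X) (u : X →ₗ[A] Y)
    (h : ∀ f : M →ₗ[A] X, u ∘ₗ f = 0) : u = 0 := by
  obtain ⟨n, q, hq⟩ := hX
  have : u ∘ₗ q = 0 := LinearMap.pi_ext' fun i => by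
    rw [LinearMap.comp_assoc, h, LinearMap.zero_comp]
  refine LinearMap.ext fun x => ?_
  obtain ⟨y, rfl⟩ := hq x
  exact LinearMap.congr_fun this y

theorem hom_eq_zero_of_sub {M : ModuleCat.{0} A} (hX : Has (Sub M) X) (u : Y →ₗ[A] X)
    (h : ∀ f : X →ₗ[A] M, f ∘ₗ u = 0) : u = 0 :=
  LinearMap.ext fun y => (has_sub_iff.1 hX).2 _ fun f => LinearMap.congr_fun (h f) y

theorem IsSES.finite [Module.Finite A X] [Module.Finite A Z] (f : X →ₗ[A] Y) (g : Y →ₗ[A] Z)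
    (h : IsSES A f g) : Module.Finite A Y := by
  have : Module.Finite A (LinearMap.ker g) := by
    rw [← h.2.2]
    infer_instance
  have : Module.Finite A (Y ⧸ LinearMap.ker g) :=
    Module.Finite.equiv (g.quotKerEquivOfSurjective h.2.1).symm
  exact Module.Finite.of_submodule_quotient (LinearMap.ker g)

/-- The extension property of `Fac M` follows from that for extensions of `M`. -/
theorem isTorsionClass_fac_of_single (M : ModuleCat.{0} A) [Module.Finite A M]
    (h : ∀ (E : Type) [AddCommGroup E] [Module A E] [Module.Finite A E] (p : E →ₗ[A] M),
      Function.Surjective p → Has (Fac A M) (LinearMap.ker p) → Has (Fac A M) E) :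
    IsTorsionClass A (Fac A M) := by
  refine ⟨finMods_fac M, quotClosed_fac M, fun X E Z f g ⟨hf, hg, hfg⟩ hX hZ => ?_⟩
  have := finMods_fac M X hX
  have := finMods_fac M Z hZ
  have hE : Module.Finite A E := IsSES.finite f g ⟨hf, hg, hfg⟩
  have hker : ∀ y, g y = 0 → y ∈ ⨆ u : M →ₗ[A] E, LinearMap.range u := fun y hy => by
    obtain ⟨x, rfl⟩ := hfg.ge hy
    have h1 := has_fac_iff.1 (show Has (Fac A M) X from hX) x
    have h2 : (⨆ u : M →ₗ[A] X, LinearMap.range u) ≤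
        (⨆ u : M →ₗ[A] E, LinearMap.range u).comap f := iSup_le fun u => by
      rintro _ ⟨m, rfl⟩
      exact Submodule.mem_iSup_of_mem (f ∘ₗ u) ⟨m, rfl⟩
    exact h2 h1
  have hmap : (⨆ u : M →ₗ[A] Z, LinearMap.range u) ≤
      (⨆ u : M →ₗ[A] E, LinearMap.range u).map g := iSup_le fun u => by
    rintro _ ⟨m, rfl⟩
    let q : E × M →ₗ[A] Z := g ∘ₗ LinearMap.fst A E M - u ∘ₗ LinearMap.snd A E M
    let p : LinearMap.ker q →ₗ[A] M := LinearMap.snd A E M ∘ₗ (LinearMap.ker q).subtype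
    have hp : Function.Surjective p := fun m => by
      obtain ⟨e, he⟩ := hg (u m)
      exact ⟨⟨(e, m), sub_eq_zero.2 he⟩, rfl⟩
    have hX' : Has (Fac A M) (LinearMap.ker p) := by
      let v : X →ₗ[A] LinearMap.ker p := LinearMap.codRestrict _
        (LinearMap.codRestrict (LinearMap.ker q) (LinearMap.inl A E M ∘ₗ f) fun x => by
          have : g (f x) = 0 := hfg.le ⟨x, rfl⟩
          simp [q, this]) fun x => rfl
      refine quotClosed_fac M X hX (ModuleCat.of A _) v ?_
      rintro ⟨⟨⟨e, m'⟩, hq⟩, hm⟩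
      obtain rfl : m' = 0 := hm
      have hq' : g e = 0 := by simpa [q] using hq
      obtain ⟨x, rfl⟩ := hfg.ge hq'
      exact ⟨x, rfl⟩
    have h1 := has_fac_iff.1 (h _ p hp hX')
    obtain ⟨w, hw⟩ := hp m
    have h2 : (⨆ u : M →ₗ[A] LinearMap.ker q, LinearMap.range u) ≤
        (⨆ u : M →ₗ[A] E, LinearMap.range u).comap
          (LinearMap.fst A E M ∘ₗ (LinearMap.ker q).subtype) := iSup_le fun u => by
      rintro _ ⟨m, rfl⟩
      exact Submodule.mem_iSup_of_mem
        ((LinearMap.fst A E M ∘ₗ (LinearMap.ker q).subtype) ∘ₗ u) ⟨m, rfl⟩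
    refine ⟨w.1.1, h2 (h1 w), ?_⟩
    rw [← hw]
    exact sub_eq_zero.1 w.2
  refine has_fac_iff.2 fun y => ?_
  obtain ⟨y', hy', hyy⟩ := hmap (has_fac_iff.1 (show Has (Fac A M) Z from hZ) (g y))
  have := Submodule.add_mem _ (hker (y - y') (by rw [map_sub, hyy, sub_self])) hy'
  rwa [sub_add_cancel] at this

/-- The extension property of `Sub N` follows from that for extensions by `N`. -/
theorem isTorsionFreeClass_sub_of_single (N : ModuleCat.{0} A) [Module.Finite A N]
    (h : ∀ (E : Type) [AddCommGroup E] [Module A E] [Module.Finite A E] (j : N →ₗ[A] E),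
      Function.Injective j → Has (Sub N) (E ⧸ LinearMap.range j) → Has (Sub N) E) :
    IsTorsionFreeClass A (Sub N) := by
  refine ⟨finMods_sub N, subClosed_sub N, fun X E Z f g ⟨hf, hg, hfg⟩ hX hZ => ?_⟩
  have := hX.1
  have := hZ.1
  have hE : Module.Finite A E := IsSES.finite f g ⟨hf, hg, hfg⟩
  refine has_sub_iff.2 ⟨hE, fun y hy => ?_⟩
  have hgy : g y = 0 := (has_sub_iff.1 (show Has (Sub N) Z from hZ)).2 _ fun u => hy (u ∘ₗ g)
  obtain ⟨x, rfl⟩ := hfg.ge hgy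
  suffices x = 0 by rw [this, map_zero]
  refine (has_sub_iff.1 (show Has (Sub N) X from hX)).2 _ fun u => ?_
  let D : Submodule A (E × N) := LinearMap.range (f.prod (-u))
  let j : N →ₗ[A] (E × N) ⧸ D := D.mkQ ∘ₗ LinearMap.inr A E N
  have hj : Function.Injective j := (injective_iff_map_eq_zero j).2 fun n hn => by
    obtain ⟨x, hx⟩ := (Submodule.Quotient.mk_eq_zero D).1 hn
    have h1 : f x = 0 := congrArg Prod.fst hx
    have h2 : -u x = n := congrArg Prod.snd hx
    rw [← h2, (injective_iff_map_eq_zero f).1 hf x h1, map_zero, neg_zero]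
  have hZ' : Has (Sub N) (((E × N) ⧸ D) ⧸ LinearMap.range j) := by
    obtain ⟨v, hv⟩ := exists_factor_of_surjective D.mkQ D.mkQ_surjective
      (g ∘ₗ LinearMap.fst A E N) fun y hy => by
        obtain ⟨x, rfl⟩ := (Submodule.Quotient.mk_eq_zero D).1 hy
        exact hfg.le ⟨x, rfl⟩
    obtain ⟨w, hw⟩ := exists_factor_of_surjective (LinearMap.range j).mkQ
      (Submodule.mkQ_surjective _) v fun y hy => by
        obtain ⟨n, rfl⟩ := (Submodule.Quotient.mk_eq_zero (LinearMap.range j)).1 hy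
        exact (hv _).trans (map_zero g)
    refine subClosed_sub N Z hZ (ModuleCat.of A _) w
      ((injective_iff_map_eq_zero w).2 fun y hy => ?_)
    obtain ⟨y, rfl⟩ := Submodule.mkQ_surjective _ y
    obtain ⟨⟨e, n⟩, rfl⟩ := Submodule.mkQ_surjective _ y
    rw [hw, hv] at hy
    obtain ⟨x, rfl⟩ := hfg.ge hy
    refine (Submodule.Quotient.mk_eq_zero (LinearMap.range j)).2 ⟨n + u x, ?_⟩
    refine (Submodule.Quotient.eq D).2 ⟨-x, ?_⟩
    ext <;> simp
  have hE' := (has_sub_iff.1 (h _ j hj hZ')).2 (D.mkQ (f x, 0))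
    fun v => hy (v ∘ₗ D.mkQ ∘ₗ LinearMap.inl A E N)
  have h3 : j (u x) = D.mkQ (f x, 0) := (Submodule.Quotient.eq D).2 ⟨-x, by ext <;> simp⟩
  exact (injective_iff_map_eq_zero j).1 hj _ (h3.trans hE')

end FacSub

section TubeClasses

variable {k A : Type} [Field k] [Ring A] {r : ℕ}

theorem len_range_pos {M N : Type} [AddCommGroup M] [Module A M] [AddCommGroup N] [Module A N]
    [IsNoetherianRing A] [IsArtinianRing A] [Module.Finite A M] {u : M →ₗ[A] N} (hu : u ≠ 0) :
    0 < len A (LinearMap.range u) := by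
  refine Nat.pos_of_ne_zero fun h => hu ?_
  have := len_eq_zero.1 h
  exact LinearMap.ext fun x =>
    congrArg Subtype.val (Subsingleton.elim (⟨u x, x, rfl⟩ : LinearMap.range u) 0)

namespace TubeModel

variable {P R Q O : Set (ModuleCat.{0} A)} (Φ : TubeModel k A R r) {X Y Z : CycRep k r}
variable [IsNoetherianRing A] [IsArtinianRing A]

theorem exists_equiv_range (hs : Separation P R Q O) (u : Φ.obj X →ₗ[A] Φ.obj Y) :
    ∃ W, Nonempty (Φ.obj W ≃ₗ[A] LinearMap.range u) := by
  have := Φ.finite_obj hs X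
  exact Φ.surj (ModuleCat.of A (LinearMap.range u))
    (has_addOfSet_of_surjective_of_injective hs (Φ.mem X) u.rangeRestrict
      u.surjective_rangeRestrict (Φ.mem Y) (LinearMap.range u).subtype
      (Submodule.injective_subtype _))

theorem mem_of_isTorsionClass (hs : Separation P R Q O) {T : Set (ModuleCat.{0} A)}
    (hT : IsTorsionClass A T) (h : ∀ i, Φ.obj (CycRep.simple k i) ∈ T) (n : ℕ) :
    ∀ Y, len A (Φ.obj Y) ≤ n → Φ.obj Y ∈ T := by
  induction n with
  | zero =>
    intro Y hY
    have := Φ.finite_obj hs Y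
    have := len_eq_zero.1 (Nat.le_zero.1 hY)
    exact hT.zero (X := Φ.obj Y) ⟨_, h 0⟩
  | succ n ih =>
    intro Y hY
    have := Φ.finite_obj hs Y
    rcases subsingleton_or_nontrivial (Φ.obj Y) with hY0 | hY0
    · exact hT.zero (X := Φ.obj Y) ⟨_, h 0⟩
    obtain ⟨i, α, hα⟩ := CycRep.exists_hom_simple (Φ.not_forall_subsingleton (Y := Y))
    obtain ⟨Z, β, hαβ⟩ := CycRep.exists_isExact_of_injective Y α (CycRep.hom_simple_injective Y hα)
    have hker := Φ.ker_map_eq_range_map hs hαβ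
    have := Φ.finite_obj hs (CycRep.simple k i)
    have hpos := len_range_pos (mt Φ.map_eq_zero_iff.1 hα)
    have hlen := len_ker_add (Φ.map β)
    obtain ⟨W, ⟨e⟩⟩ := Φ.exists_equiv_range hs (Φ.map β)
    have h1 : Has T (LinearMap.range (Φ.map β)) := by
      refine hT.equiv (X := Φ.obj W) (ih W ?_) e
      rw [len_equiv e]
      rw [hker] at hlen
      omega
    refine hT.2.2.of_ker (Y := Φ.obj Y) (Φ.map β).rangeRestrict
      (Φ.map β).surjective_rangeRestrict ?_ h1
    rw [LinearMap.ker_rangeRestrict, hker]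
    exact hT.range (X := Φ.obj (CycRep.simple k i)) (h i) _

theorem mem_of_isTorsionFreeClass (hs : Separation P R Q O) {F : Set (ModuleCat.{0} A)}
    (hF : IsTorsionFreeClass A F) (h : ∀ i, Φ.obj (CycRep.simple k i) ∈ F) (n : ℕ) :
    ∀ Y, len A (Φ.obj Y) ≤ n → Φ.obj Y ∈ F := by
  induction n with
  | zero =>
    intro Y hY
    have := Φ.finite_obj hs Y
    have := len_eq_zero.1 (Nat.le_zero.1 hY)
    exact hF.zero (X := Φ.obj Y) ⟨_, h 0⟩
  | succ n ih =>
    intro Y hY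
    have := Φ.finite_obj hs Y
    rcases subsingleton_or_nontrivial (Φ.obj Y) with hY0 | hY0
    · exact hF.zero (X := Φ.obj Y) ⟨_, h 0⟩
    obtain ⟨i, β, hβ⟩ := CycRep.exists_hom_to_simple (Φ.not_forall_subsingleton (Y := Y))
    obtain ⟨X, α, hαβ⟩ :=
      CycRep.exists_isExact_of_surjective Y β (CycRep.hom_to_simple_surjective Y hβ)
    have hker := Φ.ker_map_eq_range_map hs hαβ
    have hpos := len_range_pos (mt Φ.map_eq_zero_iff.1 hβ)
    have hlen := len_ker_add (Φ.map β)
    obtain ⟨W, ⟨e⟩⟩ := Φ.exists_equiv_range hs (Φ.map α)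
    refine hF.2.2.of_ker (Y := Φ.obj Y) (Φ.map β).rangeRestrict
      (Φ.map β).surjective_rangeRestrict ?_ ?_
    · rw [LinearMap.ker_rangeRestrict, hker]
      refine hF.equiv (X := Φ.obj W) (ih W ?_) e
      rw [len_equiv e, ← hker]
      omega
    · exact hF.sub (X := Φ.obj (CycRep.simple k i)) (h i) (LinearMap.range (Φ.map β)).subtype
        (Submodule.injective_subtype _)

theorem isTorsionClass_fac_simple (hs : Separation P R Q O) (h1 : (1 : ZMod r) ≠ 0) (i : ZMod r) :
    IsTorsionClass A (Fac A (Φ.obj (CycRep.simple k i))) := by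
  have := Φ.finite_obj hs (CycRep.simple k i)
  have hMem := Φ.mem (CycRep.simple k i)
  refine isTorsionClass_fac_of_single _ fun E _ _ _ p hp hker => ?_
  obtain ⟨d⟩ := exists_decomp hs.cover (len A E) E le_rfl
  have vanish : ∀ (W : Type) [AddCommGroup W] [Module A W] (u : E →ₗ[A] W),
      (∀ f : Φ.obj (CycRep.simple k i) →ₗ[A] W, f = 0) → u = 0 := fun W _ _ u hW => by
    obtain ⟨v, hv⟩ := exists_factor_of_surjective p hp u fun y hy =>
      LinearMap.congr_fun (hom_eq_zero_of_fac hker (u ∘ₗ (LinearMap.ker p).subtype)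
        fun f => hW _) ⟨y, hy⟩
    exact LinearMap.ext fun y => by rw [← hv, hW v]; rfl
  have hP := vanish d.XP d.pP (AddOfSet.hom_eq_zero hs.hom_RP hMem d.memP)
  have hO := vanish d.XO d.pO (AddOfSet.hom_eq_zero hs.hom_RO hMem d.memO)
  have hQ : p ∘ₗ d.iQ = 0 := AddOfSet.hom_eq_zero hs.hom_QR d.memQ hMem _
  have hpy : ∀ y, p (d.iR (d.pR y)) = p y := fun y => by
    conv_rhs => rw [← d.sum_eq y]
    have h2 : p (d.iQ (d.pQ y)) = 0 := LinearMap.congr_fun hQ _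
    simp [hP, hO, h2]
  obtain ⟨Y, ⟨e⟩⟩ := Φ.surj _ d.memR
  obtain ⟨C, β, hC, hβ⟩ := CycRep.exists_quot_of_simple h1 Y i
  have hβ0 : β = 0 := by
    have h2 := vanish _ (Φ.map β ∘ₗ e.symm.toLinearMap ∘ₗ d.pR) fun f => by
      obtain ⟨f, rfl⟩ := Φ.exists_map_eq f
      rw [hC f, Φ.map_zero]
    refine Φ.map_eq_zero_iff.1 (LinearMap.ext fun y => ?_)
    have := LinearMap.congr_fun h2 (d.iR (e y))
    simpa [d.pR_iR] using this
  obtain ⟨f, hf⟩ := Φ.exists_map_eq (p ∘ₗ d.iR ∘ₗ e.toLinearMap)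
  have hf0 : f ≠ 0 := by
    rintro rfl
    rw [Φ.map_zero] at hf
    obtain ⟨x, hx⟩ := exists_ne (0 : Φ.obj (CycRep.simple k i))
    obtain ⟨y, rfl⟩ := hp x
    have := LinearMap.congr_fun hf (e.symm (d.pR y))
    simp only [LinearMap.comp_apply, LinearEquiv.coe_coe, LinearEquiv.apply_symm_apply, hpy] at this
    exact hx this.symm
  obtain ⟨s, hs'⟩ := hβ hβ0 f hf0
  let σ : Φ.obj (CycRep.simple k i) →ₗ[A] E := d.iR ∘ₗ e.toLinearMap ∘ₗ Φ.map s
  have hσ : ∀ x, p (σ x) = x := fun x => by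
    have := LinearMap.congr_fun hf (Φ.map s x)
    rw [Φ.map_comp_apply, hs', Φ.map_one] at this
    exact this.symm
  refine has_fac_iff.2 fun y => ?_
  have hy : p (y - σ (p y)) = 0 := by rw [map_sub, hσ, sub_self]
  have h2 : (⨆ u : Φ.obj (CycRep.simple k i) →ₗ[A] LinearMap.ker p, LinearMap.range u) ≤
      (⨆ u : Φ.obj (CycRep.simple k i) →ₗ[A] E, LinearMap.range u).comap
        (LinearMap.ker p).subtype := iSup_le fun u => by
    rintro _ ⟨m, rfl⟩
    exact Submodule.mem_iSup_of_mem ((LinearMap.ker p).subtype ∘ₗ u) ⟨m, rfl⟩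
  have h3 : y - σ (p y) ∈ ⨆ u : Φ.obj (CycRep.simple k i) →ₗ[A] E, LinearMap.range u :=
    h2 (has_fac_iff.1 hker ⟨_, hy⟩)
  have h4 : σ (p y) ∈ ⨆ u : Φ.obj (CycRep.simple k i) →ₗ[A] E, LinearMap.range u :=
    Submodule.mem_iSup_of_mem σ ⟨p y, rfl⟩
  have := Submodule.add_mem _ h3 h4
  rwa [sub_add_cancel] at this

theorem isTorsionFreeClass_sub_simple (hs : Separation P R Q O) (h1 : (1 : ZMod r) ≠ 0)
    (i : ZMod r) : IsTorsionFreeClass A (Sub (Φ.obj (CycRep.simple k i))) := by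
  have := Φ.finite_obj hs (CycRep.simple k i)
  have hMem := Φ.mem (CycRep.simple k i)
  refine isTorsionFreeClass_sub_of_single _ fun E _ _ _ j hj hZ => ?_
  obtain ⟨d⟩ := exists_decomp hs.cover (len A E) E le_rfl
  have vanish : ∀ (W : Type) [AddCommGroup W] [Module A W] (u : W →ₗ[A] E),
      (∀ f : W →ₗ[A] Φ.obj (CycRep.simple k i), f = 0) → u = 0 := fun W _ _ u hW => by
    have h2 : (LinearMap.range j).mkQ ∘ₗ u = 0 := hom_eq_zero_of_sub hZ _ fun f => hW _
    obtain ⟨v, hv⟩ := exists_factor_of_injective j hj u fun w =>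
      (Submodule.Quotient.mk_eq_zero _).1 (LinearMap.congr_fun h2 w)
    exact LinearMap.ext fun w => by rw [← hv, hW v]; exact _root_.map_zero j
  have hQ := vanish d.XQ d.iQ (AddOfSet.hom_eq_zero hs.hom_QR d.memQ hMem)
  have hO := vanish d.XO d.iO (AddOfSet.hom_eq_zero hs.hom_OR d.memO hMem)
  have hP : d.pP ∘ₗ j = 0 := AddOfSet.hom_eq_zero hs.hom_RP hMem d.memP _
  have hjx : ∀ x, d.iR (d.pR (j x)) = j x := fun x => by
    conv_rhs => rw [← d.sum_eq (j x)]
    have h2 : d.pP (j x) = 0 := LinearMap.congr_fun hP _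
    simp [hQ, hO, h2]
  obtain ⟨Y, ⟨e⟩⟩ := Φ.surj _ d.memR
  obtain ⟨B, α, hB, hα⟩ := CycRep.exists_sub_to_simple h1 Y i
  have hα0 : α = 0 := by
    have h2 := vanish _ (d.iR ∘ₗ e.toLinearMap ∘ₗ Φ.map α) fun f => by
      obtain ⟨f, rfl⟩ := Φ.exists_map_eq f
      rw [hB f, Φ.map_zero]
    refine Φ.map_eq_zero_iff.1 (LinearMap.ext fun y => ?_)
    have := congrArg d.pR (LinearMap.congr_fun h2 y)
    simpa [d.pR_iR] using this
  obtain ⟨f, hf⟩ := Φ.exists_map_eq (e.symm.toLinearMap ∘ₗ d.pR ∘ₗ j)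
  have hf0 : f ≠ 0 := by
    rintro rfl
    rw [Φ.map_zero] at hf
    obtain ⟨x, hx⟩ := exists_ne (0 : Φ.obj (CycRep.simple k i))
    have h2 : e.symm (d.pR (j x)) = 0 := (LinearMap.congr_fun hf x).symm
    rw [LinearEquiv.map_eq_zero_iff] at h2
    refine hx ((injective_iff_map_eq_zero j).1 hj x ?_)
    rw [← hjx, h2, _root_.map_zero]
  obtain ⟨t, ht⟩ := hα hα0 f hf0
  let ρ : E →ₗ[A] Φ.obj (CycRep.simple k i) := Φ.map t ∘ₗ e.symm.toLinearMap ∘ₗ d.pR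
  have hρ : ∀ x, ρ (j x) = x := fun x => by
    have : Φ.map f x = e.symm (d.pR (j x)) := LinearMap.congr_fun hf x
    change Φ.map t (e.symm (d.pR (j x))) = x
    rw [← this, Φ.map_comp_apply, ht, Φ.map_one]
    rfl
  refine has_sub_iff.2 ⟨inferInstance, fun y hy => ?_⟩
  obtain ⟨x, rfl⟩ := (Submodule.Quotient.mk_eq_zero _).1
    ((has_sub_iff.1 hZ).2 ((LinearMap.range j).mkQ y) fun f => hy (f ∘ₗ (LinearMap.range j).mkQ))
  rw [← hρ x, hy ρ, _root_.map_zero]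

/-- A torsion class of the form `Fac X` containing all quasi-simples of a tube has a nonzero
homomorphism to a module outside the tube and the class `Q`. -/
theorem not_isTorsionClass_fac (hs : Separation P R Q O) (X : ModuleCat.{0} A)
    [Module.Finite A X] (hX : IsTorsionClass A (Fac A X))
    (h : ∀ i, Φ.obj (CycRep.simple k i) ∈ Fac A X) (hXP : ∀ N ∈ P, HomZero A X N)
    (hXO : ∀ N ∈ O, HomZero A X N) : False := by
  obtain ⟨d⟩ := exists_decomp hs.cover (len A X) X le_rfl
  have hXX : X ∈ AddOfSet A {X} := AddOfSet.of_mem (Set.mem_singleton X)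
  have hP : d.pP = 0 := AddOfSet.hom_eq_zero (fun _ hM => hM ▸ hXP) hXX d.memP _
  have hO : d.pO = 0 := AddOfSet.hom_eq_zero (fun _ hM => hM ▸ hXO) hXX d.memO _
  obtain ⟨Y, ⟨e⟩⟩ := Φ.surj _ d.memR
  obtain ⟨n, hn⟩ := Y.nilp
  obtain ⟨Z, ψ, hψ, hZ⟩ := CycRep.exists_rep_of_nilpotency (k := k) n (0 : ZMod r)
  refine hψ (Φ.map_eq_zero_iff.1 (hom_eq_zero_of_fac
    (Φ.mem_of_isTorsionClass hs hX h _ Z le_rfl) _ fun f => ?_))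
  obtain ⟨φ, hφ⟩ := Φ.exists_map_eq (f ∘ₗ d.iR ∘ₗ e.toLinearMap)
  have hfQ : f ∘ₗ d.iQ = 0 := AddOfSet.hom_eq_zero hs.hom_QR d.memQ (Φ.mem Z) _
  refine LinearMap.ext fun x => ?_
  have h2 : f (d.iQ (d.pQ x)) = 0 := LinearMap.congr_fun hfQ _
  have h3 : f x = f (d.iR (d.pR x)) := by
    conv_lhs => rw [← d.sum_eq x]
    simp [hP, hO, h2]
  have h4 : Φ.map φ (e.symm (d.pR x)) = f (d.iR (d.pR x)) := by rw [hφ]; simp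
  rw [LinearMap.comp_apply, h3, ← h4, Φ.map_comp_apply, hZ Y hn φ, Φ.map_zero]
  rfl

/-- A torsionfree class of the form `Sub N` containing all quasi-simples of a tube receives a nonzero
homomorphism from a module outside the tube and the class `P`. -/
theorem not_isTorsionFreeClass_sub (hs : Separation P R Q O) (N : ModuleCat.{0} A)
    [Module.Finite A N] (hN : IsTorsionFreeClass A (Sub N))
    (h : ∀ i, Φ.obj (CycRep.simple k i) ∈ Sub N) (hQN : ∀ X ∈ Q, HomZero A X N)
    (hON : ∀ X ∈ O, HomZero A X N) : False := by
  obtain ⟨d⟩ := exists_decomp hs.cover (len A N) N le_rfl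
  have hNN : N ∈ AddOfSet A {N} := AddOfSet.of_mem (Set.mem_singleton N)
  have hQ : d.iQ = 0 :=
    AddOfSet.hom_eq_zero (fun M hM _ hN => hN ▸ hQN M hM) d.memQ hNN _
  have hO : d.iO = 0 :=
    AddOfSet.hom_eq_zero (fun M hM _ hN => hN ▸ hON M hM) d.memO hNN _
  obtain ⟨Y, ⟨e⟩⟩ := Φ.surj _ d.memR
  obtain ⟨n, hn⟩ := Y.nilp
  obtain ⟨Z, s, hs0, hZ⟩ := CycRep.exists_rep_of_nilpotency_dual (k := k) n (0 : ZMod r)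
  refine hs0 (Φ.map_eq_zero_iff.1 (hom_eq_zero_of_sub
    (Φ.mem_of_isTorsionFreeClass hs hN h _ Z le_rfl) _ fun f => ?_))
  obtain ⟨φ, hφ⟩ := Φ.exists_map_eq (e.symm.toLinearMap ∘ₗ d.pR ∘ₗ f)
  have hfP : d.pP ∘ₗ f = 0 := AddOfSet.hom_eq_zero hs.hom_RP (Φ.mem Z) d.memP _
  refine LinearMap.ext fun x => ?_
  have h2 : ∀ z, f z = d.iR (e (Φ.map φ z)) := fun z => by
    have h3 : d.pP (f z) = 0 := LinearMap.congr_fun hfP _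
    rw [hφ]
    conv_lhs => rw [← d.sum_eq (f z)]
    simp [hQ, hO, h3]
  rw [LinearMap.comp_apply, h2, Φ.map_comp_apply, hZ Y hn φ, Φ.map_zero]
  simp

end TubeModel
end TubeClasses

section Semilattice

variable {k A : Type} [Field k] [Ring A] [Algebra k A] [FiniteDimensional k A] {r : ℕ} [NeZero r]
variable {P R Q O : Set (ModuleCat.{0} A)}

theorem TubeModel.not_isJoinSemilatticePoset (Φ : TubeModel k A R r) (hs : Separation P R Q O)
    (hP : ∀ X ∈ P, Module.Finite A X) (hO : ∀ X ∈ O, Module.Finite A X)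
    (h1 : (1 : ZMod r) ≠ 0) : ¬ IsJoinSemilatticePoset (FTors A) := fun hjoin => by
  have := isNoetherianRing_of_finiteDimensional k (A := A)
  have := isArtinianRing_of_finiteDimensional k (A := A)
  have hfin := fun i => Φ.finite_obj hs (CycRep.simple k i)
  let S : ZMod r → FTors A := fun i => ⟨Fac A (Φ.obj (CycRep.simple k i)),
    Φ.isTorsionClass_fac_simple hs h1 i, _, hfin i, rfl⟩
  obtain ⟨m, ⟨hm, hmin⟩, -⟩ := hjoin (Set.range S) (Set.finite_range S)
  let C : Set (ModuleCat.{0} A) := Set.range fun i => Φ.obj (CycRep.simple k i)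
  let J := lperp A (rperp A C)
  have hJ : IsTorsionClass A J := isTorsionClass_lperp _
  have hCJ : ∀ i, Φ.obj (CycRep.simple k i) ∈ J := fun i =>
    ⟨hfin i, fun T hT f => hT.2 _ ⟨i, rfl⟩ f⟩
  have hCm : C ⊆ m.1 := by
    rintro _ ⟨i, rfl⟩
    exact hm ⟨i, rfl⟩ (self_mem_fac _)
  have hJm : J ⊆ m.1 := by
    rw [← m.2.1.lperp_rperp ⟨_, hCm ⟨0, rfl⟩⟩]
    exact fun X hX => ⟨hX.1, fun T hT f => hX.2 T ⟨hT.1, fun Z hZ => hT.2 Z (hCm hZ)⟩ f⟩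
  obtain ⟨M, hM, hmM⟩ := m.2.2
  have hMt : IsTorsionClass A (Fac A M) := hmM ▸ m.2.1
  have hne : J ≠ Fac A M := fun h => by
    have hMJ : M ∈ J := h ▸ self_mem_fac M
    refine Φ.not_isTorsionClass_fac hs M hMt (fun i => h ▸ hCJ i)
      (fun N hN => hMJ.2 N ⟨hP N hN, ?_⟩) fun N hN => hMJ.2 N ⟨hO N hN, ?_⟩
    · rintro _ ⟨i, rfl⟩
      exact AddOfSet.hom_eq_zero hs.hom_RP (Φ.mem _) (AddOfSet.of_mem hN)
    · rintro _ ⟨i, rfl⟩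
      exact AddOfSet.hom_eq_zero hs.hom_RO (Φ.mem _) (AddOfSet.of_mem hN)
  obtain ⟨T, hT, hJT, hTM⟩ := exists_intermediate_below k M hMt hJ ⟨_, hCJ 0⟩
    ((hmM ▸ hJm).ssubset_of_ne hne)
  refine hTM.ne ?_
  rw [← hmM]
  refine congrArg Subtype.val (hmin ⟨T, hT⟩ ?_ (hTM.subset.trans hmM.ge))
  rintro _ ⟨i, rfl⟩
  exact hT.1.fac_subset (hJT (hCJ i))

theorem TubeModel.not_isMeetSemilatticePoset (Φ : TubeModel k A R r) (hs : Separation P R Q O)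
    (hQ : ∀ X ∈ Q, Module.Finite A X) (hO : ∀ X ∈ O, Module.Finite A X)
    (h1 : (1 : ZMod r) ≠ 0) : ¬ IsMeetSemilatticePoset (FTors A) := fun hmeet => by
  have := isNoetherianRing_of_finiteDimensional k (A := A)
  have := isArtinianRing_of_finiteDimensional k (A := A)
  have hfin := fun i => Φ.finite_obj hs (CycRep.simple k i)
  have hsub := Φ.isTorsionFreeClass_sub_simple hs h1
  let S : ZMod r → FTors A := fun i => ⟨lperp A (Sub (Φ.obj (CycRep.simple k i))),
    isFTorsionClass_lperp_sub k _ (hsub i)⟩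
  obtain ⟨m, ⟨hm, hmax⟩, -⟩ := hmeet (Set.range S) (Set.finite_range S)
  let C : Set (ModuleCat.{0} A) := Set.range fun i => Φ.obj (CycRep.simple k i)
  let U := lperp A C
  have hU : IsTorsionClass A U := isTorsionClass_lperp _
  have hmU : m.1 ⊆ U := fun X hX => ⟨m.2.1.1 X hX, by
    rintro _ ⟨i, rfl⟩ f
    exact (hm ⟨i, rfl⟩ hX : X ∈ lperp A (Sub _)).2 _ (self_mem_sub _) f⟩
  obtain ⟨M, hM, hmM⟩ := m.2.2
  have hMt : IsTorsionClass A (Fac A M) := hmM ▸ m.2.1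
  have hne : Fac A M ≠ U := fun h => by
    obtain ⟨N, hN, hMN⟩ := exists_cogenerator k M hMt
    rw [h] at hMN
    have hNF : N ∈ rperp A U := hMN ▸ self_mem_sub N
    refine Φ.not_isTorsionFreeClass_sub hs N (hMN ▸ isTorsionFreeClass_rperp U)
      (fun i => hMN ▸ ⟨hfin i, fun T hT f => hT.2 _ ⟨i, rfl⟩ f⟩)
      (fun X hX => hNF.2 X ⟨hQ X hX, ?_⟩) fun X hX => hNF.2 X ⟨hO X hX, ?_⟩
    · rintro _ ⟨i, rfl⟩
      exact AddOfSet.hom_eq_zero hs.hom_QR (AddOfSet.of_mem hX) (Φ.mem _)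
    · rintro _ ⟨i, rfl⟩
      exact AddOfSet.hom_eq_zero hs.hom_OR (AddOfSet.of_mem hX) (Φ.mem _)
  obtain ⟨E, hE, hEt, hME, hEU⟩ := exists_intermediate k M hMt hU ((hmM ▸ hmU).ssubset_of_ne hne)
  refine hME.ne ?_
  rw [← hmM]
  refine (congrArg Subtype.val (hmax ⟨Fac A E, hEt, E, hE, rfl⟩ ?_ (hmM.le.trans hME.subset))).symm
  rintro _ ⟨i, rfl⟩ X hX
  refine ⟨finMods_fac E X hX, fun T hT f => ?_⟩
  exact hom_eq_zero_of_sub (X := T) hT f fun g => (hEU hX).2 _ ⟨i, rfl⟩ (g ∘ₗ f)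

end Semilattice

/-- **Proposition 2.11.** Let `Λ` be a finite dimensional algebra such that the
indecomposable finite dimensional `Λ`-modules are the disjoint union `𝒫 ∪ ℛ ∪ 𝒬`,
where `ℛ` is a family of stable standard pairwise orthogonal tubes,
`Hom(ℛ, 𝒫) = 0`, `Hom(𝒬, ℛ) = 0` and `Hom(𝒬, 𝒫) = 0`. If some tube of `ℛ` has rank
`r ≥ 2`, then `ftors Λ` is neither a join-semilattice nor a meet-semilattice. -/
theorem separating_tubular_family_not_semilattice (k Λ : Type) [Field k] [IsAlgClosed k]
    [Ring Λ] [Algebra k Λ] [FiniteDimensional k Λ]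
    (J : Type) (R : J → Set (ModuleCat.{0} Λ)) (rk : J → ℕ)
    (P Q : Set (ModuleCat.{0} Λ))
    (hP : ∀ X ∈ P, Module.Finite Λ X ∧ Indecomp Λ X)
    (hQ : ∀ X ∈ Q, Module.Finite Λ X ∧ Indecomp Λ X)
    (htube : ∀ j, IsStandardStableTube k Λ (R j) (rk j))
    (hcover : ∀ X : ModuleCat.{0} Λ, Module.Finite Λ X → Indecomp Λ X →
      X ∈ P ∨ X ∈ Q ∨ ∃ j, X ∈ R j)
    (hPQ : P ∩ Q = ∅) (hPR : ∀ j, P ∩ R j = ∅) (hQRdisj : ∀ j, Q ∩ R j = ∅)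
    (hRR : ∀ i j, i ≠ j → R i ∩ R j = ∅)
    (horth : ∀ i j, i ≠ j → ∀ X ∈ R i, ∀ Y ∈ R j, HomZero Λ X Y)
    (hRP : ∀ j, ∀ X ∈ R j, ∀ Y ∈ P, HomZero Λ X Y)
    (hQR : ∀ j, ∀ X ∈ Q, ∀ Y ∈ R j, HomZero Λ X Y)
    (hQP : ∀ X ∈ Q, ∀ Y ∈ P, HomZero Λ X Y)
    (hrank : ∃ j, 2 ≤ rk j) :
    ¬ IsJoinSemilatticePoset (FTors Λ) ∧ ¬ IsMeetSemilatticePoset (FTors Λ) := by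
  obtain ⟨j, hj⟩ := hrank
  have : NeZero (rk j) := ⟨by omega⟩
  have : Fact (1 < rk j) := ⟨hj⟩
  have h1 : (1 : ZMod (rk j)) ≠ 0 := one_ne_zero
  let O : Set (ModuleCat.{0} Λ) := {X | ∃ i, i ≠ j ∧ X ∈ R i}
  have hs : Separation P (R j) Q O :=
    { cover := fun X hX hX' => by
        rcases hcover X hX hX' with h | h | ⟨i, h⟩
        · exact Or.inl h
        · exact Or.inr (Or.inr (Or.inl h))
        · by_cases hij : i = j
          · exact Or.inr (Or.inl (hij ▸ h))
          · exact Or.inr (Or.inr (Or.inr ⟨i, hij, h⟩))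
      finite := fun X hX => ((htube j).2.1 X hX).1
      hom_RP := hRP j
      hom_QR := hQR j
      hom_QP := hQP
      hom_RO := fun X hX Y ⟨i, hi, hY⟩ => horth j i hi.symm X hX Y hY
      hom_OR := fun X ⟨i, hi, hX⟩ Y hY => horth i j hi X hX Y hY }
  have hO : ∀ X ∈ O, Module.Finite Λ X := fun X ⟨i, _, hX⟩ => ((htube i).2.1 X hX).1
  obtain ⟨Φ⟩ := (htube j).nonempty_tubeModel
  exact ⟨Φ.not_isJoinSemilatticePoset hs (fun X hX => (hP X hX).1) hO h1,
    Φ.not_isMeetSemilatticePoset hs (fun X hX => (hQ X hX).1) hO h1⟩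

end TorsionLattice
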